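/- For every n ≥ 9, no Condorcet domain on an n-element set is (5,17)-abundant: every Condorcet domain D on an n-element set X (n ≥ 9) has a 5-element subset A ⊆ X such that the restriction of D to A contains at most 16 distinct linear orders. -/

import Mathlib

/-- `r` is a strict total order on `X`, supported on `X` (i.e. `r` never relates
elements outside `X`). -/
def IsLinearOrderOn {α : Type*} (X : Set α) (r : α → α → Prop) : Prop :=
  (∀ a b, r a b → a ∈ X ∧ b ∈ X) ∧
  (∀ a ∈ X, ¬ r a a) ∧
  (∀ a ∈ X, ∀ b ∈ X, ∀ c ∈ X, r a b → r b c → r a c) ∧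
  (∀ a ∈ X, ∀ b ∈ X, a ≠ b → r a b ∨ r b a)

/-- A domain on `X` is a set of linear orders on `X`. -/
def IsDomainOn {α : Type*} (X : Set α) (D : Set (α → α → Prop)) : Prop :=
  ∀ r ∈ D, IsLinearOrderOn X r

/-- The restriction of the order `r` to the subset `A`. -/
def restrictRel {α : Type*} (A : Set α) (r : α → α → Prop) : α → α → Prop :=
  fun a b => a ∈ A ∧ b ∈ A ∧ r a b

/-- The restriction of the domain `D` to the subset `A`: the set of linear orders
on `A` induced by the orders in `D`. -/
def restrictDom {α : Type*} (A : Set α) (D : Set (α → α → Prop)) :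
    Set (α → α → Prop) :=
  restrictRel A '' D

/-- `D` is `(k,s)`-abundant on `X`: its restriction to every `k`-element subset of `X`
contains at least `s` distinct linear orders. -/
def IsAbundant {α : Type*} (X : Set α) (D : Set (α → α → Prop)) (k s : ℕ) : Prop :=
  ∀ A : Set α, A ⊆ X → A.ncard = k → s ≤ (restrictDom A D).ncard

/-- `D` is exactly `(k,s)`-abundant: `(k,s)`-abundant but not `(k,s+1)`-abundant. -/
def IsExactlyAbundant {α : Type*} (X : Set α) (D : Set (α → α → Prop)) (k s : ℕ) : Prop :=
  IsAbundant X D k s ∧ ¬ IsAbundant X D k (s + 1)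

/-- The number of orders in the profile `R` that rank `a` above `b`. -/
noncomputable def majCount {α : Type*} (R : List (α → α → Prop)) (a b : α) : ℕ :=
  Nat.card {i : Fin R.length // (R.get i) a b}

/-- More than half of the orders in the profile `R` rank `a` above `b`. -/
def MajPrefers {α : Type*} (R : List (α → α → Prop)) (a b : α) : Prop :=
  R.length < 2 * majCount R a b

/-- `D` is a Condorcet domain on `X`: it is a domain on `X` and for every profile
(list of orders from `D`) of odd length, the majority relation is transitive on `X`. -/
def IsCondorcetDomain {α : Type*} (X : Set α) (D : Set (α → α → Prop)) : Prop :=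
  IsDomainOn X D ∧
  ∀ R : List (α → α → Prop), (∀ r ∈ R, r ∈ D) → Odd R.length →
    ∀ a ∈ X, ∀ b ∈ X, ∀ c ∈ X,
      MajPrefers R a b → MajPrefers R b c → MajPrefers R a c

/-- A maximal Condorcet domain on `X`. -/
def IsMaximalCondorcetDomain {α : Type*} (X : Set α) (D : Set (α → α → Prop)) : Prop :=
  IsCondorcetDomain X D ∧
  ∀ D' : Set (α → α → Prop), D ⊆ D' → IsCondorcetDomain X D' → D' = D

namespace CD
def PT : List Nat := [0, 1, 3, 4, 6, 7, 11, 15, 20, 22, 30, 31, 32, 33, 41, 43, 48, 52, 56, 57,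
  59, 60, 62, 63, 75, 79, 95, 107, 123, 127, 148, 150, 158, 180, 188, 190, 222, 223, 254, 255,
  288, 289, 297, 304, 312, 313, 361, 363, 377, 379, 432, 436, 440, 444, 504, 505, 507, 508, 510,
  511, 512, 513, 515, 516, 518, 519, 579, 583, 587, 591, 644, 646, 660, 662, 710, 711, 719, 726,
  734, 735, 768, 769, 800, 801, 833, 835, 843, 865, 873, 875, 896, 900, 916, 928, 944, 948, 960,
  961, 963, 964, 966, 967, 971, 975, 980, 982, 990, 991, 992, 993, 1001, 1003, 1008, 1012, 1016,
  1017, 1019, 1020, 1022, 1023]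
def cB : Nat := nat_lit 0xffffffffffffffffffffffffffffffffffffffffffffffffffffffffffffffffffffffffffffffffffffffffffffffffffffffffffffffffffffffffffffffffffffffffffffffffffffffffffffffffffffffffffffffffffffffffffffffffffffffff
def cH : Nat := nat_lit 0x6f6f6f6f6f6f6f6f6f6f6f6f6f6f6f6f6f6f6f6f6f6f6f6f6f6f6f6f6f6f6f6f6f6f6f6f6f6f6f6f6f6f6f6f6f6f6f6f6f6f6f6f6f6f6f6f6f6f6f6f6f6f6f6f6f6f6f6f6f6f6f6f6f6f6f6f6f6f6f6f6f6f6f6f6f6f6f6f6f6f00000000000000000000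
def cI : Nat := nat_lit 0x7f7f7f7f7f7f7f7f7f7f7f7f7f7f7f7f7f7f7f7f7f7f7f7f7f7f7f7f7f7f7f7f7f7f7f7f7f7f7f7f7f7f7f7f7f7f7f7f7f7f7f7f7f7f7f7f7f7f7f7f7f7f7f7f7f7f7f7f7f7f7f7f7f7f7f7f7f7f7f7f7f7f7f7f7f7f7f7f7f7f00000000000000000000
def cK : Nat := nat_lit 0x80808080808080808080808080808080808080808080808080808080808080808080808080808080808080808080808080808080808080808080808080808080808080808080808080808080808080808080808080808080808000000000000000000000
def cC : Nat := nat_lit 0x7f7f7f7f7f7f7f7f7f807f7f7f7f7f7f7f7f7f807f7f7f7f7f7f7f7f7f807f7f7f7f7f7f7f7f7f807f7f7f7f7f7f7f7f7f807f7f7f7f7f7f7f7f7f807f7f7f7f7f7f7f7f7f807f7f7f7f7f7f7f7f7f807f7f7f7f7f7f7f7f7f8000000000000000000000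
def cG : Nat := nat_lit 0x100000000000000000001000000000000000000010000000000000000000100000000000000000001000000000000000000010000000000000000000100000000000000000001000000000000000000010000000000000000000000000000000000000000
def cR : Nat := nat_lit 0x1000000000000000000010000000000000000000100000000000000000001000000000000000000010000000000000000000100000000000000000001000000000000000000010000000000000000000100000000000000000001
def cM : Nat := nat_lit 0x7fffffffffffffffffff
def cF : Nat := nat_lit 0xffffffffffffffff0000ffffffffffffffff0000ffffffffffffffff0000ffffffffffffffff0000ffffffffffffffff0000ffffffffffffffff0000ffffffffffffffff0000ffffffffffffffff0000ffffffffffffffff0000ffffffffffffffff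
def cO : Nat := nat_lit 0x1000000000000000000010000000000000000000100000000000000000001000000000000000000010000000000000000000100000000000000000001000000000000000000010000000000000000000100000000000000000000
def CLS : List (List Nat) := [[3114772374, 2809001855, 2809001891, 3114299937, 3114772734,
  3114299982, 3114772779, 206726440, 2809004775, 1737557844, 2809001895, 2809004811], [3114772321,
  1737557750, 1737557786, 206254786, 206727583, 206254831, 206727223, 206727628, 1737560670,
  2808942819, 1737557790, 1737560706], [3114709225, 2809130659], [3114709270], [3114521498,
  3114521462, 1839065987, 3114524414, 513368625, 257804230, 2808720634, 2809193431, 2808720679,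
  2809193071, 2808721084, 2809193476, 3114524382, 1584030363, 3114521502, 3114524418],
  [3114583058, 576631163, 1945096607, 1945568999, 576628283, 576631199, 3114576497, 3114635546,
  3114642107, 3114577226, 3114636275, 1945096247, 1945568639, 1945096652, 1945569044, 2808671592,
  2808724080, 2808672240, 576631167, 576628287, 576631203, 2808671597, 2808724085, 2808672245],
  [3114285302, 3114285266, 1137285866, 1839184085, 2808720632, 2149716296, 2809193429, 3114288218,
  2808720677, 2809193069, 2808721082, 2809193474, 513371541, 3114288186, 1584030768, 3114285306,
  3114288222, 257804234], [3114641837, 2583035354, 3114635276, 3114582788, 3114636005, 2583006194,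
  2583301439, 2583038999, 2281772937, 2808719652, 742223604, 1214383694, 1214357774, 1214384018,
  1214357775, 2808667169, 2808719657, 2808667817], [3114770863, 1737675848, 1737675884,
  3114770872, 1737675852, 1737678768, 2808942972, 2808942981, 1737675888, 1737678804, 206254790,
  206727182, 206727587, 206254835, 206727227, 206727632], [3114772373, 2808706610, 1214344730,
  3114299936, 2582841440, 3114772733, 2808706646, 3114299981, 3114772778, 206730085, 2808709530,
  1737558168, 2808706650, 2808709566], [3114580547, 3114580511, 1839125036, 3114583463, 513367896,
  257804229, 2808720633, 2809193430, 2808720678, 2809193070, 2808721083, 2809193475, 3114583431,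
  1584030444, 3114580551, 3114583467], [3114639596, 3114639560, 257804228, 1838829791, 3114642512,
  513367167, 513367176, 3114639564, 3114642480, 1584030516, 1584030525, 3114639600, 3114642516,
  2808720638, 2809193030, 2809193435, 2808720683, 2809193075, 2808721088, 2809193480],
  [3114679736, 2532844424, 2583083459, 3064090781, 2370504386, 2370507302, 2370504422, 2859154635,
  789248479, 1214397310, 789248884, 789721276, 789248524, 789720916, 789721321, 2370507306,
  1264870518, 2370504426, 2370507342, 2808680461], [3114639884, 619458536, 513367166, 1945096193,
  1838829863, 3114642800, 576628256, 619458545, 513367175, 257803508, 3114639920, 1902560502,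
  1902560511, 1583735271, 3114639888, 3114642804, 1583735280, 3114639924, 3114642840, 2808724283,
  2809196675, 2808724688, 2809197080, 2808724328, 2809196720, 2809197125], [3114443540,
  2306455418, 3064089323, 2583201557, 2532847340, 2370268190, 2370271106, 767968967, 789248477,
  789248882, 789721274, 2370268226, 789248522, 789720914, 789721319, 2859154068, 2808680459,
  2370271110, 1264870923, 2370268230, 2370271146, 1214397314], [3114771590, 2532810890,
  2583135947, 3064096613, 1737617204, 1737620120, 1737617240, 206257701, 1214344821, 2859207204,
  206258106, 206730498, 206257746, 206730138, 206730543, 1737620124, 1264844355, 2808706704,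
  1737617244, 1737620160], [3114775569, 210783314, 1750037358, 2809005909], [3114524693,
  1839066050, 257803519, 2808724693], [3114574769, 738171090, 2583332786, 2808667326, 2268881061,
  1214384181], [3114272305, 2808732296], [3114577514, 2808669198], [3114272143, 1137312109,
  2808733754, 2149749101], [3114583742, 1839125099, 257803518, 2808724692], [3114288254,
  1839184391, 2808720317, 257807897], [3114252947, 1137331307, 2149727231, 2808696575],
  [3114577523, 2808669189], [3114587072, 2808714072], [3114259021, 1137338353, 2808746876,
  2149781906, 2141633414, 1120336675], [3114587891, 2583306542, 2808713253, 1214351376],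
  [3114548525, 2583286859, 2808693570, 1214371059], [3114561647, 789248925, 2583319664,
  2370389240, 2808680448, 1214397303], [3114288497, 1839184148, 2808724691, 257803523],
  [3114275222, 2808673652], [3114288668, 1839184319, 2808723224, 257802056], [3114679747,
  2808916648], [3114573869, 2808668874], [3114706314, 2809012147], [3114705575, 2808716992],
  [3114705576, 2809012237], [3114272144, 1137312110, 2808674705, 2149690052], [3114288092,
  1839183986, 2808721775, 257804981], [3114524288, 2808721777], [3114642881, 1838829944,
  257802779, 2808723959], [3114770141, 2583132311, 1214344488, 2808706857, 1737735306, 206730097],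
  [3114576065, 742223927, 2808668622, 2281481337], [3114275546, 2808677297], [3114255863,
  2808696980], [3114576776, 2808669288], [3114772329, 206726449, 2809001859, 1737557835],
  [3114725672, 2583109712, 1214371056, 2808693573], [3114724214, 2583106067, 1214370732,
  2808693735], [3114576785, 2808669279], [3114576047, 2808668640], [3114576056, 2808668631],
  [3114301790, 2808710102, 1482587444, 461344004], [3114706313, 2808716902], [3114642890,
  1838829980, 257802824, 2808723950], [3114578009, 2808671376], [3114524306, 1839065933,
  2808721759, 257805013], [3114300332, 2808709535, 1482587120, 461346920], [3114288101,
  1839183995, 2808721766, 257804972], [3114772328, 2583136685, 1214344731, 206730094, 2808706614,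
  1737558159], [3114642404, 1838829737, 257805011, 2808721763], [3114583355, 1839124982,
  2808721758, 257805012], [3114576542, 2808670818], [3114578000, 2808671385], [3114574355,
  2808671061], [3114577271, 2808671466], [3114577280, 2808671457], [3114443551, 2808916646],
  [3114577595, 2808668469], [3114573950, 2808668145], [3114772330, 2808942810], [3114524468,
  2583238745, 1839066338, 2808720301, 257807929, 1214357452], [3114275258, 2808673697],
  [3114576821, 2808669324], [3114576794, 2808669270], [3114524297, 2808721768], [3114495218,
  2808687829], [3114288182, 1839184076, 2808721037, 257804243], [3114272306, 2808673247],
  [3114583337, 2808721776], [3114771599, 2583135956, 1214344812, 206730093, 2808706695,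
  1737617208], [3114642566, 2583002549, 1838830142, 257807927, 1214357450, 2808720305],
  [3114738796, 2808916647], [3114672368, 2808864979], [3114672370, 2809101175], [3114524378,
  2808721039], [3114298874, 1137298502, 2149700987, 2808709697, 1482587525, 461349836],
  [3114672369, 2809160224], [3114672365, 2808687832], [3114738794, 2583142517, 2370566387,
  1214397300, 789248928, 2808680451], [3114679746, 2808975697], [3114554267, 2808687828],
  [3114738795, 2808975696], [3114775244, 2583135227, 1750036692, 2808707019], [3114583346,
  2808721767], [3114576866, 2808668550], [3114576137, 2808667902], [3114583427, 2808721038],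
  [3114771600, 2809001940], [3114443550, 2808975695]]
def strictL {α : Type} (n : Nat) (k : Nat → α) : α := Nat.rec (k (nat_lit 0)) (fun m _ => k m) (Nat.succ n)
def fr {α β : Type} (f : α → β → β) (z : β) (l : List α) : β := List.rec z (fun a _ ih => f a ih) l
def ite' {α : Type} (b : Bool) (t e : α) : α := Bool.rec e t b
/-- force the spine of a list and its elements -/
def fcs {α γ : Type} (f : α → (α → γ) → γ) (l : List α) : (List α → γ) → γ :=
  List.rec (fun k => k []) (fun h _ ih k => f h fun h' => ih fun t' => k (h' :: t')) l
def fc0 {α γ : Type} (a : α) (k : α → γ) : γ := k a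

/-- flags -/
def fl (x : Nat) : Nat :=
  Nat.mod (Nat.land (Nat.add (Nat.land (Nat.add (Nat.mod x cB) cH) cK) cC) cG) cM

def flN (x : Nat) : Nat :=
  Nat.mod (Nat.land (Nat.add (Nat.land (Nat.add (Nat.mod x cB) cI) cK) cC) cG) cM

/-- bits of a code -/
def bt (c i : Nat) : Bool := Nat.beq (Nat.land (Nat.shiftRight c i) 1) 1
def b2n (b : Bool) : Nat := ite' b 1 0
def satc (a b c : Bool) (l : Nat) : Bool :=
  ite' (Nat.beq (Nat.div l 3) 0) (!(Nat.beq (Nat.add (b2n (!a)) (b2n (!b))) (Nat.mod l 3)))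
  (ite' (Nat.beq (Nat.div l 3) 1) (!(Nat.beq (Nat.add (b2n a) (b2n (!c))) (Nat.mod l 3)))
   (!(Nat.beq (Nat.add (b2n b) (b2n c)) (Nat.mod l 3))))
def row (g : Bool) (a b c : Bool) : Nat :=
  fr (fun l ih => Nat.lor (ite' (Bool.xor g (satc a b c l)) (Nat.shiftLeft 1 (Nat.mul 80 (Nat.succ l))) 0) ih) 0
    [0, 1, 2, 3, 4, 5, 6, 7, 8]
def sel (r0 r1 r2 r3 r4 r5 r6 r7 : Nat) (a b c : Bool) : Nat :=
  ite' a (ite' b (ite' c r7 r6) (ite' c r5 r4)) (ite' b (ite' c r3 r2) (ite' c r1 r0))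
def horner (f : Nat → Nat) (l : List Nat) : Nat :=
  fr (fun c ih => Nat.lor (f c) (Nat.shiftLeft ih 800)) 0 l
/-- the ten position triples of a 5-tuple, as three pair indices -/
def posT : List (Nat × Nat × Nat) :=
  [(0,1,2),(0,3,4),(1,3,5),(2,4,5),(0,6,7),(1,6,8),(2,7,8),(3,6,9),(4,7,9),(5,8,9)]
def WSP (g : Bool) (k : List Nat → Bool) : Bool :=
  strictL (row g false false false) fun r0 => strictL (row g false false true) fun r1 =>
  strictL (row g false true false) fun r2 => strictL (row g false true true) fun r3 =>
  strictL (row g true false false) fun r4 => strictL (row g true false true) fun r5 =>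
  strictL (row g true true false) fun r6 => strictL (row g true true true) fun r7 =>
  fcs strictL (fr (fun t ih => horner (fun c => sel r0 r1 r2 r3 r4 r5 r6 r7 (bt c t.1) (bt c t.2.1) (bt c t.2.2)) PT :: ih) [] posT) k
def ONE0 : Nat := horner (fun _ => cO) PT
def ON : Nat := Nat.lor 0xffffffffffffffff (Nat.shiftLeft (horner (fun _ => nat_lit 0x1010101010101010101) PT) 800)
def pick (o : Nat) (W : List Nat) (t : Nat) : List Nat → Nat :=
  List.rec (fun _ => o) (fun w _ ih A => List.rec o (fun a A' _ => ite' (Nat.beq a t) w (ih A')) A) W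
def junk (t : Nat) : Nat :=
  Nat.sub cF (fr (fun l ih => Nat.add (Nat.shiftLeft 1 (Nat.mod (Nat.div (Nat.add (Nat.mul t 7919) (Nat.mul l 104729)) 16) 64)) (Nat.shiftLeft ih 80)) 0
    [1, 2, 3, 4, 5, 6, 7, 8, 9, 10])
def mkT (o : Nat) (W : List Nat) (C : List (List Nat)) (t : Nat) : Nat :=
  Nat.lor (junk t) (Nat.shiftLeft (fr (fun A ih => Nat.lor (pick o W t A) (Nat.shiftLeft ih 8)) 0 C) 800)
/-- table whose junk part stays below the counters -/
def mkN (o : Nat) (W : List Nat) (C : List (List Nat)) (t : Nat) : Nat :=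
  Nat.lor (Nat.mod (junk t) (nat_lit 18446744073709551616)) (Nat.shiftLeft (fr (fun A ih => Nat.lor (pick o W t A) (Nat.shiftLeft ih 8)) 0 C) 800)
def tc (a b c : Nat) : Nat := Nat.add a (Nat.add (Nat.mul 16 b) (Nat.mul 256 c))
def t10 (a b c d e : Nat) : List Nat :=
  [tc a b c, tc a b d, tc a c d, tc b c d, tc a b e, tc a c e, tc b c e, tc a d e, tc b d e, tc c d e]
def C1 : List (List Nat) := [t10 0 1 2 4 5, t10 0 1 3 4 5, t10 0 2 3 4 5, t10 1 2 3 4 5,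
  t10 0 1 2 4 5, t10 0 1 2 4 5, t10 0 1 2 4 5, t10 0 1 2 4 5, t10 0 1 2 4 5, t10 0 1 2 4 5]
def C2 : List (List Nat) := [t10 0 1 2 5 6, t10 0 1 3 5 6, t10 0 2 3 5 6, t10 1 2 3 5 6,
  t10 0 1 4 5 6, t10 0 2 4 5 6, t10 1 2 4 5 6, t10 0 3 4 5 6, t10 1 3 4 5 6, t10 2 3 4 5 6]
def C3 : List (List Nat) := [t10 0 1 5 6 7, t10 0 2 5 6 7, t10 1 2 5 6 7, t10 0 3 5 6 7,
  t10 1 3 5 6 7, t10 2 3 5 6 7, t10 0 4 5 6 7, t10 1 4 5 6 7, t10 2 4 5 6 7, t10 3 4 5 6 7]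
def C4 : List (List Nat) := [t10 0 5 6 7 8, t10 1 5 6 7 8, t10 2 5 6 7 8, t10 3 5 6 7 8,
  t10 4 5 6 7 8, t10 0 5 6 7 8, t10 0 5 6 7 8, t10 0 5 6 7 8, t10 0 5 6 7 8, t10 0 5 6 7 8]

def fold (tabs : List Nat) : List Nat → Nat → Nat :=
  List.rec (fun _ m => m) (fun t _ ih ls m => List.rec m (fun s ls' _ => ih ls' (Nat.land m (Nat.shiftRight t s))) ls) tabs

def srch {β : Type} (L : Nat → List Nat → List β → List β) (ts : List Nat) : Nat → List Nat → List β → List β :=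
  List.rec L
    (fun t _ ih m path tail =>
      strictL (fl (Nat.shiftRight (Nat.land (Nat.mul m cR) t) (nat_lit 800))) (Nat.rec (fun _ => tail)
        (fun _ lih f => Bool.rec
          (strictL (Nat.log2 f) fun b => strictL (Nat.mul (nat_lit 80) (Nat.pred b)) fun s =>
            strictL (Nat.land m (Nat.shiftRight t s)) fun m' =>
              ih m' (s :: path) (strictL (Nat.sub f (Nat.shiftLeft (nat_lit 1) b)) lih))
          tail (Nat.beq f (nat_lit 0))) (nat_lit 9))) ts
/-- is the law `s / 80` the least one not excluded by the mask -/
def nok1 (w n s : Nat) : Bool :=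
  ite' (Nat.beq s (nat_lit 80)) true (strictL (flN (Nat.land w n)) fun f => strictL (Nat.shiftLeft (nat_lit 2) (Nat.div s (nat_lit 80))) fun q =>
    Nat.beq (Nat.mod f q) (Nat.sub q (nat_lit 4)))
def nokL (w : Nat) (ns : List Nat) : List Nat → Bool :=
  List.rec (fun _ => true) (fun n _ ih ls => List.rec true (fun s ls' _ => ite' (nok1 w n s) (ih ls') false) ls) ns

def bsrch (ts : List (Nat × Nat × (List Nat → Bool))) : Nat → List Nat → Bool :=
  List.rec (fun _ _ => false)
    (fun t _ ih m path =>
      strictL (Nat.land (fl (Nat.shiftRight (Nat.land (Nat.mul m cR) t.1) (nat_lit 800))) t.2.1) (Nat.rec (fun _ => true)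
        (fun _ lih f => Bool.rec
          (strictL (Nat.log2 f) fun b => strictL (Nat.mul (nat_lit 80) (Nat.pred b)) fun s =>
              ite' (ite' (t.2.2 (s :: path)) true
                (strictL (Nat.land m (Nat.shiftRight t.1 s)) fun m' => ih m' (s :: path)))
              (strictL (Nat.sub f (Nat.shiftLeft (nat_lit 1) b)) lih) false)
          true (Nat.beq f (nat_lit 0))) (nat_lit 9))) ts

structure URec where
  (y : List Nat) (a5 a6 b1 b2 b3 : Nat)
structure ERec where
  (y : List Nat) (e12 e13 e23 : Nat)

/-- all tables, forced -/
structure Tabs where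
  (on : Nat)
  (n1 n5 n6 nx : List Nat)
  (b1q b1t s1 y1 : List Nat)  -- C1: Q0 triples, (ab4), (ab5), (a45)
  (b2q b2t s25 y25 s26 y26 x2 : List Nat) -- C2: Q0, (ab4), (ab5),(a45)rev,(ab6),(a46)rev,(a56)
  (s35 y35 s36 y36 s37 y37 x56 x57 x67 : List Nat) (t567 : Nat) -- C3
  (k56 k57 k58 k67 k68 k78 : List Nat) (q567 q568 q578 q678 : Nat) -- C4

def mkL (o : Nat) (W : List Nat) (C : List (List Nat)) (ts : List Nat) (k : List Nat → Bool) : Bool :=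
  fcs strictL (fr (fun t ih => mkT o W C t :: ih) [] ts) k
def mkNL (o : Nat) (W : List Nat) (C : List (List Nat)) (ts : List Nat) (k : List Nat → Bool) : Bool :=
  fcs strictL (fr (fun t ih => mkN o W C t :: ih) [] ts) k
def tq : List Nat := [tc 0 1 2, tc 0 1 3, tc 0 2 3, tc 1 2 3]
def ts (e : Nat) : List Nat := [tc 0 1 e, tc 0 2 e, tc 1 2 e, tc 0 3 e, tc 1 3 e, tc 2 3 e]
def ty (d e : Nat) : List Nat := [tc 2 d e, tc 0 d e, tc 1 d e, tc 3 d e]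
def tyr (d e : Nat) : List Nat := [tc 3 d e, tc 1 d e, tc 0 d e, tc 2 d e]
def tx (d e : Nat) : List Nat := [tc 2 d e, tc 0 d e, tc 1 d e, tc 3 d e, tc 4 d e]
def txr (d e : Nat) : List Nat := [tc 4 d e, tc 3 d e, tc 1 d e, tc 0 d e, tc 2 d e]
def mkTabs (k : Tabs → Bool) : Bool :=
  WSP false fun W => WSP true fun W' => strictL ONE0 fun o => strictL ON fun on =>
  mkNL o W' C1 (tyr 4 5) fun n1 => mkNL o W' C2 (tyr 4 5) fun n5 => mkNL o W' C2 (tyr 4 6) fun n6 => mkNL o W' C2 (txr 5 6) fun nx =>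
  mkL o W C1 tq fun b1q => mkL o W C1 (ts 4) fun b1t => mkL o W C1 (ts 5) fun s1 => mkL o W C1 (ty 4 5) fun y1 =>
  mkL o W C2 tq fun b2q => mkL o W C2 (ts 4) fun b2t => mkL o W C2 (ts 5) fun s25 => mkL o W C2 (tyr 4 5) fun y25 =>
  mkL o W C2 (ts 6) fun s26 => mkL o W C2 (tyr 4 6) fun y26 => mkL o W C2 (tx 5 6) fun x2 =>
  mkL o W C3 (ts 5) fun s35 => mkL o W C3 (tyr 4 5) fun y35 =>
  mkL o W C3 (ts 6) fun s36 => mkL o W C3 (tyr 4 6) fun y36 =>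
  mkL o W C3 (ts 7) fun s37 => mkL o W C3 (tyr 4 7) fun y37 =>
  mkL o W C3 (txr 5 6) fun x56 => mkL o W C3 (txr 5 7) fun x57 => mkL o W C3 (txr 6 7) fun x67 =>
  strictL (mkN o W C3 (tc 5 6 7)) fun t567 =>
  mkL o W C4 (txr 5 6) fun k56 => mkL o W C4 (txr 5 7) fun k57 => mkL o W C4 (txr 5 8) fun k58 =>
  mkL o W C4 (txr 6 7) fun k67 => mkL o W C4 (txr 6 8) fun k68 => mkL o W C4 (txr 7 8) fun k78 =>
  strictL (mkT o W C4 (tc 5 6 7)) fun q567 => strictL (mkT o W C4 (tc 5 6 8)) fun q568 =>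
  strictL (mkT o W C4 (tc 5 7 8)) fun q578 => strictL (mkT o W C4 (tc 6 7 8)) fun q678 =>
  k ⟨on, n1, n5, n6, nx, b1q, b1t, s1, y1, b2q, b2t, s25, y25, s26, y26, x2, s35, y35, s36, y36, s37, y37,
     x56, x57, x67, t567, k56, k57, k58, k67, k68, k78, q567, q568, q578, q678⟩

def lQ : List Nat := [240, 240, 320, 320]

/-- level 1 : records of the possible points -/
def mkU (T : Tabs) (base2 : Nat) (s y : List Nat) (tail : List URec) : List URec :=
  strictL (fold T.y25 y (fold T.s25 s base2)) fun a5 =>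
  strictL (fold T.y26 y (fold T.s26 s T.on)) fun a6 =>
  strictL (fold T.y35 y (fold T.s35 s T.on)) fun b1 =>
  strictL (fold T.y36 y (fold T.s36 s T.on)) fun b2 =>
  strictL (fold T.y37 y (fold T.s37 s T.on)) fun b3 =>
  ⟨y, a5, a6, b1, b2, b3⟩ :: tail
def leaf1 (T : Tabs) (base2 : Nat) (s : List Nat) (m : Nat) (y : List Nat) (tail : List URec) : List URec :=
  ite' (strictL (Nat.mul m cR) fun w => nokL w T.n1 y) (mkU T base2 s y tail) tail
def lev1 (T : Tabs) (base1 base2 : Nat) (alive : List (List Nat)) : List URec :=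
  fr (fun s ih => strictL (fold T.s1 s base1) fun m => srch (leaf1 T base2 s) T.y1 m [] ih) [] alive
def mkE (T : Tabs) (u w : URec) (y : List Nat) (tail : List ERec) : List ERec :=
  strictL (Nat.land (Nat.mul (fold T.x56 y u.b1) cR) T.t567) fun e12 =>
  strictL (Nat.mul (fold T.x57 y w.b3) cR) fun e13 =>
  strictL (Nat.mul (fold T.x67 y u.b2) cR) fun e23 =>
  ⟨y, e12, e13, e23⟩ :: tail
def leaf2 (T : Tabs) (u w : URec) (m : Nat) (y : List Nat) (tail : List ERec) : List ERec :=
  ite' (strictL (Nat.mul m cR) fun x => ite' (nokL x T.nx y) (ite' (nokL x T.n6 w.y) (nokL x T.n5 u.y) false) false) (mkE T u w y tail) tail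
def edges (T : Tabs) (u w : URec) : List ERec :=
  strictL (Nat.land u.a5 w.a6) fun m => srch (leaf2 T u w) T.x2 m [] []
def rows (T : Tabs) (N : List URec) : List (List (List ERec)) :=
  List.rec [] (fun u N' ih => (fr (fun w ih2 => edges T u w :: ih2) [] (u :: N')) :: ih) N

def tri (e1 e2 : ERec) (G : List ERec) : List (ERec × Nat) :=
  strictL (Nat.land e1.e12 e2.e13) fun x =>
    fr (fun e3 ih => strictL (fl (Nat.land x e3.e23)) fun f => ite' (Nat.beq f (nat_lit 0)) ih ((e3, f) :: ih)) [] G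
abbrev TRow := List (ERec × List (ERec × Nat))
def trow1 (e1 : ERec) (G : List ERec) (tail : TRow) (s : List ERec) : TRow :=
  fr (fun e2 ih => (e2, tri e1 e2 G) :: ih) tail s
def trow (e1 : ERec) (bs : List (List ERec)) : List (List ERec) → TRow :=
  List.rec (fun _ => []) (fun s _ ih Gs => List.rec [] (fun G Gs' _ => trow1 e1 G (ih Gs') s) Gs) bs
def tmat (bs : List (List ERec)) : List (List (List ERec)) → List TRow :=
  List.rec (fun _ => []) (fun s bs' ih M => List.rec [] (fun R M' _ =>
    List.rec (ih M') (fun e1 s' ih2 => trow e1 ((e1 :: s') :: bs') R :: ih2) s) M) bs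

def chk4 (T : Tabs) (e1 e2 e3 : ERec) (l12 l13 l23 : List (ERec × Nat)) : Bool :=
  fr (fun e ih1 => ite' (fr (fun g ih2 => ite' (strictL (Nat.land e.1.e12 g.1.e13) fun x =>
    fr (fun h ih3 => ite' (strictL (fl (Nat.land x h.1.e23)) fun f => ite' (Nat.beq f (nat_lit 0)) true
      (strictL (fold T.k78 h.1.y (fold T.k68 g.1.y (fold T.k67 e.1.y (fold T.k58 e3.y (fold T.k57 e2.y (fold T.k56 e1.y T.on)))))) fun m =>
       bsrch [(T.q567, e.2, fun _ => false), (T.q568, g.2, fun _ => false), (T.q578, h.2, fun _ => false), (T.q678, f, fun _ => false)] m [])) ih3 false) true l23) ih2 false) true l13) ih1 false) true l12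

def k4c (T : Tabs) (e1 e2 : ERec) (l12 : List (ERec × Nat)) (S : TRow) : TRow → Bool :=
  List.rec (fun _ => true) (fun p _ ih R => List.rec true (fun q R' _ =>
    ite' (List.rec true (fun _ _ _ => List.rec true (fun _ _ _ => chk4 T e1 e2 p.1 l12 p.2 q.2) q.2) p.2)
      (ih R') false) R) S
def k4b (T : Tabs) (e1 : ERec) (S : TRow) : List TRow → Bool :=
  List.rec (fun _ => true) (fun p S' ih Ts => List.rec true (fun R Ts' _ =>
    ite' (List.rec true (fun _ _ _ => k4c T e1 p.1 p.2 (p :: S') R) p.2) (ih Ts') false) Ts) S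
def k4a (T : Tabs) (Ts : List TRow) : Bool :=
  List.rec true (fun R Ts' ih =>
    ite' (List.rec true (fun p _ _ => k4b T p.1 R (R :: Ts')) R) ih false) Ts

def allRows (T : Tabs) (M : List (List (List ERec))) : Bool :=
  List.rec true (fun R M' ih =>
    ite' (fcs (fcs fun p k => fcs fc0 p.2 fun l => k (p.1, l)) (tmat R (R :: M')) fun Ts => k4a T Ts) ih false) M

def chkClass (T : Tabs) (tau : List Nat) (alive : List (List Nat)) : Bool :=
  strictL (fold T.b1t tau (fold T.b1q lQ T.on)) fun base1 =>
  strictL (fold T.b2t tau (fold T.b2q lQ T.on)) fun base2 =>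
  fcs fc0 (lev1 T base1 base2 alive) fun N =>
  fcs (fcs (fcs fc0)) (rows T N) fun M => allRows T M

def dec6 (c : Nat) (k : List Nat → List (List Nat)) : List (List Nat) :=
  strictL (Nat.mul 80 (Nat.succ (Nat.mod c 9))) fun a0 => strictL (Nat.mul 80 (Nat.succ (Nat.mod (Nat.div c 9) 9))) fun a1 =>
  strictL (Nat.mul 80 (Nat.succ (Nat.mod (Nat.div c 81) 9))) fun a2 => strictL (Nat.mul 80 (Nat.succ (Nat.mod (Nat.div c 729) 9))) fun a3 =>
  strictL (Nat.mul 80 (Nat.succ (Nat.mod (Nat.div c 6561) 9))) fun a4 => strictL (Nat.mul 80 (Nat.succ (Nat.mod (Nat.div c 59049) 9))) fun a5 =>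
  k [a0, a1, a2, a3, a4, a5]
def decAll (L : List (List Nat)) : List (List Nat) :=
  fr (fun c ih => fr (fun x ih2 => dec6 x fun l => l :: ih2) ih c) [] L
def dropC (L : List (List Nat)) (i : Nat) : List (List Nat) := Nat.rec L (fun _ r => List.rec [] (fun _ t _ => t) r) i
def runC (T : Tabs) (i : Nat) : Bool :=
  List.rec true (fun c t _ => fcs fc0 (decAll (c :: t)) fun al => List.rec true (fun tau _ _ => chkClass T tau al) al) (dropC CLS i)
def runR (i n : Nat) : Bool := mkTabs fun T => Nat.rec true (fun j ih => ite' (runC T (Nat.add i j)) ih false) n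
def QL : List Nat := [320320240240, 560560240240, 560240560240, 480480320320, 320320480480, 560560480480, 240560560480, 320240240560, 240320480560]
def QP : List Nat := [2930, 2830, 2710, 2542, 2926, 2826, 2586, 2690, 2566]
def nth (l : List Nat) : Nat → Nat := List.rec (fun _ => nat_lit 0) (fun a _ ih i => Nat.rec a (fun j _ => ih j) i) l
def key4 (a b c d : Nat) : Nat := Nat.add a (Nat.mul 1000 (Nat.add b (Nat.mul 1000 (Nat.add c (Nat.mul 1000 d)))))
def memN (x : Nat) (l : List Nat) : Bool := fr (fun a ih => ite' (Nat.beq a x) true ih) false l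
def quad (a b c d : Nat) (path : List Nat) : Bool :=
  strictL (key4 (nth path a) (nth path b) (nth path c) (nth path d)) fun k => memN k QL
def tri10 : List (Nat × Nat × Nat) :=
  [(0,1,2),(0,1,3),(0,2,3),(1,2,3),(0,1,4),(0,2,4),(1,2,4),(0,3,4),(1,3,4),(2,3,4)]
def C0 : List (List Nat) := [t10 0 1 2 3 4, t10 0 1 2 3 4, t10 0 1 2 3 4, t10 0 1 2 3 4, t10 0 1 2 3 4,
  t10 0 1 2 3 4, t10 0 1 2 3 4, t10 0 1 2 3 4, t10 0 1 2 3 4, t10 0 1 2 3 4]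
def oQ : List Nat := [tc 0 1 2, tc 2 3 4, tc 0 1 3, tc 0 2 3, tc 1 2 3, tc 0 1 4, tc 0 2 4, tc 1 2 4, tc 0 3 4, tc 1 3 4]
def rQ : Nat := 952
def noP (_ : List Nat) : Bool := false
def zipQ (l : List Nat) : List (List Nat → Bool) → List (Nat × Nat × (List Nat → Bool)) :=
  List.rec (fun _ => []) (fun a _ ih P => List.rec [] (fun p P' _ => (a, rQ, p) :: ih P') P) l
def runQ : Bool :=
  WSP false fun W => strictL ONE0 fun o => strictL ON fun on =>
  mkL o W C0 oQ fun l => 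
  bsrch (zipQ l [noP, noP, noP, noP, quad 4 2 1 0, noP, noP, quad 7 2 1 0,
     fun p => quad 5 2 0 7 p, fun p => ite' (quad 7 4 1 0 p) true (quad 5 2 0 8 p)]) on []

/-- types -/
def enc6 (path : List Nat) : Nat := fr (fun s ih => Nat.add (Nat.pred (Nat.div s 80)) (Nat.mul 9 ih)) 0 path
def leafV (_ : Nat) (path : List Nat) (tail : List Nat) : List Nat := strictL (enc6 path) fun c => c :: tail
def tsr : List Nat := [tc 2 3 4, tc 1 3 4, tc 0 3 4, tc 1 2 4, tc 0 2 4, tc 0 1 4]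
def bset (L : List (List Nat)) : Nat := fr (fun c ih => fr (fun x ih2 => Nat.lor (Nat.shiftLeft 1 (Nat.mod x 531441)) ih2) ih c) 0 L
def runV : Bool :=
  WSP false fun W => strictL ONE0 fun o => strictL ON fun on =>
  mkL o W C0 tq fun q => mkL o W C0 tsr fun l => strictL (bset CLS) fun B => strictL (fold q lQ on) fun m =>
  fr (fun c ih => ite' (bt B c) ih false) true (srch leafV l m [] [])

/-- certificates -/
def cOnes : Nat := 1329227995784915872903807060280344575
def pbm (i : Nat) : Nat := fr (fun c ih => Nat.lor (b2n (bt c i)) (Nat.shiftLeft ih 1)) 0 PT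
def pidx (i j : Nat) : Nat := Nat.add (Nat.div (Nat.mul j (Nat.pred j)) 2) i
def up (PL : List Nat) (y x : Nat) : Nat :=
  ite' (Nat.ble (Nat.succ y) x) (nth PL (pidx y x)) (Nat.xor cOnes (nth PL (pidx x y)))
def viol (PL : List Nat) (x y z q : Nat) : Nat :=
  ite' (Nat.beq q 0) (Nat.xor cOnes (Nat.lor (up PL y x) (up PL z x)))
  (ite' (Nat.beq q 1) (Nat.xor (up PL y x) (up PL z x)) (Nat.land (up PL y x) (up PL z x)))
def violL (PL : List Nat) (g : Nat → Nat) (a b c l : Nat) : Nat :=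
  ite' (Nat.beq (Nat.div l 3) 0) (viol PL a b c (g (Nat.mod l 3)))
  (ite' (Nat.beq (Nat.div l 3) 1) (viol PL b a c (g (Nat.mod l 3))) (viol PL c a b (g (Nat.mod l 3))))
def fz (f : Nat × Nat × Nat → Nat → Nat) (ts : List (Nat × Nat × Nat)) : List Nat → Nat :=
  List.rec (fun _ => 0) (fun t _ ih ls => List.rec 0 (fun l ls' _ => Nat.lor (f t l) (ih ls')) ls) ts
def pfun (pc i : Nat) : Nat := ite' (Nat.ble 5 i) i (Nat.mod (Nat.div pc (Nat.pow 5 i)) 5)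
def injP (p : Nat → Nat) : Bool :=
  fr (fun t ih => ite' (Nat.beq (p t.1) (p t.2)) false ih) true
   [(0,1),(0,2),(0,3),(0,4),(1,2),(1,3),(1,4),(2,3),(2,4),(3,4)]
def dig6 (c : Nat) : List Nat := [Nat.mod c 9, Nat.mod (Nat.div c 9) 9, Nat.mod (Nat.div c 81) 9,
  Nat.mod (Nat.div c 729) 9, Nat.mod (Nat.div c 6561) 9, Nat.mod (Nat.div c 59049) 9]
def cod10 (c : Nat) : List Nat := 2 :: 2 :: 3 :: 3 :: dig6 c
def idn (q : Nat) : Nat := q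
def rvn (q : Nat) : Nat := Nat.sub 2 q
def cert1 (PL : List Nat) (tau e : Nat) : Bool :=
  strictL (Nat.mod (Nat.div e 531441) 2) fun rv => strictL (Nat.div e 1062882) fun pc =>
  ite' (injP (pfun pc))
  (strictL (Nat.xor cOnes (fz (fun t l => violL PL idn t.1 t.2.1 t.2.2 l) tri10 (cod10 (Nat.mod e 531441)))) fun M =>
   strictL (fz (fun t l => violL PL (ite' (Nat.beq rv 0) idn rvn) (pfun pc t.1) (pfun pc t.2.1) (pfun pc t.2.2) l) tri10 (cod10 tau)) fun V =>
   Nat.beq (Nat.land M V) 0) false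
def withPL (k : List Nat → Bool) : Bool := fcs strictL (fr (fun i ih => pbm i :: ih) [] [0,1,2,3,4,5,6,7,8,9]) k
def certC (PL : List Nat) (c : List Nat) : Bool :=
  List.rec true (fun a _ _ => fr (fun e ih => ite' (cert1 PL (Nat.mod a 531441) e) ih false) true c) c
def runCert : Bool := withPL fun PL => fr (fun c ih => ite' (certC PL c) ih false) true CLS
/-- the listed quadruples of laws are versions of the base quadruple -/
def tri4 : List (Nat × Nat × Nat) := [(0,1,2),(0,1,3),(0,2,3),(1,2,3)]
def dec4 (k : Nat) : List Nat := [Nat.pred (Nat.div (Nat.mod k 1000) 80), Nat.pred (Nat.div (Nat.mod (Nat.div k 1000) 1000) 80),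
  Nat.pred (Nat.div (Nat.mod (Nat.div k 1000000) 1000) 80), Nat.pred (Nat.div (Nat.div k 1000000000) 80)]
def certQ1 (PL : List Nat) (k pc : Nat) : Bool :=
  ite' (injP (pfun pc))
  (strictL (Nat.xor cOnes (fz (fun t l => violL PL idn t.1 t.2.1 t.2.2 l) tri4 (dec4 k))) fun M =>
   strictL (fz (fun t l => violL PL idn (pfun pc t.1) (pfun pc t.2.1) (pfun pc t.2.2) l) tri4 [2, 2, 3, 3]) fun V =>
   Nat.beq (Nat.land M V) 0) false
def runQP : Bool := withPL fun PL => fr (fun k ih => ite' (fr (fun pc ih2 => ite' (certQ1 PL k pc) true ih2) false QP) ih false) true QL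
end CD

namespace CD

theorem land_split (k a A b B : ℕ) (ha : a < 2^k) (hb : b < 2^k) :
    (a + 2^k*A) &&& (b + 2^k*B) = (a &&& b) + 2^k*(A &&& B) := by
  apply Nat.eq_of_testBit_eq
  intro i
  have h : (a &&& b) < 2^k := lt_of_le_of_lt Nat.and_le_left ha
  rw [Nat.testBit_and, add_comm a, add_comm b, add_comm (a &&& b), Nat.testBit_two_pow_mul_add _ ha,
    Nat.testBit_two_pow_mul_add _ hb, Nat.testBit_two_pow_mul_add _ h]
  split_ifs <;> simp

def rep (h : ℕ) : ℕ → ℕ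
  | 0 => 0
  | n+1 => h + 256 * rep h n
def sumc (c : ℕ → ℕ) : ℕ → ℕ
  | 0 => 0
  | n+1 => c 0 + 256 * sumc (fun i => c (i+1)) n
def gsum (h : ℕ → ℕ) : ℕ → ℕ
  | 0 => 0
  | n+1 => h 0 + 2^80 * gsum (fun i => h (i+1)) n
def gs : ℕ → ℕ
  | 0 => 0
  | n+1 => 1 + 2^80 * gs n
def bs (u : ℕ) : ℕ → ℕ
  | 0 => 0
  | n+1 => u % 2 + 2 * bs (u / 2^80) n

theorem and128 : ∀ a < 256, a &&& 128 = if 128 ≤ a then 128 else 0 := by decide +kernel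

theorem sumc_land (h : ℕ) (hh : h ≤ 127) (n : ℕ) : ∀ (c : ℕ → ℕ), (∀ i, c i ≤ 120) →
    (sumc c n + rep h n) &&& rep 128 n = sumc (fun i => if 128 ≤ c i + h then 128 else 0) n := by
  induction n with
  | zero => intro c _; simp [sumc, rep]
  | succ n ih =>
    intro c hc
    have h0 := hc 0
    have e : sumc c (n+1) + rep h (n+1) = (c 0 + h) + 2^8 * (sumc (fun i => c (i+1)) n + rep h n) := by
      simp only [sumc, rep]; ring
    have e2 : rep 128 (n+1) = 128 + 2^8 * rep 128 n := by simp [rep]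
    rw [e, e2, land_split _ _ _ _ _ (by norm_num; omega) (by norm_num), ih _ (fun i => hc _), and128 _ (by omega)]
    simp [sumc]

theorem sumc_add (c d : ℕ → ℕ) (n : ℕ) : sumc (fun i => c i + d i) n = sumc c n + sumc d n := by
  induction n generalizing c d with
  | zero => rfl
  | succ n ih => simp only [sumc]; rw [ih (fun i => c (i+1)) (fun i => d (i+1))]; ring

theorem sumc_app (k m : ℕ) (c : ℕ → ℕ) : sumc c (k+m) = sumc c k + 256^k * sumc (fun i => c (k+i)) m := by
  induction k generalizing c with
  | zero => simp [sumc]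
  | succ k ih =>
    rw [show k+1+m = (k+m)+1 by ring]; simp only [sumc]; rw [ih]
    simp only [show ∀ i, k+1+i = k+i+1 by intro i; ring]; ring

theorem sumc_grp (n : ℕ) : ∀ c : ℕ → ℕ, sumc c (10*n) = gsum (fun g => sumc (fun i => c (10*g+i)) 10) n := by
  induction n with
  | zero => intro c; rfl
  | succ n ih =>
    intro c
    rw [show 10*(n+1) = 10 + 10*n by ring, sumc_app, ih, gsum]
    simp only [mul_zero, zero_add, show ∀ i j, 10*(i+1)+j = 10+(10*i+j) by intros; ring]
    norm_num

theorem gsum_add (c d : ℕ → ℕ) (n : ℕ) : gsum (fun i => c i + d i) n = gsum c n + gsum d n := by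
  induction n generalizing c d with
  | zero => rfl
  | succ n ih => simp only [gsum]; rw [ih (fun i => c (i+1)) (fun i => d (i+1))]; ring

theorem gsum_even (n : ℕ) : ∀ h : ℕ → ℕ, (∀ i, h i % 2 = 0) → gsum h n % 2 = 0 := by
  induction n with
  | zero => intro h _; rfl
  | succ n ih => intro h hh; simp only [gsum]; have := hh 0; omega

theorem gsum_bit (n : ℕ) : ∀ (g : ℕ) (h : ℕ → ℕ), (∀ i, h i % 2 = 0) → (∀ i, h i ≤ 2^80) → g < n →
    h g = 2^80 → (gsum h n).testBit (80*(g+1)) = true := by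
  induction n with
  | zero => intro g h _ _ hg; omega
  | succ n ih =>
    intro g h he hl hg hq
    have ev := gsum_even n (fun i => h (i+1)) (fun i => he _)
    have hd : gsum h (n+1) = h 0 + 2^80 * gsum (fun i => h (i+1)) n := rfl
    set Y := gsum (fun i => h (i+1)) n with hY
    cases g with
    | zero =>
      rw [hd, hq, show 80*(0+1) = 80 by norm_num, Nat.testBit_eq_decide_div_mod_eq]
      rw [show 2^80 + 2^80*Y = 2^80*(1+Y) by ring, Nat.mul_div_cancel_left _ (by positivity)]
      simp; omega
    | succ g =>
      have key : Y.testBit (80*(g+1)) = true := ih g _ (fun i => he _) (fun i => hl _) (by omega) hq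
      rw [show 80*(g+1+1) = 80*(g+1) + 80 by ring, ← Nat.testBit_div_two_pow, hd]
      have hk : 80*(g+1) = (80*g+79)+1 := by ring
      have h0 := hl 0
      rcases Nat.lt_or_ge (h 0) (2^80) with hlt | hge
      · rw [Nat.add_mul_div_left _ _ (by positivity), Nat.div_eq_of_lt hlt, zero_add]; exact key
      · rw [show h 0 = 2^80 by omega, Nat.add_mul_div_left _ _ (by positivity), Nat.div_self (by positivity)]
        rw [hk, Nat.testBit_succ] at key ⊢
        rw [show (1 + Y)/2 = Y/2 by omega]; exact key

theorem land_gs (n : ℕ) : ∀ u, (u &&& gs n) ≡ bs u n [MOD 2^79-1] := by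
  induction n with
  | zero => intro u; simp [gs, bs]; rfl
  | succ n ih =>
    intro u
    have e : u &&& gs (n+1) = u % 2 + 2^80 * ((u/2^80) &&& gs n) := by
      conv_lhs => rw [show u = u % 2^80 + 2^80 * (u/2^80) from (Nat.mod_add_div _ _).symm]
      rw [gs, land_split _ _ _ _ _ (Nat.mod_lt _ (by positivity)) (by norm_num), Nat.and_one_is_mod,
        Nat.mod_mod_of_dvd _ (by norm_num)]
    rw [e, bs]
    refine Nat.ModEq.add rfl (Nat.ModEq.mul ?_ (ih _))
    decide

theorem bs_lt (n : ℕ) : ∀ u, bs u n < 2^n := by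
  induction n with
  | zero => intro u; simp [bs]
  | succ n ih => intro u; have := ih (u/2^80); have h2 : 2^(n+1) = 2*2^n := pow_succ' 2 n; rw [bs, h2]; omega

theorem bs_bit (n : ℕ) : ∀ u k, k < n → (bs u n).testBit k = u.testBit (80*k) := by
  induction n with
  | zero => intro u k h; omega
  | succ n ih =>
    intro u k hk
    cases k with
    | zero => simp [bs, Nat.testBit_zero]
    | succ k =>
      rw [bs, Nat.testBit_succ, show (u % 2 + 2 * bs (u/2^80) n)/2 = bs (u/2^80) n by omega, ih _ _ (by omega),
        Nat.testBit_div_two_pow]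
      congr 1

/-- the last stage of the flag computation -/
theorem fin_eq (w : ℕ) : Nat.mod (Nat.land w cG) cM = 4 * bs (w / 2^160) 9 := by
  have e : Nat.land w cG = 2^160 * ((w/2^160) &&& gs 9) := by
    have hG : cG = 0 + 2^160 * gs 9 := by decide +kernel
    change w &&& cG = _
    conv_lhs => rw [show w = w % 2^160 + 2^160 * (w/2^160) from (Nat.mod_add_div _ _).symm]
    rw [hG, land_split _ _ _ _ _ (Nat.mod_lt _ (by positivity)) (by positivity)]
    simp
  have hM : cM = 2^79 - 1 := by decide +kernel
  have h1 : (2^160 * ((w/2^160) &&& gs 9)) ≡ 4 * bs (w / 2^160) 9 [MOD 2^79-1] :=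
    Nat.ModEq.mul (by decide) (land_gs 9 _)
  have h2 := bs_lt 9 (w/2^160)
  change (Nat.land w cG) % cM = _
  rw [e, hM, h1, Nat.mod_eq_of_lt]
  norm_num at h2 ⊢; omega

theorem fin_bit (w l : ℕ) (hl : l < 9) : (Nat.mod (Nat.land w cG) cM).testBit (l+2) = w.testBit (80*(l+2)) := by
  rw [fin_eq, show 4 = 2^2 by norm_num, Nat.testBit_two_pow_mul]
  simp only [ge_iff_le, Nat.le_add_left, decide_true, Bool.true_and, Nat.add_sub_cancel]
  rw [bs_bit _ _ _ hl, Nat.testBit_div_two_pow, show 80*l+160 = 80*(l+2) by ring]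

theorem stage2 (h : ℕ) (hh : h ≤ 127) (Y0 : ℕ) (hY : Y0 < 2^80) (c : ℕ → ℕ) (hc : ∀ i, c i ≤ 120) (l : ℕ) (hl : l < 9)
    (hb : ∀ s < 10, 128 ≤ c (10*l+s) + h) :
    ((((Y0 + 2^80 * sumc c 90) + 2^80 * rep h 90) &&& (2^80 * rep 128 90)) +
      2^80 * gsum (fun _ => 2^80 - sumc (fun _ => 128) 10) 9).testBit (80*(l+2)) = true := by
  have e1 : (((Y0 + 2^80 * sumc c 90) + 2^80 * rep h 90) &&& (2^80 * rep 128 90)) =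
      2^80 * sumc (fun i => if 128 ≤ c i + h then 128 else 0) 90 := by
    rw [show (Y0 + 2^80 * sumc c 90) + 2^80 * rep h 90 = Y0 + 2^80 * (sumc c 90 + rep h 90) by ring,
      show 2^80 * rep 128 90 = 0 + 2^80 * rep 128 90 by ring, land_split _ _ _ _ _ hY (by positivity), sumc_land h hh _ _ hc]
    simp
  rw [e1, show 90 = 10*9 by norm_num, sumc_grp, ← mul_add, ← gsum_add, show 80*(l+2) = 80*(l+1)+80 by ring,
    ← Nat.testBit_div_two_pow, Nat.mul_div_cancel_left _ (by positivity)]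
  have hle : ∀ i, (if 128 ≤ c i + h then 128 else 0) = 0 ∨ (if 128 ≤ c i + h then 128 else 0) = 128 := by
    intro i; split_ifs <;> simp
  apply gsum_bit
  · intro i
    simp only [sumc]
    have := fun j => hle (10*i+j)
    have t0 := this 0
    simp only [add_zero] at *
    rcases t0 with t0 | t0 <;> simp [t0, Nat.add_mod, Nat.mul_mod]
  · intro i
    simp only [sumc]
    have t := fun j => hle (10*i+j)
    have t0 := t 0; have t1 := t (0+1); have t2 := t (0+1+1); have t3 := t (0+1+1+1); have t4 := t (0+1+1+1+1)
    have t5 := t (0+1+1+1+1+1); have t6 := t (0+1+1+1+1+1+1); have t7 := t (0+1+1+1+1+1+1+1)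
    have t8 := t (0+1+1+1+1+1+1+1+1); have t9 := t (0+1+1+1+1+1+1+1+1+1)
    generalize (if 128 ≤ c (10*i + 0) + h then 128 else 0) = a0 at *
    generalize (if 128 ≤ c (10*i + (0+1)) + h then 128 else 0) = a1 at *
    generalize (if 128 ≤ c (10*i + (0+1+1)) + h then 128 else 0) = a2 at *
    generalize (if 128 ≤ c (10*i + (0+1+1+1)) + h then 128 else 0) = a3 at *
    generalize (if 128 ≤ c (10*i + (0+1+1+1+1)) + h then 128 else 0) = a4 at *
    generalize (if 128 ≤ c (10*i + (0+1+1+1+1+1)) + h then 128 else 0) = a5 at *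
    generalize (if 128 ≤ c (10*i + (0+1+1+1+1+1+1)) + h then 128 else 0) = a6 at *
    generalize (if 128 ≤ c (10*i + (0+1+1+1+1+1+1+1)) + h then 128 else 0) = a7 at *
    generalize (if 128 ≤ c (10*i + (0+1+1+1+1+1+1+1+1)) + h then 128 else 0) = a8 at *
    generalize (if 128 ≤ c (10*i + (0+1+1+1+1+1+1+1+1+1)) + h then 128 else 0) = a9 at *
    have : ∀ a, (a = 0 ∨ a = 128) → a ≤ 128 := by intro a h; omega
    have u0 := this _ t0; have u1 := this _ t1; have u2 := this _ t2; have u3 := this _ t3; have u4 := this _ t4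
    have u5 := this _ t5; have u6 := this _ t6; have u7 := this _ t7; have u8 := this _ t8; have u9 := this _ t9
    clear t0 t1 t2 t3 t4 t5 t6 t7 t8 t9 this t hle e1 hb
    norm_num
    omega
  · exact hl
  · have hs : sumc (fun i => if 128 ≤ c (10*l+i) + h then 128 else 0) 10 = sumc (fun _ => 128) 10 := by
      simp only [sumc]
      rw [if_pos (hb _ (by norm_num)), if_pos (hb _ (by norm_num)), if_pos (hb _ (by norm_num)), if_pos (hb _ (by norm_num)),
        if_pos (hb _ (by norm_num)), if_pos (hb _ (by norm_num)), if_pos (hb _ (by norm_num)), if_pos (hb _ (by norm_num)),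
        if_pos (hb _ (by norm_num)), if_pos (hb _ (by norm_num))]
    rw [hs]
    simp only [sumc]
    norm_num

theorem sumc_bits (n : ℕ) : ∀ z, z < 256^n → (∀ i, z.testBit i = true → i % 8 = 0) →
    z = sumc (fun i => (z.testBit (8*i)).toNat) n := by
  induction n with
  | zero => intro z hz _; simp at hz; simp [sumc, hz]
  | succ n ih =>
    intro z hz hb
    have h1 : z % 256 = (z.testBit 0).toNat := by
      apply Nat.eq_of_testBit_eq
      intro i
      rw [show 256 = 2^8 by norm_num, Nat.testBit_mod_two_pow]
      cases i with
      | zero => rcases Nat.mod_two_eq_zero_or_one z with h | h <;> simp [h]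
      | succ i =>
        have : (z.testBit 0).toNat.testBit (i+1) = false := by cases z.testBit 0 <;> simp [Nat.testBit_succ]
        rw [this]
        by_contra hcon
        simp at hcon
        have := hb _ hcon.2
        omega
    have h2 : z / 256 = sumc (fun i => ((z/256).testBit (8*i)).toNat) n := by
      apply ih
      · rw [Nat.div_lt_iff_lt_mul (by norm_num)]; rw [pow_succ] at hz; exact hz
      · intro i hi
        rw [show 256 = 2^8 by norm_num, Nat.testBit_div_two_pow] at hi
        have := hb _ hi; omega
    have h3 : ∀ i, (z/256).testBit (8*i) = z.testBit (8*(i+1)) := by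
      intro i; rw [show 256 = 2^8 by norm_num, Nat.testBit_div_two_pow]; rfl
    simp only [h3] at h2
    simp only [sumc, mul_zero]
    rw [← h2, ← h1]
    omega

theorem sumc_rows (k : ℕ) : ∀ b : ℕ → ℕ, sumc b (100*k) ≡ sumc (fun i => ∑ p ∈ Finset.range k, b (100*p+i)) 100 [MOD 2^800-1] := by
  induction k with
  | zero =>
    intro b
    simp only [mul_zero, Finset.range_zero, Finset.sum_empty]
    have : ∀ n, sumc (fun _ => 0) n = 0 := by intro n; induction n with
      | zero => rfl
      | succ n ih => simp [sumc, ih]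
    rw [this]; rfl
  | succ k ih =>
    intro b
    rw [show 100*(k+1) = 100 + 100*k by ring, sumc_app]
    have := ih (fun i => b (100+i))
    have e : (fun i => ∑ p ∈ Finset.range (k+1), b (100*p+i)) = fun i => b i + ∑ p ∈ Finset.range k, b (100 + (100*p+i)) := by
      funext i; rw [Finset.sum_range_succ']
      simp only [mul_zero, zero_add, show ∀ p, 100*(p+1)+i = 100+(100*p+i) by intro p; ring]; ring
    rw [e, sumc_add]
    have h1 : 256^100 ≡ 1 [MOD 2^800-1] := by decide +kernel
    have h2 := h1.mul this
    rw [one_mul] at h2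
    exact Nat.ModEq.add rfl h2

theorem sumc_le (n : ℕ) : ∀ c : ℕ → ℕ, (∀ i, c i ≤ 120) → sumc c n ≤ 120 * rep 1 n := by
  induction n with
  | zero => intro c _; rfl
  | succ n ih => intro c hc; simp only [sumc, rep]; have := ih (fun i => c (i+1)) (fun i => hc _); have := hc 0; omega

theorem fl_gen (h : ℕ) (hh : h ≤ 127) (z j x : ℕ) (hz : z < 2^(800*120)) (hb : ∀ i, z.testBit i = true → i % 8 = 0)
    (hj : j < 2^64) (hx : x ≡ j + z [MOD cB]) (l : ℕ) (hl : l < 9)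
    (hc : ∀ s < 10, 128 ≤ ((Finset.range 120).filter (fun p => z.testBit (800*p+80*(l+1)+8*s) = true)).card + h) :
    (Nat.mod (Nat.land (Nat.add (Nat.land (Nat.add (Nat.mod x cB) (2^80 * rep h 90)) cK) cC) cG) cM).testBit (l+2) = true := by
  have hz' : z < 256^(100*120) := by rw [show (256:ℕ) = 2^8 by norm_num, ← pow_mul]; exact hz
  have e1 := sumc_bits _ z hz' hb
  have e2 := sumc_rows 120 (fun i => (z.testBit (8*i)).toNat)
  rw [← e1] at e2
  set c : ℕ → ℕ := fun i => ∑ p ∈ Finset.range 120, (z.testBit (8*(100*p+i))).toNat with hcdef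
  have hcard : ∀ i, c i = ((Finset.range 120).filter (fun p => z.testBit (8*(100*p+i)) = true)).card := by
    intro i
    rw [hcdef, Finset.card_filter]
    apply Finset.sum_congr rfl
    intro p _
    cases z.testBit (8*(100*p+i)) <;> simp
  have hc120 : ∀ i, c i ≤ 120 := by
    intro i; rw [hcard]; exact (Finset.card_filter_le _ _).trans (by simp)
  have hB : cB = 2^800-1 := by decide +kernel
  have l10 := sumc_le 10 c hc120
  have l90 := sumc_le 90 (fun i => c (10+i)) (fun i => hc120 _)
  have hs : sumc c 100 = sumc c 10 + 2^80 * sumc (fun i => c (10+i)) 90 := by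
    have := sumc_app 10 90 c
    norm_num at this ⊢; exact this
  have r10 : 120 * rep 1 10 + 2^64 < 2^80 := by decide +kernel
  have r90 : 2^80 * (120 * rep 1 90) + 2^80 < 2^800 - 1 := by decide +kernel
  have hxm : Nat.mod x cB = (j + sumc c 10) + 2^80 * sumc (fun i => c (10+i)) 90 := by
    change x % cB = _
    have : x ≡ j + sumc c 100 [MOD cB] := hx.trans (by rw [hB]; exact Nat.ModEq.add rfl e2)
    rw [this, hB, hs, ← add_assoc, Nat.mod_eq_of_lt]
    calc j + sumc c 10 + 2^80 * sumc (fun i => c (10+i)) 90 ≤ 2^80 + 2^80 * (120 * rep 1 90) := by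
          gcongr; omega
      _ < _ := by rw [add_comm]; exact r90
  rw [hxm, fin_bit _ _ hl]
  have hK : cK = 2^80 * rep 128 90 := by decide +kernel
  have hC : cC = 2^80 * gsum (fun _ => 2^80 - sumc (fun _ => 128) 10) 9 := by decide +kernel
  rw [hK, hC]
  apply stage2 h hh _ (by omega) _ (fun i => hc120 _) l hl
  intro s hs'
  have := hc s hs'
  rw [hcard]
  convert this using 8
  ring

theorem flg_lt (w : ℕ) : Nat.mod (Nat.land w cG) cM < 2^11 ∧ Nat.mod (Nat.land w cG) cM % 4 = 0 := by
  rw [fin_eq]; have := bs_lt 9 (w/2^160); constructor <;> omega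

theorem fl_lt (x : ℕ) : fl x < 2^11 := (flg_lt _).1
theorem flN_lt (x : ℕ) : flN x < 2^11 := (flg_lt _).1
theorem flN_mod (x : ℕ) : flN x % 4 = 0 := (flg_lt _).2

theorem fl_bit (z j x : ℕ) (hz : z < 2^(800*120)) (hb : ∀ i, z.testBit i = true → i % 8 = 0)
    (hj : j < 2^64) (hx : x ≡ j + z [MOD cB]) (l : ℕ) (hl : l < 9)
    (hc : ∀ s < 10, 17 ≤ ((Finset.range 120).filter (fun p => z.testBit (800*p+80*(l+1)+8*s) = true)).card) :
    (fl x).testBit (l+2) = true := by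
  have hH : cH = 2^80 * rep 111 90 := by decide +kernel
  unfold fl; rw [hH]
  exact fl_gen 111 (by norm_num) z j x hz hb hj hx l hl (fun s hs => by have := hc s hs; omega)

theorem flN_bit (z j x : ℕ) (hz : z < 2^(800*120)) (hb : ∀ i, z.testBit i = true → i % 8 = 0)
    (hj : j < 2^64) (hx : x ≡ j + z [MOD cB]) (l : ℕ) (hl : l < 9)
    (hc : ∀ s < 10, 1 ≤ ((Finset.range 120).filter (fun p => z.testBit (800*p+80*(l+1)+8*s) = true)).card) :
    (flN x).testBit (l+2) = true := by
  have hH : cI = 2^80 * rep 127 90 := by decide +kernel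
  unfold flN; rw [hH]
  exact fl_gen 127 (by norm_num) z j x hz hb hj hx l hl (fun s hs => by have := hc s hs; omega)

end CD

namespace CD

theorem add_lor (n : ℕ) : ∀ a b : ℕ, a < 2^n → (∀ i, ¬ (a.testBit i = true ∧ b.testBit i = true)) → a + b = a ||| b := by
  induction n with
  | zero => intro a b ha _; have : a = 0 := by simpa using ha
            subst this; simp
  | succ n ih =>
    intro a b ha h
    have h1 : a/2 + b/2 = (a/2 ||| b/2) := by
      apply ih
      · rw [pow_succ] at ha; omega
      · intro i hi; apply h (i+1); simpa [Nat.testBit_succ] using hi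
    have h0 := h 0
    simp only [Nat.testBit_zero, decide_eq_true_eq] at h0
    have h2 := Nat.or_div_two (a := a) (b := b)
    have h3 := Nat.or_mod_two_eq_one (a := a) (b := b)
    omega

def NF (m : ℕ) : Prop :=
  ∀ i, m.testBit i = true → i < 64 ∨ (800 ≤ i ∧ i < 800*121 ∧ i % 800 < 80 ∧ i % 8 = 0)

theorem gs_succ (n : ℕ) : gs (n+1) = gs n + 2^(80*n) := by
  induction n with
  | zero => simp [gs]
  | succ n ih =>
    rw [show gs (n+1+1) = 1 + 2^80 * gs (n+1) from rfl]
    nth_rewrite 1 [ih]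
    rw [show gs (n+1) = 1 + 2^80 * gs n from rfl]; ring

theorem shift_bit (m : ℕ) (hm : NF m) (n : ℕ) (hn : n < 10) (i : ℕ) :
    (m * 2^(80*n)).testBit i = (decide (i % 800 / 80 = n) && m.testBit (800*(i/800) + i%80)) := by
  rw [mul_comm, Nat.testBit_two_pow_mul]
  by_cases hb : i % 800 / 80 = n
  · have e : i - 80*n = 800*(i/800)+i%80 := by omega
    have e2 : 80*n ≤ i := by omega
    simp [hb, e, e2]
  · simp only [hb, decide_false, Bool.false_and]
    by_contra hc
    simp at hc
    have := hm _ hc.2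
    omega

theorem wide_aux (m : ℕ) (hm : NF m) (n : ℕ) (hn : n ≤ 10) : ∀ i,
    (m * gs n).testBit i = (decide (i % 800 / 80 < n) && m.testBit (800*(i/800) + i%80)) := by
  induction n with
  | zero => intro i; simp [gs]
  | succ n ih =>
    intro i
    have ih := ih (by omega)
    rw [gs_succ, mul_add, add_lor (m * gs n) _ _ Nat.lt_two_pow_self, Nat.testBit_or, ih, shift_bit m hm n (by omega)]
    · cases m.testBit (800*(i/800)+i%80)
      · simp
      · simp only [Bool.and_true, ← Bool.decide_or]
        congr 1
        simp only [eq_iff_iff]; omega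
    · intro i hi
      rw [ih, shift_bit m hm n (by omega)] at hi
      simp at hi; omega

theorem wide_bit (m : ℕ) (hm : NF m) (i : ℕ) : (m * cR).testBit i = m.testBit (800*(i/800) + i%80) := by
  rw [show cR = gs 10 by decide +kernel, wide_aux m hm 10 le_rfl]
  have : i % 800 / 80 < 10 := by omega
  simp [this]

def Cov (S : ℕ → ℕ → Prop) (m : ℕ) : Prop :=
  NF m ∧ ∀ j < 10, ∀ p < 120, S j p → m.testBit (800*(p+1)+8*j) = true
def Big (S : ℕ → ℕ → Prop) : Prop :=
  ∀ j < 10, ∃ F : Finset ℕ, F ⊆ Finset.range 120 ∧ 17 ≤ F.card ∧ ∀ p ∈ F, S j p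
def TS (S : ℕ → ℕ → Prop) (T l : ℕ) : Prop :=
  ∀ j < 10, ∀ p < 120, S j p → T.testBit (800*(p+1)+80*(l+1)+8*j) = true
def NS (S : ℕ → ℕ → Prop) (T l : ℕ) : Prop :=
  ∀ j < 10, ∃ p < 120, S j p ∧ T.testBit (800*(p+1)+80*(l+1)+8*j) = true
def CovW (S : ℕ → ℕ → Prop) (x : ℕ) : Prop :=
  ∀ j < 10, ∀ p < 120, S j p → ∀ g < 10, x.testBit (800*(p+1)+80*g+8*j) = true
def ShW (x : ℕ) : Prop := ∀ i, x.testBit i = true → 800 ≤ i → i < 800*121 ∧ i % 8 = 0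
def Cl (x : ℕ) : Prop := ∀ i, x.testBit i = true → i < 64 ∨ 800 ≤ i

theorem sh_wide {m : ℕ} (hm : NF m) : ShW (m * cR) := by
  intro i hi h8
  rw [wide_bit m hm] at hi
  have := hm _ hi
  omega

theorem cov_wide {S : ℕ → ℕ → Prop} {m : ℕ} (hm : Cov S m) : CovW S (m * cR) := by
  intro j hj p hp hs g hg
  rw [wide_bit m hm.1]
  have := hm.2 j hj p hp hs
  rwa [show 800 * ((800*(p+1)+80*g+8*j)/800) + (800*(p+1)+80*g+8*j) % 80 = 800*(p+1)+8*j by omega]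

theorem cov_child {S : ℕ → ℕ → Prop} {m T l : ℕ} (hm : Cov S m) (hT : TS S T l) :
    Cov S (Nat.land m (Nat.shiftRight T (80*(l+1)))) := by
  change Cov S (m &&& (T >>> (80*(l+1))))
  refine ⟨fun i hi => hm.1 i ?_, ?_⟩
  · rw [Nat.testBit_and] at hi; simp at hi; exact hi.1
  · intro j hj p hp hs
    rw [Nat.testBit_and, hm.2 j hj p hp hs, Nat.testBit_shiftRight, Bool.true_and]
    rw [show 80*(l+1) + (800*(p+1)+8*j) = 800*(p+1)+80*(l+1)+8*j by ring]
    exact hT j hj p hp hs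

theorem sh_lt {x : ℕ} (hx : ShW x) : x >>> 800 < 2^(800*120) := by
  apply Nat.lt_pow_two_of_testBit
  intro i hi
  rw [Nat.testBit_shiftRight]
  by_contra hc
  have := hx (800+i) (by simpa using hc) (by omega)
  omega

theorem sh_mod {x : ℕ} (hx : ShW x) (i : ℕ) (hi : (x >>> 800).testBit i = true) : i % 8 = 0 := by
  rw [Nat.testBit_shiftRight] at hi
  have := hx _ hi (by omega)
  omega

theorem card_of {x l k j : ℕ} (F : Finset ℕ) (h1 : F ⊆ Finset.range 120) (h2 : k ≤ F.card)
    (h : ∀ p ∈ F, x.testBit (800*(p+1)+80*(l+1)+8*j) = true) :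
    k ≤ ((Finset.range 120).filter (fun p => (x >>> 800).testBit (800*p+80*(l+1)+8*j) = true)).card := by
  refine h2.trans (Finset.card_le_card ?_)
  intro p hp
  rw [Finset.mem_filter, Nat.testBit_shiftRight]
  refine ⟨h1 hp, ?_⟩
  have := h p hp
  rwa [show 800 + (800*p+80*(l+1)+8*j) = 800*(p+1)+80*(l+1)+8*j by ring]

theorem cl_modeq {x : ℕ} (hc : Cl x) : x % 2^800 < 2^64 ∧ x ≡ x % 2^800 + x >>> 800 [MOD cB] := by
  constructor
  · apply Nat.lt_pow_two_of_testBit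
    intro i hi
    rw [Nat.testBit_mod_two_pow]
    by_contra hcon
    simp at hcon
    have := hc i hcon.2
    omega
  · have hB : cB = 2^800-1 := by decide +kernel
    rw [hB, Nat.shiftRight_eq_div_pow]
    conv_lhs => rw [← Nat.mod_add_div x (2^800)]
    have h1 : 2^800 ≡ 1 [MOD 2^800-1] := by decide +kernel
    have h2 := h1.mul_right (x / 2^800)
    rw [one_mul] at h2
    exact Nat.ModEq.add rfl h2

theorem flag_srch {S : ℕ → ℕ → Prop} {m T l : ℕ} (hm : Cov S m) (hB : Big S) (hT : TS S T l) (hl : l < 9) :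
    (fl (Nat.shiftRight (Nat.land (Nat.mul m cR) T) (nat_lit 800))).testBit (l+2) = true := by
  change (fl (((m * cR) &&& T) >>> 800)).testBit (l+2) = true
  have hs : ShW ((m * cR) &&& T) := by
    intro i hi; rw [Nat.testBit_and] at hi; simp at hi; exact sh_wide hm.1 i hi.1
  apply fl_bit _ 0 _ (sh_lt hs) (sh_mod hs) (by norm_num) (by rw [zero_add]) l hl
  intro j hj
  obtain ⟨F, h1, h2, h3⟩ := hB j hj
  refine card_of F h1 h2 ?_
  intro p hp
  have hp' := Finset.mem_range.1 (h1 hp)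
  rw [Nat.testBit_and, cov_wide hm j hj p hp' (h3 p hp) (l+1) (by omega), hT j hj p hp' (h3 p hp)]; rfl

theorem flag_direct {S : ℕ → ℕ → Prop} {x l : ℕ} (hs : ShW x) (hc : Cl x) (hB : Big S) (hT : TS S x l) (hl : l < 9) :
    (fl x).testBit (l+2) = true := by
  obtain ⟨c1, c2⟩ := cl_modeq hc
  apply fl_bit _ _ _ (sh_lt hs) (sh_mod hs) c1 c2 l hl
  intro j hj
  obtain ⟨F, h1, h2, h3⟩ := hB j hj
  exact card_of F h1 h2 (fun p hp => hT j hj p (Finset.mem_range.1 (h1 hp)) (h3 p hp))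

theorem flagN {S : ℕ → ℕ → Prop} {m T l : ℕ} (hm : Cov S m) (hT : NS S T l) (hC : Cl T) (hl : l < 9) :
    (flN ((m * cR) &&& T)).testBit (l+2) = true := by
  have hs : ShW ((m * cR) &&& T) := by
    intro i hi; rw [Nat.testBit_and] at hi; simp at hi; exact sh_wide hm.1 i hi.1
  have hc : Cl ((m * cR) &&& T) := by
    intro i hi; rw [Nat.testBit_and] at hi; simp at hi; exact hC i hi.2
  obtain ⟨c1, c2⟩ := cl_modeq hc
  apply flN_bit _ _ _ (sh_lt hs) (sh_mod hs) c1 c2 l hl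
  intro j hj
  obtain ⟨p, hp, h1, h2⟩ := hT j hj
  refine card_of {p} (by simpa using hp) (by simp) ?_
  intro p' hp'
  simp at hp'; subst hp'
  rw [Nat.testBit_and, cov_wide hm j hj p' hp h1 (l+1) (by omega), h2]; rfl

theorem beq_false' {a b : ℕ} (h : a ≠ b) : Nat.beq a b = false := by
  cases e : Nat.beq a b
  · rfl
  · exact absurd (Nat.eq_of_beq_eq_true e) h

def sv (l : ℕ) : ℕ := 80*(l+1)

theorem strictL_eq {α : Type} (n : Nat) (k : Nat → α) : strictL n k = k n := rfl
theorem fr_nil {α β : Type} (f : α → β → β) (z : β) : fr f z [] = z := rfl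
theorem fr_cons {α β : Type} (f : α → β → β) (z : β) (a : α) (l : List α) : fr f z (a :: l) = f a (fr f z l) := rfl
theorem ite'_true {α : Type} (t e : α) : ite' true t e = t := rfl
theorem ite'_false {α : Type} (t e : α) : ite' false t e = e := rfl
theorem ite'_ff {a b : Bool} (h : ite' a b false = true) : a = true ∧ b = true := by
  cases a <;> simp_all [ite']
theorem ite'_tt {a b : Bool} (h : ite' a true b = true) : a = true ∨ b = true := by
  cases a <;> simp_all [ite']
theorem fcs_eq {α γ : Type} (f : α → (α → γ) → γ) (hf : ∀ a k, f a k = k a) (l : List α) (k : List α → γ) :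
    fcs f l k = k l := by
  induction l generalizing k with
  | nil => rfl
  | cons a l ih => change f a (fun h' => fcs f l fun t' => k (h' :: t')) = _; rw [hf, ih]

theorem nok1_true {S : ℕ → ℕ → Prop} {m n l : ℕ} (hm : Cov S m) (hC : Cl n) (hl : l < 9) (hN : ∀ l' < l, NS S n l') :
    nok1 (m * cR) n (sv l) = true := by
  unfold nok1 sv
  by_cases h0 : l = 0
  · subst h0; rfl
  have h1 : Nat.beq (80*(l+1)) (nat_lit 80) = false := by
    exact beq_false' (show 80*(l+1) ≠ 80 by omega)
  rw [h1, ite'_false, strictL_eq, strictL_eq]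
  have hq : Nat.shiftLeft (nat_lit 2) (Nat.div (80*(l+1)) (nat_lit 80)) = 2^(l+2) := by
    change 2 <<< (80*(l+1)/80) = _
    rw [Nat.mul_div_cancel_left _ (by norm_num), Nat.shiftLeft_eq]; ring
  rw [hq]
  change Nat.beq (flN ((m * cR) &&& n) % 2^(l+2)) (2^(l+2) - 4) = true
  have hb : ∀ l' < l, (flN ((m * cR) &&& n)).testBit (l'+2) = true := fun l' h => flagN hm (hN l' h) hC (by omega)
  have h4 := flN_mod ((m * cR) &&& n)
  generalize flN ((m * cR) &&& n) = f at *
  obtain ⟨g, rfl⟩ : ∃ g, f = 2^2*g := ⟨f/4, by omega⟩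
  have hg : g % 2^l = 2^l - 1 := by
    apply Nat.eq_of_testBit_eq
    intro i
    rw [Nat.testBit_mod_two_pow, Nat.testBit_two_pow_sub_one]
    by_cases hi : i < l
    · have := hb i hi
      rw [Nat.testBit_two_pow_mul] at this
      simp at this
      simp [hi, this]
    · simp [hi]
  rw [Nat.beq_eq, show 2^(l+2) = 2^2 * 2^l by ring, Nat.mul_mod_mul_left, hg, Nat.mul_sub]
  norm_num

theorem nokL_true {S : ℕ → ℕ → Prop} {m : ℕ} (hm : Cov S m) : ∀ (ns ls : List ℕ),
    List.Forall₂ (fun n l => Cl n ∧ l < 9 ∧ ∀ l' < l, NS S n l') ns ls → nokL (m * cR) ns (ls.map sv) = true := by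
  intro ns ls h
  induction h with
  | nil => rfl
  | @cons n l ns ls h _ ih =>
    change ite' (nok1 (m * cR) n (sv l)) (nokL (m * cR) ns (ls.map sv)) false = true
    rw [nok1_true hm h.1 h.2.1 h.2.2, ite'_true, ih]

theorem fold_cov {S : ℕ → ℕ → Prop} : ∀ (Ts ls : List ℕ), List.Forall₂ (fun T l => TS S T l) Ts ls → ∀ m, Cov S m →
    Cov S (fold Ts (ls.map sv) m) := by
  intro ns ls h
  induction h with
  | nil => intro m hm; exact hm
  | @cons n l ns ls h _ ih => intro m hm; exact ih _ (cov_child hm h)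

/-- the inner loop of the search -/
def loop {β : Type} (ih : ℕ → List ℕ → List β → List β) (t m : ℕ) (path : List ℕ) (tail : List β) (n : ℕ) : ℕ → List β :=
  Nat.rec (fun _ => tail)
        (fun _ lih f => Bool.rec
          (strictL (Nat.log2 f) fun b => strictL (Nat.mul (nat_lit 80) (Nat.pred b)) fun s =>
            strictL (Nat.land m (Nat.shiftRight t s)) fun m' =>
              ih m' (s :: path) (strictL (Nat.sub f (Nat.shiftLeft (nat_lit 1) b)) lih))
          tail (Nat.beq f (nat_lit 0))) n

theorem srch_cons {β : Type} (L : Nat → List Nat → List β → List β) (t : ℕ) (ts : List Nat) (m : ℕ) (path : List ℕ) (tail : List β) :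
    srch L (t :: ts) m path tail =
     strictL (fl (Nat.shiftRight (Nat.land (Nat.mul m cR) t) (nat_lit 800))) (loop (srch L ts) t m path tail 9) := rfl

theorem loop_zero {β : Type} (ih : ℕ → List ℕ → List β → List β) (t m : ℕ) (path : List ℕ) (tail : List β) (f : ℕ) :
    loop ih t m path tail 0 f = tail := rfl
theorem loop_succ {β : Type} (ih : ℕ → List ℕ → List β → List β) (t m : ℕ) (path : List ℕ) (tail : List β) (n f : ℕ) :
    loop ih t m path tail (n+1) f = if f = 0 then tail else
      ih (Nat.land m (Nat.shiftRight t (80 * (Nat.log2 f - 1)))) (80 * (Nat.log2 f - 1) :: path)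
        (loop ih t m path tail n (f - 2^(Nat.log2 f))) := by
  by_cases h : f = 0
  · subst h; rfl
  · rw [if_neg h]
    have h1 : Nat.beq f (nat_lit 0) = false := by
      exact beq_false' h
    have : 2^(Nat.log2 f) = Nat.shiftLeft (nat_lit 1) (Nat.log2 f) := by
      change _ = 1 <<< _; rw [Nat.one_shiftLeft]
    rw [this]
    unfold loop
    simp only [h1, strictL_eq]
    rfl

theorem loop_tail {β : Type} (ih : ℕ → List ℕ → List β → List β) (hih : ∀ m p tl, tl <:+ ih m p tl) (t m : ℕ) (path : List ℕ)
    (tail : List β) (n : ℕ) : ∀ f, tail <:+ loop ih t m path tail n f := by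
  induction n with
  | zero => intro f; exact List.suffix_rfl
  | succ n ihn =>
    intro f
    rw [loop_succ]
    split_ifs
    · exact List.suffix_rfl
    · exact (ihn _).trans (hih _ _ _)

theorem top_cases {f k : ℕ} (h : f.testBit k = true) :
    Nat.log2 f = k ∨ (k < Nat.log2 f ∧ (f - 2^(Nat.log2 f)).testBit k = true ∧ f - 2^(Nat.log2 f) < 2^(Nat.log2 f)) := by
  have h0 : f ≠ 0 := by rintro rfl; simp at h
  have h1 := Nat.log2_self_le h0
  have h2 : f < 2^(Nat.log2 f + 1) := Nat.lt_log2_self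
  have h3 : k ≤ Nat.log2 f := by
    by_contra hc
    have : f < 2^k := h2.trans_le (Nat.pow_le_pow_right (by norm_num) (by omega))
    rw [Nat.testBit_lt_two_pow this] at h; simp at h
  rcases h3.eq_or_lt with e | e
  · left; exact e.symm
  · right
    have h4 : f - 2^(Nat.log2 f) < 2^(Nat.log2 f) := by rw [pow_succ] at h2; omega
    refine ⟨e, ?_, h4⟩
    have h5 : f = 2^(Nat.log2 f) * 1 + (f - 2^(Nat.log2 f)) := by omega
    rw [h5, Nat.testBit_two_pow_mul_add _ h4, if_pos e] at h
    exact h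

theorem loop_hit {β : Type} (ih : ℕ → List ℕ → List β → List β) (hih : ∀ m p tl, tl <:+ ih m p tl) (t m : ℕ) (path : List ℕ)
    (tail : List β) (l : ℕ) (n : ℕ) : ∀ f, f < 2^(n+2) → f.testBit (l+2) = true →
    ∃ tl, ih (Nat.land m (Nat.shiftRight t (sv l))) (sv l :: path) tl <:+ loop ih t m path tail n f := by
  induction n with
  | zero =>
    intro f hf hb
    have : f < 2^(l+2) := hf.trans_le (Nat.pow_le_pow_right (by norm_num) (by omega))
    rw [Nat.testBit_lt_two_pow this] at hb; simp at hb
  | succ n ihn =>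
    intro f hf hb
    rw [loop_succ]
    have h0 : f ≠ 0 := by rintro rfl; simp at hb
    rw [if_neg h0]
    rcases top_cases hb with e | ⟨e1, e2, e3⟩
    · rw [e]
      exact ⟨_, List.suffix_rfl⟩
    · have : Nat.log2 f < n+1+2 := (Nat.log2_lt h0).2 hf
      obtain ⟨tl, htl⟩ := ihn _ (e3.trans_le (Nat.pow_le_pow_right (by norm_num) (by omega))) e2
      exact ⟨tl, htl.trans (hih _ _ _)⟩

theorem srch_tail {β : Type} (L : Nat → List Nat → List β → List β) (hL : ∀ m p tl, tl <:+ L m p tl) : ∀ (ts : List ℕ) m p tl,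
    tl <:+ srch L ts m p tl := by
  intro ts
  induction ts with
  | nil => exact hL
  | cons t ts ih => intro m p tl; rw [srch_cons, strictL_eq]; exact loop_tail _ ih _ _ _ _ _ _

theorem srch_hit {β : Type} (L : Nat → List Nat → List β → List β) (hL : ∀ m p tl, tl <:+ L m p tl)
    {S : ℕ → ℕ → Prop} (hB : Big S) : ∀ (ts ls : List ℕ), List.Forall₂ (fun T l => l < 9 ∧ TS S T l) ts ls →
    ∀ m path tail, Cov S m → ∃ m' tl, Cov S m' ∧ L m' ((ls.map sv).reverse ++ path) tl <:+ srch L ts m path tail := by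
  intro ts ls h
  induction h with
  | nil => intro m path tail hm; exact ⟨m, tail, hm, List.suffix_rfl⟩
  | @cons t l ts ls h _ ih =>
    intro m path tail hm
    obtain ⟨tl, h1⟩ := loop_hit (srch L ts) (srch_tail L hL ts) t m path tail l 9 _ (fl_lt _) (flag_srch hm hB h.2 h.1)
    obtain ⟨m', tl', hm', h2⟩ := ih _ (sv l :: path) tl (cov_child hm h.2)
    refine ⟨m', tl', hm', ?_⟩
    rw [srch_cons, strictL_eq]
    simp only [List.map_cons, List.reverse_cons, List.append_assoc, List.singleton_append]
    exact h2.trans h1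

def Hit : List (Nat × Nat × (List Nat → Bool)) → List ℕ → List ℕ → Prop
  | t :: ts, l :: ls, path => t.2.2 (sv l :: path) = true ∨ Hit ts ls (sv l :: path)
  | _, _, _ => False

def bloop (P : List ℕ → Bool) (ih : ℕ → List ℕ → Bool) (t m : ℕ) (path : List ℕ) (n : ℕ) : ℕ → Bool :=
  Nat.rec (fun _ => true)
        (fun _ lih f => Bool.rec
          (strictL (Nat.log2 f) fun b => strictL (Nat.mul (nat_lit 80) (Nat.pred b)) fun s =>
              ite' (ite' (P (s :: path)) true
                (strictL (Nat.land m (Nat.shiftRight t s)) fun m' => ih m' (s :: path)))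
              (strictL (Nat.sub f (Nat.shiftLeft (nat_lit 1) b)) lih) false)
          true (Nat.beq f (nat_lit 0))) n

theorem bloop_succ (P : List ℕ → Bool) (ih : ℕ → List ℕ → Bool) (t m : ℕ) (path : List ℕ) (n f : ℕ) :
    bloop P ih t m path (n+1) f = if f = 0 then true else
      ite' (ite' (P (80 * (Nat.log2 f - 1) :: path)) true
        (ih (Nat.land m (Nat.shiftRight t (80 * (Nat.log2 f - 1)))) (80 * (Nat.log2 f - 1) :: path)))
        (bloop P ih t m path n (f - 2^(Nat.log2 f))) false := by
  by_cases h : f = 0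
  · subst h; rfl
  · rw [if_neg h]
    have h1 : Nat.beq f (nat_lit 0) = false := by
      exact beq_false' h
    have : 2^(Nat.log2 f) = Nat.shiftLeft (nat_lit 1) (Nat.log2 f) := by
      change _ = 1 <<< _; rw [Nat.one_shiftLeft]
    rw [this]
    unfold bloop
    simp only [h1, strictL_eq]
    rfl

theorem bloop_hit (P : List ℕ → Bool) (ih : ℕ → List ℕ → Bool) (t m : ℕ) (path : List ℕ) (l : ℕ) (n : ℕ) :
    ∀ f, f < 2^(n+2) → f.testBit (l+2) = true → bloop P ih t m path n f = true →
    P (sv l :: path) = true ∨ ih (Nat.land m (Nat.shiftRight t (sv l))) (sv l :: path) = true := by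
  induction n with
  | zero =>
    intro f hf hb
    have : f < 2^(l+2) := hf.trans_le (Nat.pow_le_pow_right (by norm_num) (by omega))
    rw [Nat.testBit_lt_two_pow this] at hb; simp at hb
  | succ n ihn =>
    intro f hf hb ht
    rw [bloop_succ] at ht
    have h0 : f ≠ 0 := by rintro rfl; simp at hb
    rw [if_neg h0] at ht
    obtain ⟨t1, t2⟩ := ite'_ff ht
    rcases top_cases hb with e | ⟨e1, e2, e3⟩
    · rw [e] at t1
      exact ite'_tt t1
    · have : Nat.log2 f < n+1+2 := (Nat.log2_lt h0).2 hf
      exact ihn _ (e3.trans_le (Nat.pow_le_pow_right (by norm_num) (by omega))) e2 t2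

theorem bsrch_cons (t : Nat × Nat × (List Nat → Bool)) (ts : List (Nat × Nat × (List Nat → Bool))) (m : ℕ) (path : List ℕ) :
    bsrch (t :: ts) m path = strictL (Nat.land (fl (Nat.shiftRight (Nat.land (Nat.mul m cR) t.1) (nat_lit 800))) t.2.1)
      (bloop t.2.2 (bsrch ts) t.1 m path 9) := rfl

theorem bsrch_hit {S : ℕ → ℕ → Prop} (hB : Big S) : ∀ (ts : List (Nat × Nat × (List Nat → Bool))) (ls : List ℕ),
    List.Forall₂ (fun T l => l < 9 ∧ TS S T.1 l ∧ T.2.1.testBit (l+2) = true) ts ls →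
    ∀ m path, Cov S m → bsrch ts m path = true → Hit ts ls path := by
  intro ts ls h
  induction h with
  | nil => intro m path hm h; exact absurd h (by simp [bsrch])
  | @cons t l ts ls h _ ih =>
    intro m path hm hb
    rw [bsrch_cons, strictL_eq] at hb
    have := bloop_hit _ _ _ _ _ l 9 _ (lt_of_le_of_lt Nat.and_le_left (fl_lt _)) (by
      rw [show ∀ a b, Nat.land a b = a &&& b from fun _ _ => rfl] at *
      rw [Nat.testBit_and, h.2.2, Bool.and_true]
      exact flag_srch hm hB h.2.1 h.1) hb
    rcases this with h1 | h1
    · left; exact h1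
    · right; exact ih _ _ (cov_child hm h.2.1) h1

end CD

namespace CD

abbrev Q5 := ℕ × ℕ × ℕ × ℕ × ℕ
def tl (q : Q5) : List ℕ := t10 q.1 q.2.1 q.2.2.1 q.2.2.2.1 q.2.2.2.2

def Mat (r : ℕ → ℕ → Bool) (u : ℕ → ℕ) (q : Q5) (c : ℕ) : Prop :=
  bt c 0 = r (u q.1) (u q.2.1) ∧ bt c 1 = r (u q.1) (u q.2.2.1) ∧ bt c 2 = r (u q.2.1) (u q.2.2.1) ∧
  bt c 3 = r (u q.1) (u q.2.2.2.1) ∧ bt c 4 = r (u q.2.1) (u q.2.2.2.1) ∧ bt c 5 = r (u q.2.2.1) (u q.2.2.2.1) ∧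
  bt c 6 = r (u q.1) (u q.2.2.2.2) ∧ bt c 7 = r (u q.2.1) (u q.2.2.2.2) ∧ bt c 8 = r (u q.2.2.1) (u q.2.2.2.2) ∧
  bt c 9 = r (u q.2.2.2.1) (u q.2.2.2.2)

def satR (r : ℕ → ℕ → Bool) (a b c l : ℕ) : Bool := satc (r a b) (r a c) (r b c) l
def Law (R : Set (ℕ → ℕ → Bool)) (a b c l : ℕ) : Prop := ∀ r ∈ R, satR r a b c l = true

def SP (R : Set (ℕ → ℕ → Bool)) (u : ℕ → ℕ) (SL : List Q5) (j p : ℕ) : Prop :=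
  ∃ q c, SL[j]? = some q ∧ PT[p]? = some c ∧ ∃ r ∈ R, Mat r u q c

def Lin (r : ℕ → ℕ → Bool) : Prop :=
  (∀ i < 9, ∀ j < 9, i ≠ j → r j i = !(r i j)) ∧
  (∀ i < 9, ∀ j < 9, ∀ k < 9, i ≠ j → j ≠ k → i ≠ k → r i j = true → r j k = true → r i k = true)

def Inj9 (u : ℕ → ℕ) : Prop := (∀ i < 9, u i < 9) ∧ ∀ i < 9, ∀ j < 9, i ≠ j → u i ≠ u j

def Q5ok (q : Q5) : Prop :=
  q.1 < q.2.1 ∧ q.2.1 < q.2.2.1 ∧ q.2.2.1 < q.2.2.2.1 ∧ q.2.2.2.1 < q.2.2.2.2 ∧ q.2.2.2.2 < 9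
instance (q : Q5) : Decidable (Q5ok q) := by unfold Q5ok; infer_instance

structure Hyp (R : Set (ℕ → ℕ → Bool)) : Prop where
  lin : ∀ r ∈ R, Lin r
  law : ∀ i < 9, ∀ j < 9, ∀ k < 9, i ≠ j → j ≠ k → i ≠ k → ∃ l < 9, Law R i j k l
  big : ∀ u, Inj9 u → ∀ q, Q5ok q → ∃ F : Finset ℕ, F ⊆ Finset.range 120 ∧ 17 ≤ F.card ∧
    ∀ p ∈ F, ∃ c, PT[p]? = some c ∧ ∃ r ∈ R, Mat r u q c

/-! ### bits of the tables -/

theorem row_bit_aux (P : ℕ → Bool) (L : List ℕ) (l : ℕ) (hl : l ∈ L) (hP : P l = true) :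
    (fr (fun l ih => Nat.lor (ite' (P l) (Nat.shiftLeft 1 (Nat.mul 80 (Nat.succ l))) 0) ih) 0 L).testBit (80*(l+1)) = true := by
  induction L with
  | nil => simp at hl
  | cons a L ih =>
    rw [fr_cons]
    change ((ite' (P a) (1 <<< (80*(a+1))) 0) ||| _).testBit _ = true
    rw [Nat.testBit_or]
    rcases List.mem_cons.1 hl with h | h
    · subst h; rw [hP, ite'_true, Nat.one_shiftLeft, Nat.testBit_two_pow_self]; rfl
    · rw [ih h, Bool.or_true]

theorem row_bit (g a b c : Bool) (l : ℕ) (hl : l < 9) (h : Bool.xor g (satc a b c l) = true) :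
    (row g a b c).testBit (80*(l+1)) = true := by
  unfold row
  exact row_bit_aux (fun l => Bool.xor g (satc a b c l)) _ l (by
    simp only [List.mem_cons, List.not_mem_nil, or_false]; omega) h

theorem horner_bit (f : ℕ → ℕ) (l : List ℕ) : ∀ (p c i : ℕ), l[p]? = some c → (f c).testBit i = true →
    (horner f l).testBit (800*p+i) = true := by
  induction l with
  | nil => intro p c i h; simp at h
  | cons a l ih =>
    intro p c i h hb
    change (f a ||| (horner f l <<< 800)).testBit _ = true
    rw [Nat.testBit_or, Nat.testBit_shiftLeft]
    cases p with
    | zero => simp at h; subst h; simp [hb]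
    | succ p =>
      have := ih p c i (by simpa using h) hb
      rw [show 800*(p+1)+i - 800 = 800*p+i by omega, this]
      have h2 : 800*(p+1)+i ≥ 800 := by omega
      simp [h2]

def selr (g a b c : Bool) : ℕ :=
  sel (row g false false false) (row g false false true) (row g false true false) (row g false true true)
    (row g true false false) (row g true false true) (row g true true false) (row g true true true) a b c
theorem selr_eq (g a b c : Bool) : selr g a b c = row g a b c := by
  unfold selr
  generalize h0 : row g false false false = r0
  generalize h1 : row g false false true = r1
  generalize h2 : row g false true false = r2
  generalize h3 : row g false true true = r3
  generalize h4 : row g true false false = r4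
  generalize h5 : row g true false true = r5
  generalize h6 : row g true true false = r6
  generalize h7 : row g true true true = r7
  cases a <;> cases b <;> cases c <;> simp only [sel, ite', *]

def Wp (g : Bool) (t : ℕ × ℕ × ℕ) : ℕ := horner (fun c => selr g (bt c t.1) (bt c t.2.1) (bt c t.2.2)) PT
def Wl (g : Bool) : List ℕ := fr (fun t ih => Wp g t :: ih) [] posT

theorem WSP_eq (g : Bool) (k : List ℕ → Bool) : WSP g k = k (Wl g) := by
  unfold WSP
  rw [strictL_eq, strictL_eq, strictL_eq, strictL_eq, strictL_eq, strictL_eq, strictL_eq, strictL_eq, fcs_eq strictL (fun _ _ => strictL_eq _ _)]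
  rfl

theorem fr_map {α β : Type} (f : α → β) (l : List α) : fr (fun t ih => f t :: ih) [] l = l.map f := by
  induction l with
  | nil => rfl
  | cons a l ih => rw [fr_cons, ih]; rfl

theorem Wl_eq (g : Bool) : Wl g = posT.map (Wp g) := fr_map _ _

theorem Wp_bit (g : Bool) (t : ℕ × ℕ × ℕ) (p c l : ℕ) (hp : PT[p]? = some c) (hl : l < 9)
    (h : Bool.xor g (satc (bt c t.1) (bt c t.2.1) (bt c t.2.2) l) = true) : (Wp g t).testBit (800*p+80*(l+1)) = true := by
  unfold Wp
  apply horner_bit _ _ _ c _ hp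
  rw [selr_eq]
  exact row_bit _ _ _ _ _ hl h

theorem ONE0_bit (p c l : ℕ) (hp : PT[p]? = some c) (hl : l < 9) : ONE0.testBit (800*p+80*(l+1)) = true := by
  unfold ONE0
  apply horner_bit _ _ _ c _ hp
  have : ∀ l < 9, cO.testBit (80*(l+1)) = true := by decide +kernel
  exact this l hl

theorem pick_bit (o t i : ℕ) (ho : o.testBit i = true) : ∀ (W A : List ℕ),
    (∀ k w : ℕ, W[k]? = some w → A[k]? = some t → w.testBit i = true) → (pick o W t A).testBit i = true := by
  intro W
  induction W with
  | nil => intro A _; exact ho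
  | cons w W ih =>
    intro A h
    cases A with
    | nil => exact ho
    | cons a A =>
      change (ite' (Nat.beq a t) w (pick o W t A)).testBit i = true
      cases e : Nat.beq a t
      · rw [ite'_false]; apply ih
        intro k w' h1 h2; exact h (k+1) w' (by simpa using h1) (by simpa using h2)
      · rw [ite'_true]
        have := Nat.eq_of_beq_eq_true e
        exact h 0 w (by simp) (by simp [this])

def tabF (o : ℕ) (W : List ℕ) (C : List (List ℕ)) (t : ℕ) : ℕ :=
  fr (fun A ih => Nat.lor (pick o W t A) (Nat.shiftLeft ih 8)) 0 C

theorem tabF_bit (o : ℕ) (W : List ℕ) (t i : ℕ) : ∀ (C : List (List ℕ)) (j : ℕ) (A : List ℕ), C[j]? = some A →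
    (pick o W t A).testBit i = true → (tabF o W C t).testBit (i+8*j) = true := by
  intro C
  induction C with
  | nil => intro j A h; simp at h
  | cons B C ih =>
    intro j A h hb
    change (pick o W t B ||| (tabF o W C t <<< 8)).testBit _ = true
    rw [Nat.testBit_or, Nat.testBit_shiftLeft]
    cases j with
    | zero => simp at h; subst h; simp [hb]
    | succ j =>
      have := ih j A (by simpa using h) hb
      rw [show i + 8*(j+1) - 8 = i+8*j by omega, this]
      have h2 : i+8*(j+1) ≥ 8 := by omega
      simp [h2]

theorem tc_inj {a b c a' b' c' : ℕ} (h1 : a < 16) (h2 : b < 16) (h4 : a' < 16) (h5 : b' < 16)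
    (h : tc a b c = tc a' b' c') : a = a' ∧ b = b' ∧ c = c' := by
  change a + (16*b + 256*c) = a' + (16*b' + 256*c') at h
  omega

theorem tab_bit (g : Bool) (SL : List Q5) (u : ℕ → ℕ) (r : ℕ → ℕ → Bool) (j p cc a b c l : ℕ) (q : Q5)
    (hq : SL[j]? = some q) (hok : Q5ok q) (ha : a < 16) (hb : b < 16) (hp : PT[p]? = some cc) (hM : Mat r u q cc)
    (hl : l < 9) (hs : Bool.xor g (satR r (u a) (u b) (u c) l) = true) (J : ℕ) :
    (Nat.lor J (Nat.shiftLeft (tabF ONE0 (Wl g) (SL.map tl) (tc a b c)) 800)).testBit (800*(p+1)+80*(l+1)+8*j) = true := by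
  change (J ||| (tabF ONE0 (Wl g) (SL.map tl) (tc a b c) <<< 800)).testBit (800*(p+1)+80*(l+1)+8*j) = true
  rw [Nat.testBit_or, Nat.testBit_shiftLeft]
  have h2 : 800*(p+1)+80*(l+1)+8*j ≥ 800 := by omega
  rw [show 800*(p+1)+80*(l+1)+8*j - 800 = (800*p+80*(l+1))+8*j by omega]
  rw [tabF_bit _ _ _ (800*p+80*(l+1)) (SL.map tl) j (tl q) (by simp [hq])]
  · simp [h2]
  apply pick_bit _ _ _ (ONE0_bit p cc l hp hl)
  intro k w hw hA
  rw [Wl_eq, List.getElem?_map] at hw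
  obtain ⟨x0, x1, x2, x3, x4⟩ := q
  obtain ⟨m0, m1, m2, m3, m4, m5, m6, m7, m8, m9⟩ := hM
  obtain ⟨o1, o2, o3, o4, o5⟩ := hok
  simp only at m0 m1 m2 m3 m4 m5 m6 m7 m8 m9 o1 o2 o3 o4 o5
  have hk : k < 10 := by
    by_contra hc
    rw [List.getElem?_eq_none (by simp [posT]; omega)] at hw
    simp at hw
  unfold satR at hs
  interval_cases k <;> simp only [posT, List.getElem?_cons_zero, List.getElem?_cons_succ, Option.map_some, Option.some.injEq] at hw <;>
    simp only [tl, t10, List.getElem?_cons_zero, List.getElem?_cons_succ, Option.some.injEq] at hA <;>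
    subst hw <;> obtain ⟨e1, e2, e3⟩ := tc_inj (by omega) (by omega) (by omega) (by omega) hA <;> subst e1 <;> subst e2 <;> subst e3 <;>
    apply Wp_bit _ _ _ _ _ hp hl <;> simp only [m0, m1, m2, m3, m4, m5, m6, m7, m8, m9] <;> exact hs

def SLok (SL : List Q5) : Prop := SL.length = 10 ∧ ∀ q ∈ SL, Q5ok q

def tabT (SL : List Q5) (t : ℕ) : ℕ := mkT ONE0 (Wl false) (SL.map tl) t
def tabN (SL : List Q5) (t : ℕ) : ℕ := mkN ONE0 (Wl false) (SL.map tl) t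
def tabN' (SL : List Q5) (t : ℕ) : ℕ := mkN ONE0 (Wl true) (SL.map tl) t

theorem TS_T {R : Set (ℕ → ℕ → Bool)} {u : ℕ → ℕ} {SL : List Q5} (hS : SLok SL) {a b c l : ℕ} (ha : a < 16) (hb : b < 16)
    (hl : l < 9) (hL : Law R (u a) (u b) (u c) l) : TS (SP R u SL) (tabT SL (tc a b c)) l := by
  rintro j hj p hp ⟨q, cc, hq, hc, r, hr, hM⟩
  exact tab_bit false SL u r j p cc a b c l q hq (hS.2 q (List.mem_of_getElem? hq)) ha hb hc hM hl (by simpa using hL r hr) _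

theorem TS_N {R : Set (ℕ → ℕ → Bool)} {u : ℕ → ℕ} {SL : List Q5} (hS : SLok SL) {a b c l : ℕ} (ha : a < 16) (hb : b < 16)
    (hl : l < 9) (hL : Law R (u a) (u b) (u c) l) : TS (SP R u SL) (tabN SL (tc a b c)) l := by
  rintro j hj p hp ⟨q, cc, hq, hc, r, hr, hM⟩
  exact tab_bit false SL u r j p cc a b c l q hq (hS.2 q (List.mem_of_getElem? hq)) ha hb hc hM hl (by simpa using hL r hr) _

theorem cl_mk (o : ℕ) (W : List ℕ) (C : List (List ℕ)) (t : ℕ) : Cl (mkN o W C t) := by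
  intro i hi
  change (((junk t) % 2^64) ||| (tabF o W C t <<< 800)).testBit i = true at hi
  rw [Nat.testBit_or, Nat.testBit_mod_two_pow, Nat.testBit_shiftLeft] at hi
  simp at hi
  omega

/-! ### existence of patterns -/
def acy (a b c : Bool) : Bool := !((a && c && !b) || (!a && !c && b))
def cod (b0 b1 b2 b3 b4 b5 b6 b7 b8 b9 : Bool) : ℕ :=
  b0.toNat + 2*(b1.toNat + 2*(b2.toNat + 2*(b3.toNat + 2*(b4.toNat + 2*(b5.toNat + 2*(b6.toNat + 2*(b7.toNat + 2*(b8.toNat + 2*b9.toNat))))))))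
theorem cod_mem : ∀ b0 b1 b2 b3 b4 b5 b6 b7 b8 b9 : Bool,
    (acy b0 b1 b2 && acy b0 b3 b4 && acy b1 b3 b5 && acy b2 b4 b5 && acy b0 b6 b7 && acy b1 b6 b8 && acy b2 b7 b8 &&
     acy b3 b6 b9 && acy b4 b7 b9 && acy b5 b8 b9) = true → PT.contains (cod b0 b1 b2 b3 b4 b5 b6 b7 b8 b9) = true := by
  decide +kernel
theorem cod_bit : ∀ b0 b1 b2 b3 b4 b5 b6 b7 b8 b9 : Bool,
    bt (cod b0 b1 b2 b3 b4 b5 b6 b7 b8 b9) 0 = b0 ∧ bt (cod b0 b1 b2 b3 b4 b5 b6 b7 b8 b9) 1 = b1 ∧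
    bt (cod b0 b1 b2 b3 b4 b5 b6 b7 b8 b9) 2 = b2 ∧ bt (cod b0 b1 b2 b3 b4 b5 b6 b7 b8 b9) 3 = b3 ∧
    bt (cod b0 b1 b2 b3 b4 b5 b6 b7 b8 b9) 4 = b4 ∧ bt (cod b0 b1 b2 b3 b4 b5 b6 b7 b8 b9) 5 = b5 ∧
    bt (cod b0 b1 b2 b3 b4 b5 b6 b7 b8 b9) 6 = b6 ∧ bt (cod b0 b1 b2 b3 b4 b5 b6 b7 b8 b9) 7 = b7 ∧
    bt (cod b0 b1 b2 b3 b4 b5 b6 b7 b8 b9) 8 = b8 ∧ bt (cod b0 b1 b2 b3 b4 b5 b6 b7 b8 b9) 9 = b9 := by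
  decide +kernel

theorem lin_acy {r : ℕ → ℕ → Bool} (hr : Lin r) {i j k : ℕ} (hi : i < 9) (hj : j < 9) (hk : k < 9) (h1 : i ≠ j) (h2 : j ≠ k)
    (h3 : i ≠ k) : acy (r i j) (r i k) (r j k) = true := by
  have t1 := hr.2 i hi j hj k hk h1 h2 h3
  have t2 := hr.2 k hk j hj i hi h2.symm h1.symm h3.symm
  rw [hr.1 j hj k hk h2, hr.1 i hi j hj h1, hr.1 i hi k hk h3] at t2
  revert t1 t2
  cases r i j <;> cases r i k <;> cases r j k <;> simp [acy]

theorem mat_ex {r : ℕ → ℕ → Bool} (hr : Lin r) {u : ℕ → ℕ} (hu : Inj9 u) {q : Q5} (hq : Q5ok q) :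
    ∃ p < 120, ∃ c, PT[p]? = some c ∧ Mat r u q c := by
  obtain ⟨x0, x1, x2, x3, x4⟩ := q
  obtain ⟨o1, o2, o3, o4, o5⟩ := hq
  simp only at o1 o2 o3 o4 o5
  have A : ∀ i j k, i < j → j < k → k < 9 → acy (r (u i) (u j)) (r (u i) (u k)) (r (u j) (u k)) = true := by
    intro i j k h1 h2 h3
    exact lin_acy hr (hu.1 _ (by omega)) (hu.1 _ (by omega)) (hu.1 _ (by omega)) (hu.2 _ (by omega) _ (by omega) (by omega))
      (hu.2 _ (by omega) _ (by omega) (by omega)) (hu.2 _ (by omega) _ (by omega) (by omega))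
  have hm := cod_mem (r (u x0) (u x1)) (r (u x0) (u x2)) (r (u x1) (u x2)) (r (u x0) (u x3)) (r (u x1) (u x3)) (r (u x2) (u x3))
    (r (u x0) (u x4)) (r (u x1) (u x4)) (r (u x2) (u x4)) (r (u x3) (u x4))
    (by rw [A x0 x1 x2, A x0 x1 x3, A x0 x2 x3, A x1 x2 x3, A x0 x1 x4, A x0 x2 x4, A x1 x2 x4, A x0 x3 x4, A x1 x3 x4, A x2 x3 x4] <;> first | rfl | omega)
  have hb := cod_bit (r (u x0) (u x1)) (r (u x0) (u x2)) (r (u x1) (u x2)) (r (u x0) (u x3)) (r (u x1) (u x3)) (r (u x2) (u x3))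
    (r (u x0) (u x4)) (r (u x1) (u x4)) (r (u x2) (u x4)) (r (u x3) (u x4))
  rw [List.contains_iff_mem] at hm
  obtain ⟨p, hp, e⟩ := List.getElem_of_mem hm
  have hlen : PT.length = 120 := by decide +kernel
  exact ⟨p, by omega, _, by rw [List.getElem?_eq_getElem hp, e], hb⟩

theorem NS_N {R : Set (ℕ → ℕ → Bool)} (hR : Hyp R) {u : ℕ → ℕ} (hu : Inj9 u) {SL : List Q5} (hS : SLok SL) {a b c l : ℕ}
    (ha : a < 16) (hb : b < 16) (hl : l < 9) (hL : ¬ Law R (u a) (u b) (u c) l) : NS (SP R u SL) (tabN' SL (tc a b c)) l := by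
  intro j hj
  unfold Law at hL
  push Not at hL
  obtain ⟨r, hr, hs⟩ := hL
  have hj' : j < SL.length := by rw [hS.1]; exact hj
  obtain ⟨p, hp, cc, hc, hM⟩ := mat_ex (hR.lin r hr) hu (hS.2 _ (List.getElem_mem hj'))
  refine ⟨p, hp, ⟨_, cc, List.getElem?_eq_getElem hj', hc, r, hr, hM⟩, ?_⟩
  exact tab_bit true SL u r j p cc a b c l _ (List.getElem?_eq_getElem hj') (hS.2 _ (List.getElem_mem hj')) ha hb hc hM hl (by simpa using hs) _

theorem big_SP {R : Set (ℕ → ℕ → Bool)} (hR : Hyp R) {u : ℕ → ℕ} (hu : Inj9 u) {SL : List Q5} (hS : SLok SL) : Big (SP R u SL) := by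
  intro j hj
  have hj' : j < SL.length := by rw [hS.1]; exact hj
  obtain ⟨F, h1, h2, h3⟩ := hR.big u hu _ (hS.2 _ (List.getElem_mem hj'))
  refine ⟨F, h1, h2, fun p hp => ?_⟩
  obtain ⟨c, hc, hh⟩ := h3 p hp
  exact ⟨_, c, List.getElem?_eq_getElem hj', hc, hh⟩

theorem hornc_bit (k : ℕ) (hk : k < 2^800) (l : List ℕ) : ∀ i, (horner (fun _ => k) l).testBit i = true →
    i < 800 * l.length ∧ k.testBit (i % 800) = true := by
  induction l with
  | nil => intro i h; simp [horner, fr_nil] at h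
  | cons a l ih =>
    intro i h
    change (k ||| (horner (fun _ => k) l <<< 800)).testBit i = true at h
    rw [Nat.testBit_or, Nat.testBit_shiftLeft] at h
    simp only [Bool.or_eq_true, Bool.and_eq_true, decide_eq_true_eq, ge_iff_le, List.length_cons] at h ⊢
    rcases h with h | ⟨h1, h2⟩
    · have : i < 800 := by
        by_contra hc
        rw [Nat.testBit_lt_two_pow (hk.trans_le (Nat.pow_le_pow_right (by norm_num) (by omega)))] at h; simp at h
      rw [Nat.mod_eq_of_lt this]; exact ⟨by omega, h⟩
    · obtain ⟨h3, h4⟩ := ih _ h2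
      rw [show (i - 800) % 800 = i % 800 by omega] at h4
      exact ⟨by omega, h4⟩

theorem cov_ON (S : ℕ → ℕ → Prop) : Cov S ON := by
  have hk : ∀ i < 80, (nat_lit 0x1010101010101010101).testBit i = true → i % 8 = 0 := by decide +kernel
  have hlt : (0x1010101010101010101 : ℕ) < 2^80 := by norm_num
  have hlen : PT.length = 120 := by decide +kernel
  constructor
  · intro i hi
    change (0xffffffffffffffff ||| ((horner (fun _ => nat_lit 0x1010101010101010101) PT) <<< 800)).testBit i = true at hi
    rw [Nat.testBit_or, Nat.testBit_shiftLeft] at hi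
    simp only [Bool.or_eq_true, Bool.and_eq_true, decide_eq_true_eq, ge_iff_le] at hi
    rcases hi with h | ⟨h1, h2⟩
    · left
      by_contra hc
      rw [Nat.testBit_lt_two_pow (lt_of_lt_of_le (by norm_num : 0xffffffffffffffff < 2^64) (Nat.pow_le_pow_right (by norm_num) (by omega)))] at h; simp at h
    · right
      obtain ⟨h3, h4⟩ := hornc_bit _ (lt_of_lt_of_le hlt (Nat.pow_le_pow_right (by norm_num) (by norm_num))) _ _ h2
      rw [hlen] at h3
      have h5 : (i - 800) % 800 < 80 := by
        by_contra hc
        rw [Nat.testBit_lt_two_pow (lt_of_lt_of_le hlt (Nat.pow_le_pow_right (by norm_num) (by omega)))] at h4; simp at h4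
      have := hk _ h5 h4
      omega
  · intro j hj p hp _
    change (0xffffffffffffffff ||| ((horner (fun _ => nat_lit 0x1010101010101010101) PT) <<< 800)).testBit _ = true
    rw [Nat.testBit_or, Nat.testBit_shiftLeft]
    have hb : ∀ j < 10, (nat_lit 0x1010101010101010101).testBit (8*j) = true := by decide +kernel
    have := horner_bit (fun _ => nat_lit 0x1010101010101010101) PT p _ (8*j) (List.getElem?_eq_getElem (by omega)) (hb j hj)
    rw [show 800*(p+1)+8*j - 800 = 800*p+8*j by omega, this]
    have h2 : 800*(p+1)+8*j ≥ 800 := by omega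
    simp [h2]

end CD

namespace CD

theorem mkL_eq (o : Nat) (W : List Nat) (C : List (List Nat)) (ts : List Nat) (k : List Nat → Bool) :
    mkL o W C ts k = k (ts.map (mkT o W C)) := by
  unfold mkL; rw [fcs_eq strictL (fun _ _ => strictL_eq _ _), fr_map]
theorem mkNL_eq (o : Nat) (W : List Nat) (C : List (List Nat)) (ts : List Nat) (k : List Nat → Bool) :
    mkNL o W C ts k = k (ts.map (mkN o W C)) := by
  unfold mkNL; rw [fcs_eq strictL (fun _ _ => strictL_eq _ _), fr_map]

def tT (C : List (List Nat)) (l : List ℕ) : List ℕ := l.map (mkT ONE0 (Wl false) C)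
def tN' (C : List (List Nat)) (l : List ℕ) : List ℕ := l.map (mkN ONE0 (Wl true) C)

def T0 : Tabs := ⟨ON, tN' C1 (tyr 4 5), tN' C2 (tyr 4 5), tN' C2 (tyr 4 6), tN' C2 (txr 5 6),
  tT C1 tq, tT C1 (ts 4), tT C1 (ts 5), tT C1 (ty 4 5),
  tT C2 tq, tT C2 (ts 4), tT C2 (ts 5), tT C2 (tyr 4 5), tT C2 (ts 6), tT C2 (tyr 4 6), tT C2 (tx 5 6),
  tT C3 (ts 5), tT C3 (tyr 4 5), tT C3 (ts 6), tT C3 (tyr 4 6), tT C3 (ts 7), tT C3 (tyr 4 7),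
  tT C3 (txr 5 6), tT C3 (txr 5 7), tT C3 (txr 6 7), mkN ONE0 (Wl false) C3 (tc 5 6 7),
  tT C4 (txr 5 6), tT C4 (txr 5 7), tT C4 (txr 5 8), tT C4 (txr 6 7), tT C4 (txr 6 8), tT C4 (txr 7 8),
  mkT ONE0 (Wl false) C4 (tc 5 6 7), mkT ONE0 (Wl false) C4 (tc 5 6 8), mkT ONE0 (Wl false) C4 (tc 5 7 8),
  mkT ONE0 (Wl false) C4 (tc 6 7 8)⟩

theorem mkTabs_eq (k : Tabs → Bool) : mkTabs k = k T0 := by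
  unfold mkTabs
  simp only [WSP_eq, mkL_eq, mkNL_eq, strictL_eq, T0, tT, tN']

def SL0 : List Q5 := List.replicate 10 (0,1,2,3,4)
def SL1 : List Q5 := [(0,1,2,4,5), (0,1,3,4,5), (0,2,3,4,5), (1,2,3,4,5),
  (0,1,2,4,5), (0,1,2,4,5), (0,1,2,4,5), (0,1,2,4,5), (0,1,2,4,5), (0,1,2,4,5)]
def SL2 : List Q5 := [(0,1,2,5,6), (0,1,3,5,6), (0,2,3,5,6), (1,2,3,5,6),
  (0,1,4,5,6), (0,2,4,5,6), (1,2,4,5,6), (0,3,4,5,6), (1,3,4,5,6), (2,3,4,5,6)]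
def SL3 : List Q5 := [(0,1,5,6,7), (0,2,5,6,7), (1,2,5,6,7), (0,3,5,6,7),
  (1,3,5,6,7), (2,3,5,6,7), (0,4,5,6,7), (1,4,5,6,7), (2,4,5,6,7), (3,4,5,6,7)]
def SL4 : List Q5 := [(0,5,6,7,8), (1,5,6,7,8), (2,5,6,7,8), (3,5,6,7,8),
  (4,5,6,7,8), (0,5,6,7,8), (0,5,6,7,8), (0,5,6,7,8), (0,5,6,7,8), (0,5,6,7,8)]
theorem C0_eq : C0 = SL0.map tl := rfl
theorem C1_eq : C1 = SL1.map tl := rfl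
theorem C2_eq : C2 = SL2.map tl := rfl
theorem C3_eq : C3 = SL3.map tl := rfl
theorem C4_eq : C4 = SL4.map tl := rfl
theorem SL0_ok : SLok SL0 := ⟨rfl, by decide⟩
theorem SL1_ok : SLok SL1 := ⟨rfl, by decide⟩
theorem SL2_ok : SLok SL2 := ⟨rfl, by decide⟩
theorem SL3_ok : SLok SL3 := ⟨rfl, by decide⟩
theorem SL4_ok : SLok SL4 := ⟨rfl, by decide⟩

abbrev Rs := Set (ℕ → ℕ → Bool)
def tcf (t : ℕ × ℕ × ℕ) : ℕ := tc t.1 t.2.1 t.2.2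
def LawP (R : Rs) (u : ℕ → ℕ) (t : ℕ × ℕ × ℕ) (l : ℕ) : Prop :=
  t.1 < 16 ∧ t.2.1 < 16 ∧ l < 9 ∧ Law R (u t.1) (u t.2.1) (u t.2.2) l

theorem tT_ok {R : Rs} {u : ℕ → ℕ} {SL : List Q5} (hS : SLok SL) {C : List (List ℕ)} (hC : C = SL.map tl)
    {P : List (ℕ × ℕ × ℕ)} {ls : List ℕ} (h : List.Forall₂ (LawP R u) P ls) (L : List ℕ) (hL : L = P.map tcf) :
    List.Forall₂ (fun T l => l < 9 ∧ TS (SP R u SL) T l) (tT C L) ls := by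
  subst hC; subst hL
  unfold tT
  rw [List.map_map, List.forall₂_map_left_iff]
  refine h.imp fun t l ⟨h1, h2, h3, h4⟩ => ⟨h3, ?_⟩
  have := TS_T hS h1 h2 h3 h4
  unfold tabT at this
  rw [Function.comp_apply, tcf]
  exact this

theorem tT_ok' {R : Rs} {u : ℕ → ℕ} {SL : List Q5} (hS : SLok SL) {C : List (List ℕ)} (hC : C = SL.map tl)
    {P : List (ℕ × ℕ × ℕ)} {ls : List ℕ} (h : List.Forall₂ (LawP R u) P ls) (L : List ℕ) (hL : L = P.map tcf) (m : ℕ)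
    (hm : Cov (SP R u SL) m) : Cov (SP R u SL) (fold (tT C L) (ls.map sv) m) :=
  fold_cov _ _ ((tT_ok hS hC h L hL).imp fun _ _ h => h.2) _ hm

def LeastP (R : Rs) (u : ℕ → ℕ) (t : ℕ × ℕ × ℕ) (l : ℕ) : Prop :=
  t.1 < 16 ∧ t.2.1 < 16 ∧ l < 9 ∧ ∀ l' < l, ¬ Law R (u t.1) (u t.2.1) (u t.2.2) l'

theorem tN_ok {R : Rs} (hR : Hyp R) {u : ℕ → ℕ} (hu : Inj9 u) {SL : List Q5} (hS : SLok SL) {C : List (List ℕ)} (hC : C = SL.map tl)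
    {P : List (ℕ × ℕ × ℕ)} {ls : List ℕ} (h : List.Forall₂ (LeastP R u) P ls) (L : List ℕ) (hL : L = P.map tcf)
    {m : ℕ} (hm : Cov (SP R u SL) m) : nokL (Nat.mul m cR) (tN' C L) (ls.map sv) = true := by
  apply nokL_true hm
  subst hC; subst hL
  unfold tN'
  rw [List.map_map, List.forall₂_map_left_iff]
  exact h.imp fun t l ⟨h1, h2, h3, h4⟩ => ⟨by rw [Function.comp_apply]; exact cl_mk _ _ _ _, h3, fun l' hl => by
    have := NS_N hR hu hS h1 h2 (by omega) (h4 l' hl)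
    unfold tabN' at this
    rw [Function.comp_apply, tcf]
    exact this⟩

open Classical in
noncomputable def lm (R : Rs) (a b c : ℕ) : ℕ := if h : ∃ l, Law R a b c l then Nat.find h else 0

theorem lm_spec {R : Rs} (hR : Hyp R) {a b c : ℕ} (ha : a < 9) (hb : b < 9) (hc : c < 9) (h1 : a ≠ b) (h2 : b ≠ c) (h3 : a ≠ c) :
    lm R a b c < 9 ∧ Law R a b c (lm R a b c) ∧ ∀ l' < lm R a b c, ¬ Law R a b c l' := by
  obtain ⟨l, hl, hL⟩ := hR.law a ha b hb c hc h1 h2 h3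
  have h : ∃ l, Law R a b c l := ⟨l, hL⟩
  classical
  have e : lm R a b c = Nat.find h := by unfold lm; rw [dif_pos h]
  rw [e]
  exact ⟨(Nat.find_min' h hL).trans_lt hl, Nat.find_spec h, fun l' h' => Nat.find_min h h'⟩

def World (u : ℕ → ℕ) : Prop := Inj9 u ∧ ∀ n < 5, u n = n

theorem World.ge {u : ℕ → ℕ} (h : World u) {n : ℕ} (h5 : 5 ≤ n) (h9 : n < 9) : 5 ≤ u n ∧ u n < 9 := by
  refine ⟨?_, h.1.1 n h9⟩
  by_contra hc
  push Not at hc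
  have h1 := h.2 _ hc
  exact h.1.2 n h9 (u n) (by omega) (by omega) h1.symm

def P6 : List (ℕ × ℕ) := [(0,1),(0,2),(1,2),(0,3),(1,3),(2,3)]
def HasT (R : Rs) (x : ℕ) (ls : List ℕ) : Prop :=
  List.Forall₂ (fun (ab : ℕ × ℕ) l => ab.1 < 5 ∧ ab.2 < 5 ∧ l < 9 ∧ Law R ab.1 ab.2 x l) P6 ls
def Q0 (R : Rs) : Prop := Law R 0 1 2 2 ∧ Law R 0 1 3 2 ∧ Law R 0 2 3 3 ∧ Law R 1 2 3 3

def pts (e : ℕ) : List (ℕ × ℕ × ℕ) := P6.map fun ab => (ab.1, ab.2, e)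
theorem pts_eq (e : ℕ) : ts e = (pts e).map tcf := rfl
def pql : List (ℕ × ℕ × ℕ) := [(0,1,2),(0,1,3),(0,2,3),(1,2,3)]
theorem pql_eq : tq = pql.map tcf := rfl
def py (L : List ℕ) (d e : ℕ) : List (ℕ × ℕ × ℕ) := L.map fun a => (a, d, e)

theorem pts_law {R : Rs} {u : ℕ → ℕ} (hu : World u) {e x : ℕ} (he : u e = x) {ls : List ℕ} (h : HasT R x ls) :
    List.Forall₂ (LawP R u) (pts e) ls := by
  unfold pts
  rw [List.forall₂_map_left_iff]
  refine h.imp fun ab l ⟨h1, h2, h3, h4⟩ => ⟨by simp only; omega, by simp only; omega, h3, ?_⟩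
  simp only [hu.2 _ h1, hu.2 _ h2, he]; exact h4

theorem pql_law {R : Rs} {u : ℕ → ℕ} (hu : World u) (h : Q0 R) : List.Forall₂ (LawP R u) pql [2,2,3,3] := by
  obtain ⟨h1, h2, h3, h4⟩ := h
  unfold pql LawP
  simp only [List.forall₂_cons, List.Forall₂.nil, hu.2 0 (by omega), hu.2 1 (by omega), hu.2 2 (by omega), hu.2 3 (by omega)]
  exact ⟨⟨by omega, by omega, by omega, h1⟩, ⟨by omega, by omega, by omega, h2⟩, ⟨by omega, by omega, by omega, h3⟩, ⟨by omega, by omega, by omega, h4⟩, trivial⟩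

/-- least laws of the triples (a, d, e) -/
theorem py_law {R : Rs} (hR : Hyp R) {u : ℕ → ℕ} (hu : World u) (L : List ℕ) {d e : ℕ} (hd : d < 9) (he : e < 9) (hde : d ≠ e)
    (hL : ∀ a ∈ L, a < 5 ∧ a ≠ d ∧ a ≠ e) :
    List.Forall₂ (fun t l => LawP R u t l ∧ LeastP R u t l) (py L d e) (L.map fun a => lm R a (u d) (u e)) := by
  unfold py
  rw [List.forall₂_map_left_iff, List.forall₂_map_right_iff, List.forall₂_same]
  intro a ha
  obtain ⟨h1, h2, h3⟩ := hL a ha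
  have := lm_spec hR (hu.1.1 a (by omega)) (hu.1.1 d hd) (hu.1.1 e he) (hu.1.2 a (by omega) d hd h2) (hu.1.2 d hd e he hde) (hu.1.2 a (by omega) e he h3)
  rw [hu.2 a h1] at this
  obtain ⟨g1, g2, g3⟩ := this
  refine ⟨⟨by simp only; omega, by simp only; omega, g1, ?_⟩, ⟨by simp only; omega, by simp only; omega, g1, ?_⟩⟩
  · simp only [hu.2 a h1]; exact g2
  · simp only [hu.2 a h1]; exact g3

theorem py1 {R : Rs} {u : ℕ → ℕ} {a b} (h : List.Forall₂ (fun t l => LawP R u t l ∧ LeastP R u t l) a b) : List.Forall₂ (LawP R u) a b :=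
  h.imp fun _ _ h => h.1
theorem py2 {R : Rs} {u : ℕ → ℕ} {a b} (h : List.Forall₂ (fun t l => LawP R u t l ∧ LeastP R u t l) a b) : List.Forall₂ (LeastP R u) a b :=
  h.imp fun _ _ h => h.2

noncomputable def YL (R : Rs) (x : ℕ) : List ℕ := [3,1,0,2].map fun a => lm R a 4 x
noncomputable def XL (R : Rs) (x y : ℕ) : List ℕ := [4,3,1,0,2].map fun a => lm R a x y

theorem y_law {R : Rs} (hR : Hyp R) {u : ℕ → ℕ} (hu : World u) {e : ℕ} (he : e < 9) (h5 : 5 ≤ e) :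
    List.Forall₂ (fun t l => LawP R u t l ∧ LeastP R u t l) (py [3,1,0,2] 4 e) (YL R (u e)) := by
  have := py_law hR hu [3,1,0,2] (d := 4) (e := e) (by omega) he (by omega) (by
    intro a ha; simp only [List.mem_cons, List.not_mem_nil, or_false] at ha; omega)
  rw [hu.2 4 (by omega)] at this
  exact this
theorem x_law {R : Rs} (hR : Hyp R) {u : ℕ → ℕ} (hu : World u) {d e : ℕ} (hd : d < 9) (h5' : 5 ≤ d) (he : e < 9) (h5 : 5 ≤ e) (hde : d ≠ e) :
    List.Forall₂ (fun t l => LawP R u t l ∧ LeastP R u t l) (py [4,3,1,0,2] d e) (XL R (u d) (u e)) := by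
  exact py_law hR hu [4,3,1,0,2] (d := d) (e := e) hd he hde (by
    intro a ha; simp only [List.mem_cons, List.not_mem_nil, or_false] at ha; omega)

structure UOK (R : Rs) (x : ℕ) (U : URec) : Prop where
  y : U.y = (YL R x).map sv
  a5 : ∀ u, World u → u 5 = x → Cov (SP R u SL2) U.a5
  a6 : ∀ u, World u → u 6 = x → Cov (SP R u SL2) U.a6
  b1 : ∀ u, World u → u 5 = x → Cov (SP R u SL3) U.b1
  b2 : ∀ u, World u → u 6 = x → Cov (SP R u SL3) U.b2
  b3 : ∀ u, World u → u 7 = x → Cov (SP R u SL3) U.b3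

structure EOK (R : Rs) (x x' : ℕ) (E : ERec) : Prop where
  y : E.y = (XL R x x').map sv
  sh : ShW E.e12
  cl : Cl E.e12
  e12 : ∀ u, World u → u 5 = x → u 6 = x' → ∀ l < 9, Law R (u 5) (u 6) (u 7) l → TS (SP R u SL3) E.e12 l
  e13 : ∀ u, World u → u 5 = x → u 7 = x' → CovW (SP R u SL3) E.e13
  e23 : ∀ u, World u → u 6 = x → u 7 = x' → CovW (SP R u SL3) E.e23

def Base (R : Rs) (SL : List Q5) (m : ℕ) : Prop := ∀ u, World u → Cov (SP R u SL) m

theorem mkU_mem {R : Rs} (hR : Hyp R) {base2 x : ℕ} {ls : List ℕ} (hb : Base R SL2 base2) (hT : HasT R x ls) (tail : List URec) :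
    ∃ U, UOK R x U ∧ mkU T0 base2 (ls.map sv) ((YL R x).map sv) tail = U :: tail := by
  refine ⟨_, ?_, by unfold mkU; simp only [strictL_eq]; rfl⟩
  refine ⟨rfl, ?_, ?_, ?_, ?_, ?_⟩
  · rintro u hu rfl
    exact tT_ok' SL2_ok C2_eq (py1 (y_law hR hu (by omega) (by omega))) _ rfl _
      (tT_ok' SL2_ok C2_eq (pts_law hu rfl hT) _ rfl _ (hb u hu))
  · rintro u hu rfl
    exact tT_ok' SL2_ok C2_eq (py1 (y_law hR hu (by omega) (by omega))) _ rfl _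
      (tT_ok' SL2_ok C2_eq (pts_law hu rfl hT) _ rfl _ (cov_ON _))
  · rintro u hu rfl
    exact tT_ok' SL3_ok C3_eq (py1 (y_law hR hu (by omega) (by omega))) _ rfl _
      (tT_ok' SL3_ok C3_eq (pts_law hu rfl hT) _ rfl _ (cov_ON _))
  · rintro u hu rfl
    exact tT_ok' SL3_ok C3_eq (py1 (y_law hR hu (by omega) (by omega))) _ rfl _
      (tT_ok' SL3_ok C3_eq (pts_law hu rfl hT) _ rfl _ (cov_ON _))
  · rintro u hu rfl
    exact tT_ok' SL3_ok C3_eq (py1 (y_law hR hu (by omega) (by omega))) _ rfl _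
      (tT_ok' SL3_ok C3_eq (pts_law hu rfl hT) _ rfl _ (cov_ON _))

theorem ite'_suf {β : Type} (b : Bool) (l t : List β) (h : t <:+ l) : t <:+ ite' b l t := by
  cases b
  · exact List.suffix_rfl
  · rw [ite'_true]; exact h

theorem leaf1_suf (base2 : ℕ) (s : List ℕ) (m : ℕ) (y : List ℕ) (tail : List URec) : tail <:+ leaf1 T0 base2 s m y tail := by
  unfold leaf1
  apply ite'_suf
  unfold mkU
  simp only [strictL_eq]
  exact List.suffix_cons _ _

theorem lev1_cons (T : Tabs) (b1 b2 : ℕ) (a : List ℕ) (al : List (List ℕ)) : lev1 T b1 b2 (a :: al) =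
    strictL (fold T.s1 a b1) fun m => srch (leaf1 T b2 a) T.y1 m [] (lev1 T b1 b2 al) := rfl

theorem lev1_mem {R : Rs} (hR : Hyp R) {base1 base2 : ℕ} (hb1 : Base R SL1 base1) (hb2 : Base R SL2 base2) {x : ℕ} {u : ℕ → ℕ} (hu : World u)
    (hx : u 5 = x) {ls : List ℕ} (hT : HasT R x ls) : ∀ (als : List (List ℕ)), ls ∈ als →
    ∃ U ∈ lev1 T0 base1 base2 (als.map (List.map sv)), UOK R x U := by
  intro als
  induction als with
  | nil => intro h; simp at h
  | cons a als ih =>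
    intro h
    rw [List.map_cons, lev1_cons, strictL_eq]
    rcases List.mem_cons.1 h with h | h
    · subst h
      subst hx
      have hy := y_law hR hu (e := 5) (by omega) (by omega)
      have hy' : List.Forall₂ (LawP R u) (py [2,0,1,3] 4 5) ([2,0,1,3].map fun a => lm R a 4 (u 5)) := by
        have := List.rel_reverse (py1 hy); exact this
      obtain ⟨m', tl, hm', hs⟩ := srch_hit (leaf1 T0 base2 (ls.map sv)) (leaf1_suf base2 (ls.map sv)) (big_SP hR hu.1 SL1_ok) T0.y1 _
        (tT_ok SL1_ok C1_eq hy' (ty 4 5) rfl) (fold T0.s1 (ls.map sv) base1) [] (lev1 T0 base1 base2 (als.map (List.map sv)))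
        (tT_ok' SL1_ok C1_eq (pts_law hu rfl hT) (ts 5) rfl _ (hb1 u hu))
      have e : (([2,0,1,3].map fun a => lm R a 4 (u 5)).map sv).reverse ++ [] = (YL R (u 5)).map sv := rfl
      rw [e] at hs
      have hn : nokL (Nat.mul m' cR) T0.n1 ((YL R (u 5)).map sv) = true := tN_ok hR hu.1 SL1_ok C1_eq (py2 hy) (tyr 4 5) rfl hm'
      unfold leaf1 at hs
      rw [strictL_eq, hn, ite'_true] at hs
      obtain ⟨U, hU, e⟩ := mkU_mem hR hb2 hT tl
      rw [e] at hs
      exact ⟨U, hs.subset (by simp), hU⟩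
    · obtain ⟨U, h1, h2⟩ := ih h
      exact ⟨U, (srch_tail _ (leaf1_suf _ _) _ _ _ _).subset h1, h2⟩

theorem covW_and {S : ℕ → ℕ → Prop} {T l a b : ℕ} (hl : l < 9) (h1 : TS S T l) (h2 : CovW S a) (h3 : CovW S b) :
    TS S (Nat.land (Nat.land T a) b) l := by
  intro j hj p hp hs
  change ((T &&& a) &&& b).testBit _ = true
  rw [Nat.testBit_and, Nat.testBit_and, h1 j hj p hp hs, h2 j hj p hp hs (l+1) (by omega), h3 j hj p hp hs (l+1) (by omega)]; rfl
theorem covW_TS {S : ℕ → ℕ → Prop} {T l a : ℕ} (hl : l < 9) (h1 : TS S T l) (h2 : CovW S a) : TS S (Nat.land a T) l := by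
  intro j hj p hp hs
  change (a &&& T).testBit _ = true
  rw [Nat.testBit_and, h1 j hj p hp hs, h2 j hj p hp hs (l+1) (by omega)]; rfl
theorem shW_and {a : ℕ} (h : ShW a) (b : ℕ) : ShW (Nat.land a b) := by
  intro i hi; change (a &&& b).testBit i = true at hi; rw [Nat.testBit_and, Bool.and_eq_true] at hi; exact h i hi.1
theorem cl_and {a : ℕ} (h : Cl a) (b : ℕ) : Cl (Nat.land a b) := by
  intro i hi; change (a &&& b).testBit i = true at hi; rw [Nat.testBit_and, Bool.and_eq_true] at hi; exact h i hi.1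
theorem cl_and' {a : ℕ} (h : Cl a) (b : ℕ) : Cl (Nat.land b a) := by
  intro i hi; change (b &&& a).testBit i = true at hi; rw [Nat.testBit_and, Bool.and_eq_true] at hi; exact h i hi.2

theorem T0_t567 : T0.t567 = mkN ONE0 (Wl false) C3 (tc 5 6 7) := by unfold T0; with_reducible rfl
theorem T0_t567' : T0.t567 = tabN SL3 (tc 5 6 7) := by rw [T0_t567, C3_eq, tabN]
theorem mkE_eq (T : Tabs) (U W : URec) (y : List ℕ) (tail : List ERec) : mkE T U W y tail =
  ⟨y, Nat.land (Nat.mul (fold T.x56 y U.b1) cR) T.t567,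
    Nat.mul (fold T.x57 y W.b3) cR, Nat.mul (fold T.x67 y U.b2) cR⟩ :: tail := by
  unfold mkE
  rw [strictL_eq, strictL_eq, strictL_eq]
theorem mkE_mem {R : Rs} (hR : Hyp R) {x x' : ℕ} {U W : URec} (hU : UOK R x U) (hW : UOK R x' W) {u : ℕ → ℕ} (hu : World u)
    (hx : u 5 = x) (hx' : u 6 = x') (tail : List ERec) :
    ∃ E, EOK R x x' E ∧ mkE T0 U W ((XL R x x').map sv) tail = E :: tail := by
  refine ⟨⟨(XL R x x').map sv, Nat.land (Nat.mul (fold T0.x56 ((XL R x x').map sv) U.b1) cR) T0.t567,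
    Nat.mul (fold T0.x57 ((XL R x x').map sv) W.b3) cR, Nat.mul (fold T0.x67 ((XL R x x').map sv) U.b2) cR⟩, ?_,
    mkE_eq _ _ _ _ _⟩
  have h12 : ∀ v, World v → v 5 = x → v 6 = x' → Cov (SP R v SL3) (fold T0.x56 ((XL R x x').map sv) U.b1) := by
    rintro v hv rfl rfl
    exact tT_ok' SL3_ok C3_eq (py1 (x_law hR hv (d := 5) (e := 6) (by omega) (by omega) (by omega) (by omega) (by omega))) (txr 5 6) rfl _ (hU.b1 v hv rfl)
  refine ⟨rfl, ?_, ?_, ?_, ?_, ?_⟩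
  · exact shW_and (sh_wide (h12 u hu hx hx').1) _
  · exact cl_and' (T0_t567 ▸ cl_mk _ _ _ _) _
  · intro v hv h1 h2 l hl hL
    refine covW_TS hl ?_ (cov_wide (h12 v hv h1 h2))
    rw [T0_t567']
    exact TS_N SL3_ok (by omega) (by omega) hl hL
  · rintro v hv rfl rfl
    apply cov_wide
    exact tT_ok' SL3_ok C3_eq (py1 (x_law hR hv (d := 5) (e := 7) (by omega) (by omega) (by omega) (by omega) (by omega))) (txr 5 7) rfl _ (hW.b3 v hv rfl)
  · rintro v hv rfl rfl
    apply cov_wide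
    exact tT_ok' SL3_ok C3_eq (py1 (x_law hR hv (d := 6) (e := 7) (by omega) (by omega) (by omega) (by omega) (by omega))) (txr 6 7) rfl _ (hU.b2 v hv rfl)

theorem leaf2_suf (U W : URec) (m : ℕ) (y : List ℕ) (tail : List ERec) : tail <:+ leaf2 T0 U W m y tail := by
  unfold leaf2
  apply ite'_suf
  rw [mkE_eq]
  exact List.suffix_cons _ _

theorem cov_and {S : ℕ → ℕ → Prop} {a b : ℕ} (h1 : Cov S a) (h2 : Cov S b) : Cov S (Nat.land a b) := by
  refine ⟨fun i hi => ?_, fun j hj p hp hs => ?_⟩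
  · change (a &&& b).testBit i = true at hi; rw [Nat.testBit_and, Bool.and_eq_true] at hi; exact h1.1 i hi.1
  · change (a &&& b).testBit _ = true
    rw [Nat.testBit_and, h1.2 j hj p hp hs, h2.2 j hj p hp hs]; rfl

theorem edges_mem {R : Rs} (hR : Hyp R) {x x' : ℕ} {U W : URec} (hU : UOK R x U) (hW : UOK R x' W) {u : ℕ → ℕ} (hu : World u)
    (hx : u 5 = x) (hx' : u 6 = x') : ∃ E ∈ edges T0 U W, EOK R x x' E := by
  have hxl := x_law hR hu (d := 5) (e := 6) (by omega) (by omega) (by omega) (by omega) (by omega)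
  have hxl' : List.Forall₂ (LawP R u) (py [2,0,1,3,4] 5 6) ([2,0,1,3,4].map fun a => lm R a (u 5) (u 6)) := by
    have := List.rel_reverse (py1 hxl); exact this
  unfold edges
  rw [strictL_eq]
  obtain ⟨m', tl, hm', hs⟩ := srch_hit (leaf2 T0 U W) (leaf2_suf U W) (big_SP hR hu.1 SL2_ok) T0.x2 _
        (tT_ok SL2_ok C2_eq hxl' (tx 5 6) rfl) (Nat.land U.a5 W.a6) [] [] (cov_and (hU.a5 u hu hx) (hW.a6 u hu hx'))
  have e : (([2,0,1,3,4].map fun a => lm R a (u 5) (u 6)).map sv).reverse ++ [] = (XL R (u 5) (u 6)).map sv := rfl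
  rw [e] at hs
  have n1 : nokL (Nat.mul m' cR) T0.nx ((XL R (u 5) (u 6)).map sv) = true := tN_ok hR hu.1 SL2_ok C2_eq (py2 hxl) (txr 5 6) rfl hm'
  have n2 : nokL (Nat.mul m' cR) T0.n6 W.y = true := by
    rw [hW.y, ← hx']; exact tN_ok hR hu.1 SL2_ok C2_eq (py2 (y_law hR hu (e := 6) (by omega) (by omega))) (tyr 4 6) rfl hm'
  have n3 : nokL (Nat.mul m' cR) T0.n5 U.y = true := by
    rw [hU.y, ← hx]; exact tN_ok hR hu.1 SL2_ok C2_eq (py2 (y_law hR hu (e := 5) (by omega) (by omega))) (tyr 4 5) rfl hm'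
  unfold leaf2 at hs
  rw [strictL_eq, n1, n2, n3, ite'_true, ite'_true, ite'_true, hx, hx'] at hs
  obtain ⟨E, hE, e⟩ := mkE_mem hR hU hW hu hx hx' tl
  rw [e] at hs
  exact ⟨E, hs.subset (by simp), hE⟩

theorem tri_flag {R : Rs} (hR : Hyp R) {u : ℕ → ℕ} (hu : World u) {e1 e2 e3 : ERec} (h1 : EOK R (u 5) (u 6) e1) (h2 : EOK R (u 5) (u 7) e2)
    (h3 : EOK R (u 6) (u 7) e3) (l : ℕ) (hl : l < 9) (hL : Law R (u 5) (u 6) (u 7) l) :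
    (fl (Nat.land (Nat.land e1.e12 e2.e13) e3.e23)).testBit (l+2) = true := by
  refine flag_direct (shW_and (shW_and h1.sh _) _) (cl_and (cl_and h1.cl _) _) (big_SP hR hu.1 SL3_ok) ?_ hl
  exact covW_and hl (h1.e12 u hu rfl rfl l hl hL) (h2.e13 u hu rfl rfl) (h3.e23 u hu rfl rfl)

def FOK (R : Rs) (x y z f : ℕ) : Prop := ∀ l < 9, Law R x y z l → f.testBit (l+2) = true

theorem FOK_ne {R : Rs} (hR : Hyp R) {u : ℕ → ℕ} (hu : World u) {f : ℕ} (hf : FOK R (u 5) (u 6) (u 7) f) : Nat.beq f 0 = false := by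
  obtain ⟨l, hl, hL⟩ := hR.law _ (hu.1.1 5 (by omega)) _ (hu.1.1 6 (by omega)) _ (hu.1.1 7 (by omega)) (hu.1.2 _ (by omega) _ (by omega) (by omega))
    (hu.1.2 _ (by omega) _ (by omega) (by omega)) (hu.1.2 _ (by omega) _ (by omega) (by omega))
  apply beq_false'
  rintro rfl
  have := hf l hl hL
  simp at this

theorem tri_mem {R : Rs} (hR : Hyp R) {u : ℕ → ℕ} (hu : World u) {e1 e2 : ERec} (h1 : EOK R (u 5) (u 6) e1) (h2 : EOK R (u 5) (u 7) e2)
    (G : List ERec) (hG : ∃ e3 ∈ G, EOK R (u 6) (u 7) e3) :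
    ∃ p ∈ tri e1 e2 G, EOK R (u 6) (u 7) p.1 ∧ FOK R (u 5) (u 6) (u 7) p.2 := by
  unfold tri
  rw [strictL_eq]
  induction G with
  | nil => simp at hG
  | cons a G ih =>
    rw [fr_cons, strictL_eq]
    obtain ⟨e3, hm, he⟩ := hG
    rcases List.mem_cons.1 hm with h | h
    · subst h
      have hf : FOK R (u 5) (u 6) (u 7) (fl (Nat.land (Nat.land e1.e12 e2.e13) e3.e23)) := tri_flag hR hu h1 h2 he
      rw [FOK_ne hR hu hf, ite'_false]
      exact ⟨_, List.mem_cons_self, he, hf⟩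
    · obtain ⟨p, hp, h'⟩ := ih ⟨e3, h, he⟩
      refine ⟨p, ?_, h'⟩
      cases Nat.beq (fl (Nat.land (Nat.land e1.e12 e2.e13) a.e23)) 0
      · rw [ite'_false]; exact List.mem_cons_of_mem _ hp
      · rw [ite'_true]; exact hp

theorem fr_all {α : Type} (f : α → Bool) (l : List α) (h : fr (fun a ih => ite' (f a) ih false) true l = true) : ∀ a ∈ l, f a = true := by
  induction l with
  | nil => intro a ha; simp at ha
  | cons b l ih =>
    rw [fr_cons] at h
    obtain ⟨h1, h2⟩ := ite'_ff h
    intro a ha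
    rcases List.mem_cons.1 ha with e | e
    · rw [e]; exact h1
    · exact ih h2 a e

end CD

namespace CD

theorem chk4_get {T : Tabs} {e1 e2 e3 : ERec} {l12 l13 l23 : List (ERec × Nat)} (h : chk4 T e1 e2 e3 l12 l13 l23 = true)
    {e g k : ERec × ℕ} (he : e ∈ l12) (hg : g ∈ l13) (hk : k ∈ l23)
    (hf : Nat.beq (fl (Nat.land (Nat.land e.1.e12 g.1.e13) k.1.e23)) 0 = false) :
    bsrch [(T.q567, e.2, fun _ => false), (T.q568, g.2, fun _ => false), (T.q578, k.2, fun _ => false),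
       (T.q678, fl (Nat.land (Nat.land e.1.e12 g.1.e13) k.1.e23), fun _ => false)]
       (fold T.k78 k.1.y (fold T.k68 g.1.y (fold T.k67 e.1.y (fold T.k58 e3.y (fold T.k57 e2.y (fold T.k56 e1.y T.on)))))) [] = true := by
  unfold chk4 at h
  have h1 := fr_all _ _ h e he
  have h2 := fr_all _ _ h1 g hg
  rw [strictL_eq] at h2
  have h3 := fr_all _ _ h2 k hk
  rw [strictL_eq, hf, ite'_false, strictL_eq] at h3
  exact h3

theorem T0_q567 : T0.q567 = tabT SL4 (tc 5 6 7) := by unfold T0; rw [C4_eq, tabT]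
theorem T0_q568 : T0.q568 = tabT SL4 (tc 5 6 8) := by unfold T0; rw [C4_eq, tabT]
theorem T0_q578 : T0.q578 = tabT SL4 (tc 5 7 8) := by unfold T0; rw [C4_eq, tabT]
theorem T0_q678 : T0.q678 = tabT SL4 (tc 6 7 8) := by unfold T0; rw [C4_eq, tabT]

def w4 (a b c d : ℕ) (n : ℕ) : ℕ := if n = 5 then a else if n = 6 then b else if n = 7 then c else if n = 8 then d else n
theorem w4_world {a b c d : ℕ} (ha : 5 ≤ a ∧ a < 9) (hb : 5 ≤ b ∧ b < 9) (hc : 5 ≤ c ∧ c < 9) (hd : 5 ≤ d ∧ d < 9)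
    (h1 : a ≠ b) (h2 : a ≠ c) (h3 : a ≠ d) (h4 : b ≠ c) (h5 : b ≠ d) (h6 : c ≠ d) : World (w4 a b c d) := by
  refine ⟨⟨fun i hi => ?_, fun i hi j hj hij => ?_⟩, fun n hn => ?_⟩
  · unfold w4; split_ifs <;> omega
  · unfold w4; split_ifs <;> omega
  · unfold w4; split_ifs <;> omega
theorem w4_ex {a b : ℕ} (ha : 5 ≤ a ∧ a < 9) (hb : 5 ≤ b ∧ b < 9) (h1 : a ≠ b) : ∃ u, World u ∧ u 5 = a ∧ u 6 = b := by
  have : ∀ a ∈ [5,6,7,8], ∀ b ∈ [5,6,7,8], a ≠ b → ∃ c ∈ [5,6,7,8], ∃ d ∈ [5,6,7,8], a ≠ c ∧ a ≠ d ∧ b ≠ c ∧ b ≠ d ∧ c ≠ d := by decide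
  obtain ⟨c, hc, d, hd, h⟩ := this a (by simp; omega) b (by simp; omega) h1
  simp only [List.mem_cons, List.not_mem_nil, or_false] at hc hd
  exact ⟨w4 a b c d, w4_world ha hb (by omega) (by omega) h1 (by omega) (by omega) (by omega) (by omega) (by omega), rfl, rfl⟩

theorem fin4 {R : Rs} (hR : Hyp R) {u : ℕ → ℕ} (hu : World u) {e1 e2 e3 : ERec} {e g k : ERec × ℕ}
    (h1 : EOK R (u 5) (u 6) e1) (h2 : EOK R (u 5) (u 7) e2) (h3 : EOK R (u 5) (u 8) e3)
    (he : EOK R (u 6) (u 7) e.1) (hg : EOK R (u 6) (u 8) g.1) (hk : EOK R (u 7) (u 8) k.1)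
    (fe : FOK R (u 5) (u 6) (u 7) e.2) (fg : FOK R (u 5) (u 6) (u 8) g.2) (fk : FOK R (u 5) (u 7) (u 8) k.2)
    {l12 l13 l23 : List (ERec × Nat)} (me : e ∈ l12) (mg : g ∈ l13) (mk : k ∈ l23) : chk4 T0 e1 e2 e3 l12 l13 l23 ≠ true := by
  intro h
  have g5 := hu.ge (n := 5) (by omega) (by omega)
  have g6 := hu.ge (n := 6) (by omega) (by omega)
  have g7 := hu.ge (n := 7) (by omega) (by omega)
  have g8 := hu.ge (n := 8) (by omega) (by omega)
  have d56 := hu.1.2 5 (by omega) 6 (by omega) (by omega)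
  have d57 := hu.1.2 5 (by omega) 7 (by omega) (by omega)
  have d58 := hu.1.2 5 (by omega) 8 (by omega) (by omega)
  have d67 := hu.1.2 6 (by omega) 7 (by omega) (by omega)
  have d68 := hu.1.2 6 (by omega) 8 (by omega) (by omega)
  have d78 := hu.1.2 7 (by omega) 8 (by omega) (by omega)
  have hv : World (w4 (u 6) (u 7) (u 8) (u 5)) := w4_world g6 g7 g8 g5 d67 d68 d56.symm d78 d57.symm d58.symm
  have fl' : FOK R (u 6) (u 7) (u 8) (fl (Nat.land (Nat.land e.1.e12 g.1.e13) k.1.e23)) := fun l hl hL =>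
    tri_flag hR hv (e1 := e.1) (e2 := g.1) (e3 := k.1) he hg hk l hl hL
  have hb := chk4_get h me mg mk (FOK_ne hR hv fl')
  have hm : Cov (SP R u SL4) (fold T0.k78 k.1.y (fold T0.k68 g.1.y (fold T0.k67 e.1.y (fold T0.k58 e3.y (fold T0.k57 e2.y (fold T0.k56 e1.y T0.on)))))) := by
    rw [h1.y, h2.y, h3.y, he.y, hg.y, hk.y]
    exact tT_ok' SL4_ok C4_eq (py1 (x_law hR hu (d := 7) (e := 8) (by omega) (by omega) (by omega) (by omega) (by omega))) (txr 7 8) rfl _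
     (tT_ok' SL4_ok C4_eq (py1 (x_law hR hu (d := 6) (e := 8) (by omega) (by omega) (by omega) (by omega) (by omega))) (txr 6 8) rfl _
     (tT_ok' SL4_ok C4_eq (py1 (x_law hR hu (d := 6) (e := 7) (by omega) (by omega) (by omega) (by omega) (by omega))) (txr 6 7) rfl _
     (tT_ok' SL4_ok C4_eq (py1 (x_law hR hu (d := 5) (e := 8) (by omega) (by omega) (by omega) (by omega) (by omega))) (txr 5 8) rfl _
     (tT_ok' SL4_ok C4_eq (py1 (x_law hR hu (d := 5) (e := 7) (by omega) (by omega) (by omega) (by omega) (by omega))) (txr 5 7) rfl _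
     (tT_ok' SL4_ok C4_eq (py1 (x_law hR hu (d := 5) (e := 6) (by omega) (by omega) (by omega) (by omega) (by omega))) (txr 5 6) rfl _
     (cov_ON _))))))
  obtain ⟨a1, a2, _⟩ := lm_spec hR g5.2 g6.2 g7.2 d56 d67 d57
  obtain ⟨b1, b2, _⟩ := lm_spec hR g5.2 g6.2 g8.2 d56 d68 d58
  obtain ⟨c1, c2, _⟩ := lm_spec hR g5.2 g7.2 g8.2 d57 d78 d58
  obtain ⟨r1, r2, _⟩ := lm_spec hR g6.2 g7.2 g8.2 d67 d78 d68
  have := bsrch_hit (big_SP hR hu.1 SL4_ok) _ [lm R (u 5) (u 6) (u 7), lm R (u 5) (u 6) (u 8), lm R (u 5) (u 7) (u 8), lm R (u 6) (u 7) (u 8)]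
    (by
      rw [T0_q567, T0_q568, T0_q578, T0_q678]
      have q1 := TS_T (a := 5) (b := 6) (c := 7) SL4_ok (u := u) (R := R) (by omega) (by omega) a1 a2
      have q2 := TS_T (a := 5) (b := 6) (c := 8) SL4_ok (u := u) (R := R) (by omega) (by omega) b1 b2
      have q3 := TS_T (a := 5) (b := 7) (c := 8) SL4_ok (u := u) (R := R) (by omega) (by omega) c1 c2
      have q4 := TS_T (a := 6) (b := 7) (c := 8) SL4_ok (u := u) (R := R) (by omega) (by omega) r1 r2
      have f1 := fe _ a1 a2
      have f2 := fg _ b1 b2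
      have f3 := fk _ c1 c2
      have f4 := fl' _ r1 r2
      generalize tabT SL4 (tc 5 6 7) = A1 at *
      generalize tabT SL4 (tc 5 6 8) = A2 at *
      generalize tabT SL4 (tc 5 7 8) = A3 at *
      generalize tabT SL4 (tc 6 7 8) = A4 at *
      generalize fl (Nat.land (Nat.land e.1.e12 g.1.e13) k.1.e23) = A5 at *
      exact .cons ⟨a1, q1, f1⟩ (.cons ⟨b1, q2, f2⟩ (.cons ⟨c1, q3, f3⟩ (.cons ⟨r1, q4, f4⟩ .nil)))) _ _ hm hb
  simp [Hit] at this

/-! ### the combinatorial loops -/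
theorem rows_cons (T : Tabs) (u : URec) (N : List URec) : rows T (u :: N) = ((u :: N).map (edges T u)) :: rows T N := by
  rw [← fr_map (edges T u)]; rfl

def rowT (T : Tabs) (a : URec × ERec) (L : List (URec × ERec)) : TRow := L.map fun b => (b.2, tri a.2 b.2 (edges T a.1 b.1))
def rowsS (T : Tabs) : List (URec × ERec) → List TRow
  | [] => []
  | a :: F => rowT T a (a :: F) :: rowsS T F
def flat (T : Tabs) (u : URec) (N : List URec) : List (URec × ERec) := N.flatMap fun w => (edges T u w).map fun e => (w, e)

theorem trow1_eq (e1 : ERec) (G : List ERec) (tail : TRow) (s : List ERec) :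
    trow1 e1 G tail s = (s.map fun e2 => (e2, tri e1 e2 G)) ++ tail := by
  unfold trow1
  induction s with
  | nil => rfl
  | cons a s ih => rw [fr_cons, ih]; rfl
theorem trow_cons (e1 : ERec) (s : List ERec) (bs : List (List ERec)) (G : List ERec) (Gs : List (List ERec)) :
    trow e1 (s :: bs) (G :: Gs) = (s.map fun e2 => (e2, tri e1 e2 G)) ++ trow e1 bs Gs := by
  rw [← trow1_eq]; rfl
theorem trow_spec (T : Tabs) (e1 : ERec) (w u : URec) (N : List URec) :
    trow e1 (N.map (edges T u)) (N.map (edges T w)) = rowT T (w, e1) (flat T u N) := by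
  induction N with
  | nil => rfl
  | cons v N ih =>
    rw [List.map_cons, List.map_cons, trow_cons, ih]
    simp only [rowT, flat, List.flatMap_cons, List.map_append, List.map_map]
    rfl
theorem tmat_cons (s : List ERec) (bs : List (List ERec)) (R : List (List ERec)) (M : List (List (List ERec))) :
    tmat (s :: bs) (R :: M) = List.rec (tmat bs M) (fun e1 s' ih2 => trow e1 ((e1 :: s') :: bs) R :: ih2) s := rfl
theorem tmat_spec (T : Tabs) (u : URec) (N : List URec) : tmat (N.map (edges T u)) (rows T N) = rowsS T (flat T u N) := by
  induction N with
  | nil => rfl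
  | cons w N ih =>
    rw [List.map_cons, rows_cons, tmat_cons, ih]
    unfold flat
    rw [List.flatMap_cons]
    change _ = rowsS T (_ ++ flat T u N)
    generalize edges T u w = s
    induction s with
    | nil => rfl
    | cons e s ih2 =>
      rw [show ((e :: s).map fun e => (w, e)) = (w, e) :: (s.map fun e => (w, e)) from rfl, List.cons_append, rowsS, ← ih2]
      change trow e ((e :: s) :: N.map (edges T u)) ((w :: N).map (edges T w)) :: _ = _
      congr 1
      rw [List.map_cons, trow_cons, trow_spec]
      simp only [rowT, List.map_append, List.map_cons, List.cons_append, List.map_map]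
      rfl

theorem k4a_suf {T : Tabs} : ∀ {F : List (URec × ERec)}, k4a T (rowsS T F) = true → ∀ {a F'}, (a :: F') <:+ F →
    k4b T a.2 (rowT T a (a :: F')) (rowsS T (a :: F')) = true := by
  intro F
  induction F with
  | nil => intro _ a F' h; simp at h
  | cons b F ih =>
    intro h a F' hs
    obtain ⟨h1, h2⟩ := ite'_ff (a := k4b T b.2 (rowT T b (b :: F)) (rowsS T (b :: F))) (b := k4a T (rowsS T F)) h
    rcases List.suffix_cons_iff.1 hs with e | e
    · obtain ⟨rfl, rfl⟩ := List.cons.inj e; exact h1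
    · exact ih h2 e

def gd {α : Type} (l : List α) (b : Bool) : Bool := @List.rec α (fun _ => Bool) true (fun _ _ _ => b) l
theorem rec_guard {α : Type} (l : List α) (b : Bool) (h : gd l b = true) (hl : l ≠ []) : b = true := by
  cases l with
  | nil => exact absurd rfl hl
  | cons a l => exact h

theorem k4b_suf {T : Tabs} {e1 : ERec} {a : URec × ERec} : ∀ {F : List (URec × ERec)}, k4b T e1 (rowT T a F) (rowsS T F) = true →
    ∀ {b F'}, (b :: F') <:+ F → tri a.2 b.2 (edges T a.1 b.1) ≠ [] →
    k4c T e1 b.2 (tri a.2 b.2 (edges T a.1 b.1)) (rowT T a (b :: F')) (rowT T b (b :: F')) = true := by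
  intro F
  induction F with
  | nil => intro _ a F' h; simp at h
  | cons c F ih =>
    intro h b F' hs hn
    obtain ⟨h1, h2⟩ := ite'_ff (a := gd (tri a.2 c.2 (edges T a.1 c.1)) (k4c T e1 c.2 (tri a.2 c.2 (edges T a.1 c.1)) (rowT T a (c :: F)) (rowT T c (c :: F)))) (b := k4b T e1 (rowT T a F) (rowsS T F)) h
    rcases List.suffix_cons_iff.1 hs with e | e
    · obtain ⟨rfl, rfl⟩ := List.cons.inj e; exact rec_guard _ _ h1 hn
    · exact ih h2 e hn

theorem k4c_mem {T : Tabs} {e1 e2 : ERec} {l12 : List (ERec × Nat)} {a b : URec × ERec} : ∀ {F : List (URec × ERec)},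
    k4c T e1 e2 l12 (rowT T a F) (rowT T b F) = true →
    ∀ {c}, c ∈ F → tri a.2 c.2 (edges T a.1 c.1) ≠ [] → tri b.2 c.2 (edges T b.1 c.1) ≠ [] →
    chk4 T e1 e2 c.2 l12 (tri a.2 c.2 (edges T a.1 c.1)) (tri b.2 c.2 (edges T b.1 c.1)) = true := by
  intro F
  induction F with
  | nil => intro _ a h; simp at h
  | cons d F ih =>
    intro h c hs hn1 hn2
    obtain ⟨h1, h2⟩ := ite'_ff (a := gd (tri a.2 d.2 (edges T a.1 d.1)) (gd (tri b.2 d.2 (edges T b.1 d.1))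
      (chk4 T e1 e2 d.2 l12 (tri a.2 d.2 (edges T a.1 d.1)) (tri b.2 d.2 (edges T b.1 d.1)))))
      (b := k4c T e1 e2 l12 (rowT T a F) (rowT T b F)) h
    rcases List.mem_cons.1 hs with e | e
    · subst e; exact rec_guard _ _ (rec_guard _ _ h1 hn1) hn2
    · exact ih h2 e hn1 hn2

theorem allRows_cons (T : Tabs) (R : List (List ERec)) (M : List (List (List ERec))) : allRows T (R :: M) =
    ite' (k4a T (tmat R (R :: M))) (allRows T M) false := by
  have : ∀ (p : ERec × List (ERec × ℕ)) (k : ERec × List (ERec × ℕ) → Bool), (fcs fc0 p.2 fun l => k (p.1, l)) = k p := by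
    intro p k; rw [fcs_eq fc0 (fun _ _ => rfl)]
  rw [← fcs_eq (γ := Bool) (fcs fun (p : ERec × List (ERec × ℕ)) k => fcs fc0 p.2 fun l => k (p.1, l)) (fun a k => fcs_eq _ this _ _) (tmat R (R :: M)) (fun Ts => k4a T Ts)]
  rfl

theorem allRows_suf {T : Tabs} : ∀ {N : List URec}, allRows T (rows T N) = true → ∀ {u N'}, (u :: N') <:+ N →
    k4a T (rowsS T (flat T u (u :: N'))) = true := by
  intro N
  induction N with
  | nil => intro _ a F' h; simp at h
  | cons b N ih =>
    intro h a F' hs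
    rw [rows_cons, allRows_cons, ← rows_cons, tmat_spec] at h
    obtain ⟨h1, h2⟩ := ite'_ff h
    rcases List.suffix_cons_iff.1 hs with e | e
    · obtain ⟨rfl, rfl⟩ := List.cons.inj e; exact h1
    · exact ih h2 e

theorem suf_pick {α : Type} (P : ℕ → α → Prop) (s : List ℕ) (hs : s ≠ []) : ∀ (N : List α), (∀ x ∈ s, ∃ a ∈ N, P x a) →
    ∃ x ∈ s, ∃ u N', (u :: N') <:+ N ∧ P x u ∧ ∀ y ∈ s, ∃ a ∈ u :: N', P y a := by
  intro N
  induction N with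
  | nil =>
    intro h
    cases s with
    | nil => exact absurd rfl hs
    | cons a s => obtain ⟨b, hb, _⟩ := h a (by simp); simp at hb
  | cons b N ih =>
    intro h
    by_cases hx : ∃ x ∈ s, P x b
    · obtain ⟨x, h1, h2⟩ := hx
      exact ⟨x, h1, b, N, List.suffix_rfl, h2, h⟩
    · push Not at hx
      obtain ⟨x, h1, u, N', h2, h3⟩ := ih (fun x hxs => by
        obtain ⟨a, ha, hp⟩ := h x hxs
        rcases List.mem_cons.1 ha with e | e
        · subst e; exact absurd hp (hx x hxs)
        · exact ⟨a, e, hp⟩)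
      exact ⟨x, h1, u, N', h2.trans (List.suffix_cons _ _), h3⟩

theorem class_contra {R : Rs} (hR : Hyp R) (hQ : Q0 R) {τ : List ℕ} (hτ : HasT R 4 τ) {als : List (List ℕ)}
    (hal : ∀ x, 5 ≤ x → x < 9 → ∃ ls ∈ als, HasT R x ls) : chkClass T0 (τ.map sv) (als.map (List.map sv)) ≠ true := by
  intro h
  unfold chkClass at h
  rw [strictL_eq, strictL_eq, fcs_eq fc0 (fun _ _ => rfl), fcs_eq (fcs (fcs fc0)) (fun a k => fcs_eq _ (fun a k => fcs_eq _ (fun _ _ => rfl) _ _) _ _)] at h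
  have hb1 : Base R SL1 (fold T0.b1t (τ.map sv) (fold T0.b1q lQ T0.on)) := fun u hu =>
    tT_ok' SL1_ok C1_eq (pts_law hu (hu.2 4 (by omega)) hτ) (ts 4) rfl _ (tT_ok' SL1_ok C1_eq (pql_law hu hQ) tq rfl _ (cov_ON _))
  have hb2 : Base R SL2 (fold T0.b2t (τ.map sv) (fold T0.b2q lQ T0.on)) := fun u hu =>
    tT_ok' SL2_ok C2_eq (pts_law hu (hu.2 4 (by omega)) hτ) (ts 4) rfl _ (tT_ok' SL2_ok C2_eq (pql_law hu hQ) tq rfl _ (cov_ON _))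
  generalize fold T0.b1t (τ.map sv) (fold T0.b1q lQ T0.on) = base1 at h hb1
  generalize fold T0.b2t (τ.map sv) (fold T0.b2q lQ T0.on) = base2 at h hb2
  have hU : ∀ x, 5 ≤ x → x < 9 → ∃ U ∈ lev1 T0 base1 base2 (als.map (List.map sv)), UOK R x U := by
    intro x h5 h9
    obtain ⟨ls, hls, hT⟩ := hal x h5 h9
    obtain ⟨u, hu, hx, _⟩ := w4_ex (a := x) (b := if x = 5 then 6 else 5) ⟨h5, h9⟩ (by split_ifs <;> omega) (by split_ifs <;> omega)
    exact lev1_mem hR hb1 hb2 hu hx hT als hls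
  generalize lev1 T0 base1 base2 (als.map (List.map sv)) = N at h hU
  -- first point
  obtain ⟨x1, hx1, u1, N1, s1, p1, r1⟩ := suf_pick (UOK R) [5,6,7,8] (by simp) N (by
    intro x hx; simp only [List.mem_cons, List.not_mem_nil, or_false] at hx; exact hU x (by omega) (by omega))
  have hk := allRows_suf h s1
  have E1 : ∀ y, y ∈ [5,6,7,8] → y ≠ x1 → ∃ b ∈ flat T0 u1 (u1 :: N1), UOK R y b.1 ∧ EOK R x1 y b.2 := by
    intro y hy hne
    obtain ⟨w, hw, hUw⟩ := r1 y hy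
    simp only [List.mem_cons, List.not_mem_nil, or_false] at hx1 hy
    obtain ⟨u, hu, e1, e2⟩ := w4_ex (a := x1) (b := y) (by omega) (by omega) (by omega)
    obtain ⟨E, hE, hE'⟩ := edges_mem hR p1 hUw hu e1 e2
    exact ⟨(w, E), List.mem_flatMap.2 ⟨w, hw, List.mem_map.2 ⟨E, hE, rfl⟩⟩, hUw, hE'⟩
  generalize flat T0 u1 (u1 :: N1) = F at hk E1
  -- second point
  obtain ⟨x2, hx2, a, F1, s2, p2, r2⟩ := suf_pick (fun y b => UOK R y b.1 ∧ EOK R x1 y b.2) ([5,6,7,8].filter (· ≠ x1)) (by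
      intro h; rw [List.filter_eq_nil_iff] at h
      have g5 := h 5 (by simp); have g6 := h 6 (by simp); simp at g5 g6; omega) F (by
    intro x hx; rw [List.mem_filter] at hx; exact E1 x hx.1 (by simpa using hx.2))
  have hk2 := k4a_suf hk s2
  rw [List.mem_filter] at hx2
  have m1 : 5 ≤ x1 ∧ x1 < 9 := by simp only [List.mem_cons, List.not_mem_nil, or_false] at hx1; omega
  have m2 : 5 ≤ x2 ∧ x2 < 9 := by have := hx2.1; simp only [List.mem_cons, List.not_mem_nil, or_false] at this; omega
  have n12 : x2 ≠ x1 := by simpa using hx2.2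
  -- third point
  obtain ⟨x3, hx3, b, F2, s3, p3, r3⟩ := suf_pick (fun y b => UOK R y b.1 ∧ EOK R x1 y b.2) ([5,6,7,8].filter (fun y => y ≠ x1 ∧ y ≠ x2)) (by
      intro h; rw [List.filter_eq_nil_iff] at h
      have g5 := h 5 (by simp); have g6 := h 6 (by simp); have g7 := h 7 (by simp); simp at g5 g6 g7; omega) (a :: F1) (by
    intro x hx; rw [List.mem_filter] at hx; refine r2 x (List.mem_filter.2 ⟨hx.1, ?_⟩); have := hx.2; simp at this ⊢; exact this.1)
  rw [List.mem_filter] at hx3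
  have m3 : 5 ≤ x3 ∧ x3 < 9 := by have := hx3.1; simp only [List.mem_cons, List.not_mem_nil, or_false] at this; omega
  have n3 : x3 ≠ x1 ∧ x3 ≠ x2 := by simpa using hx3.2
  -- fourth point
  obtain ⟨x4, m4, n4⟩ : ∃ x4, (5 ≤ x4 ∧ x4 < 9) ∧ x4 ≠ x1 ∧ x4 ≠ x2 ∧ x4 ≠ x3 := by
    have : ∀ a ∈ [5,6,7,8], ∀ b ∈ [5,6,7,8], ∀ c ∈ [5,6,7,8], ∃ d ∈ [5,6,7,8], d ≠ a ∧ d ≠ b ∧ d ≠ c := by decide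
    obtain ⟨d, h1, h3⟩ := this x1 (by simp; omega) x2 (by simp; omega) x3 (by simp; omega)
    simp only [List.mem_cons, List.not_mem_nil, or_false] at h1
    exact ⟨d, by omega, h3⟩
  obtain ⟨c, hc, p4⟩ := r3 x4 (by
    rw [List.mem_filter]; simp only [List.mem_cons, List.not_mem_nil, or_false]; exact ⟨by omega, by simp; omega⟩)
  have W : World (w4 x1 x2 x3 x4) := w4_world m1 m2 m3 m4 (by omega) (by omega) (by omega) (by omega) (by omega) (by omega)
  have W' : World (w4 x1 x2 x4 x3) := w4_world m1 m2 m4 m3 (by omega) (by omega) (by omega) (by omega) (by omega) (by omega)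
  have W'' : World (w4 x1 x3 x4 x2) := w4_world m1 m3 m4 m2 (by omega) (by omega) (by omega) (by omega) (by omega) (by omega)
  have ed : ∀ {x y : ℕ} {U V : URec}, 5 ≤ x ∧ x < 9 → 5 ≤ y ∧ y < 9 → x ≠ y → UOK R x U → UOK R y V → ∃ e3 ∈ edges T0 U V, EOK R x y e3 := by
    intro x y U V hx hy hxy hU hV
    obtain ⟨u, hu, e1, e2⟩ := w4_ex hx hy hxy
    exact edges_mem hR hU hV hu e1 e2
  obtain ⟨e, me, he, fe⟩ := tri_mem hR W (e1 := a.2) (e2 := b.2) p2.2 p3.2 (edges T0 a.1 b.1) (ed m2 m3 (fun e => n3.2 e.symm) p2.1 p3.1)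
  obtain ⟨g, mg, hg, fg⟩ := tri_mem hR W' (e1 := a.2) (e2 := c.2) p2.2 p4.2 (edges T0 a.1 c.1) (ed m2 m4 (fun e => n4.2.1 e.symm) p2.1 p4.1)
  obtain ⟨k, mk, hk', fk⟩ := tri_mem hR W'' (e1 := b.2) (e2 := c.2) p3.2 p4.2 (edges T0 b.1 c.1) (ed m3 m4 (fun e => n4.2.2 e.symm) p3.1 p4.1)
  have hk3 := k4b_suf hk2 s3 (List.ne_nil_of_mem me)
  have hk4 := k4c_mem hk3 hc (List.ne_nil_of_mem mg) (List.ne_nil_of_mem mk)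
  exact fin4 hR W (e1 := a.2) (e2 := b.2) (e3 := c.2) (e := e) (g := g) (k := k) p2.2 p3.2 p4.2 he hg hk' fe fg fk me mg mk hk4

end CD

namespace CD

/-! ### relabelling and reversal -/
def rel (w : ℕ → ℕ) (R : Rs) : Rs := (fun r i j => r (w i) (w j)) '' R
def rvs (R : Rs) : Rs := (fun r i j => r j i) '' R

theorem rel_law {w : ℕ → ℕ} {R : Rs} {a b c l : ℕ} (h : Law R (w a) (w b) (w c) l) : Law (rel w R) a b c l := by
  rintro _ ⟨r, hr, rfl⟩; exact h r hr
theorem law_rel {w : ℕ → ℕ} {R : Rs} {a b c l : ℕ} (h : Law (rel w R) a b c l) : Law R (w a) (w b) (w c) l := by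
  intro r hr; exact h _ ⟨r, hr, rfl⟩
theorem inj_comp {w u : ℕ → ℕ} (hw : Inj9 w) (hu : Inj9 u) : Inj9 (fun i => w (u i)) :=
  ⟨fun i hi => hw.1 _ (hu.1 i hi), fun i hi j hj h => hw.2 _ (hu.1 i hi) _ (hu.1 j hj) (hu.2 i hi j hj h)⟩
theorem rel_hyp {w : ℕ → ℕ} (hw : Inj9 w) {R : Rs} (hR : Hyp R) : Hyp (rel w R) := by
  refine ⟨?_, ?_, ?_⟩
  · rintro _ ⟨r, hr, rfl⟩
    have h := hR.lin r hr
    exact ⟨fun i hi j hj hij => h.1 _ (hw.1 i hi) _ (hw.1 j hj) (hw.2 i hi j hj hij),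
      fun i hi j hj k hk h1 h2 h3 => h.2 _ (hw.1 i hi) _ (hw.1 j hj) _ (hw.1 k hk) (hw.2 i hi j hj h1) (hw.2 j hj k hk h2) (hw.2 i hi k hk h3)⟩
  · intro i hi j hj k hk h1 h2 h3
    obtain ⟨l, hl, h⟩ := hR.law _ (hw.1 i hi) _ (hw.1 j hj) _ (hw.1 k hk) (hw.2 i hi j hj h1) (hw.2 j hj k hk h2) (hw.2 i hi k hk h3)
    exact ⟨l, hl, rel_law h⟩
  · intro u hu q hq
    obtain ⟨F, h1, h2, h3⟩ := hR.big _ (inj_comp hw hu) q hq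
    refine ⟨F, h1, h2, fun p hp => ?_⟩
    obtain ⟨c, hc, r, hr, hM⟩ := h3 p hp
    exact ⟨c, hc, _, ⟨r, hr, rfl⟩, hM⟩

def rl (l : ℕ) : ℕ := 3*(l/3) + (2 - l%3)
theorem satc_rl : ∀ a b c : Bool, ∀ l < 9, satc (!a) (!b) (!c) l = satc a b c (rl l) := by decide
theorem rl_rl : ∀ l < 9, rl l < 9 ∧ rl (rl l) = l := by decide
theorem rvs_law {R : Rs} (hR : ∀ r ∈ R, Lin r) {a b c l : ℕ} (ha : a < 9) (hb : b < 9) (hc : c < 9) (h1 : a ≠ b) (h2 : b ≠ c) (h3 : a ≠ c)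
    (hl : l < 9) (h : Law R a b c (rl l)) : Law (rvs R) a b c l := by
  rintro _ ⟨r, hr, rfl⟩
  have hh := h r hr
  have hL := hR r hr
  unfold satR at hh ⊢
  change satc (r b a) (r c a) (r c b) l = true
  rw [hL.1 a ha b hb h1, hL.1 a ha c hc h3, hL.1 b hb c hc h2, satc_rl _ _ _ _ hl]
  exact hh
theorem PT_rev : ∀ p < 120, PT[119-p]? = some (1023 - (PT[p]?).getD 0) := by decide +kernel
theorem bt_rev : ∀ c ∈ PT, ∀ i < 10, bt (1023 - c) i = !(bt c i) := by decide +kernel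
theorem rvs_hyp {R : Rs} (hR : Hyp R) : Hyp (rvs R) := by
  refine ⟨?_, ?_, ?_⟩
  · rintro _ ⟨r, hr, rfl⟩
    have h := hR.lin r hr
    exact ⟨fun i hi j hj hij => h.1 _ hj _ hi hij.symm,
      fun i hi j hj k hk h1 h2 h3 a b => h.2 k hk j hj i hi h2.symm h1.symm h3.symm b a⟩
  · intro i hi j hj k hk h1 h2 h3
    obtain ⟨l, hl, h⟩ := hR.law i hi j hj k hk h1 h2 h3
    exact ⟨rl l, (rl_rl l hl).1, rvs_law hR.lin hi hj hk h1 h2 h3 (rl_rl l hl).1 (by rw [(rl_rl l hl).2]; exact h)⟩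
  · intro u hu q hq
    obtain ⟨F, h1, h2, h3⟩ := hR.big u hu q hq
    refine ⟨F.image (119 - ·), ?_, ?_, ?_⟩
    · intro p hp; rw [Finset.mem_image] at hp; obtain ⟨a, _, rfl⟩ := hp; rw [Finset.mem_range]; omega
    · rw [Finset.card_image_of_injOn]
      · exact h2
      · intro a ha b hb hab
        have := Finset.mem_range.1 (h1 ha); have := Finset.mem_range.1 (h1 hb)
        simp only at hab; omega
    · intro p hp; rw [Finset.mem_image] at hp; obtain ⟨a, ha, rfl⟩ := hp
      obtain ⟨c, hc, r, hr, hM⟩ := h3 a ha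
      have hp := PT_rev a (Finset.mem_range.1 (h1 ha))
      rw [hc, Option.getD_some] at hp
      refine ⟨1023 - c, hp, _, ⟨r, hr, rfl⟩, ?_⟩
      have hb := bt_rev c (List.mem_of_getElem? hc)
      have hL := hR.lin r hr
      obtain ⟨x0, x1, x2, x3, x4⟩ := q
      obtain ⟨o1, o2, o3, o4, o5⟩ := hq
      simp only at o1 o2 o3 o4 o5
      have A : ∀ i j, i < j → j < 9 → r (u j) (u i) = !(r (u i) (u j)) := fun i j h1 h2 =>
        hL.1 _ (hu.1 _ (by omega)) _ (hu.1 _ (by omega)) (hu.2 _ (by omega) _ (by omega) (by omega))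
      obtain ⟨m0, m1, m2, m3, m4, m5, m6, m7, m8, m9⟩ := hM
      simp only at m0 m1 m2 m3 m4 m5 m6 m7 m8 m9
      refine ⟨?_, ?_, ?_, ?_, ?_, ?_, ?_, ?_, ?_, ?_⟩ <;> rw [hb _ (by omega)] <;> dsimp only <;> rw [A _ _ (by omega) (by omega)] <;> congr 1

/-! ### pattern masks -/
def PLs : List ℕ := [pbm 0, pbm 1, pbm 2, pbm 3, pbm 4, pbm 5, pbm 6, pbm 7, pbm 8, pbm 9]
theorem withPL_eq (k : List ℕ → Bool) : withPL k = k PLs := by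
  unfold withPL
  rw [fcs_eq strictL (fun _ _ => rfl), fr_map]
  rfl
theorem pbm_bit (i : ℕ) : ∀ (l : List ℕ) (p c : ℕ), l[p]? = some c →
    (fr (fun c ih => Nat.lor (b2n (bt c i)) (Nat.shiftLeft ih 1)) 0 l).testBit p = bt c i := by
  intro l
  induction l with
  | nil => intro p c h; simp at h
  | cons a l ih =>
    intro p c h
    rw [fr_cons]
    change (b2n (bt a i) ||| (_ <<< 1)).testBit p = _
    rw [Nat.testBit_or, Nat.testBit_shiftLeft]
    cases p with
    | zero =>
      simp only [List.getElem?_cons_zero, Option.some.injEq] at h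
      subst h
      cases bt a i <;> simp [b2n, ite']
    | succ p =>
      rw [List.getElem?_cons_succ] at h
      rw [show p + 1 - 1 = p from rfl, ih p c h]
      cases bt a i <;> simp [b2n, ite', Nat.testBit_succ]

/-- the mask bit `p` describes the pattern of `r` -/
def Pat (r : ℕ → ℕ → Bool) (p : ℕ) : Prop := p < 120 ∧ ∀ x < 5, ∀ y < 5, x ≠ y → (up PLs y x).testBit p = r y x
theorem cOnes_eq : cOnes = 2^120 - 1 := by decide +kernel
theorem cOnes_bit {p : ℕ} (hp : p < 120) : cOnes.testBit p = true := by
  rw [cOnes_eq, Nat.testBit_two_pow_sub_one]; simpa using hp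

theorem pat_ex {r : ℕ → ℕ → Bool} (hr : Lin r) : ∃ p, Pat r p := by
  obtain ⟨p, hp, c, hc, hM⟩ := mat_ex hr (u := fun i => i) ⟨fun i hi => hi, fun i _ j _ h => h⟩ (q := (0,1,2,3,4)) (by decide)
  refine ⟨p, hp, ?_⟩
  have hb : ∀ i, (pbm i).testBit p = bt c i := fun i => pbm_bit i PT p c hc
  obtain ⟨m0, m1, m2, m3, m4, m5, m6, m7, m8, m9⟩ := hM
  simp only at m0 m1 m2 m3 m4 m5 m6 m7 m8 m9
  have key : ∀ i x y : ℕ, nth PLs (pidx y x) = pbm i → Nat.ble (Nat.succ y) x = true → Nat.ble (Nat.succ x) y = false → x < 5 → y < 5 → x ≠ y → bt c i = r y x →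
      (up PLs y x).testBit p = r y x ∧ (up PLs x y).testBit p = r x y := by
    intro i x y h1 h2 h3 hx hy hxy h4
    constructor
    · rw [up, h2, ite'_true, h1, hb, h4]
    · rw [up, h3, ite'_false, h1]
      change (cOnes ^^^ pbm i).testBit p = _
      rw [Nat.testBit_xor, cOnes_bit hp, hb, h4, hr.1 y (by omega) x (by omega) hxy.symm, Bool.true_xor]
  have k0 := key 0 1 0 rfl rfl rfl (by omega) (by omega) (by omega) m0
  have k1 := key 1 2 0 rfl rfl rfl (by omega) (by omega) (by omega) m1
  have k2 := key 2 2 1 rfl rfl rfl (by omega) (by omega) (by omega) m2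
  have k3 := key 3 3 0 rfl rfl rfl (by omega) (by omega) (by omega) m3
  have k4 := key 4 3 1 rfl rfl rfl (by omega) (by omega) (by omega) m4
  have k5 := key 5 3 2 rfl rfl rfl (by omega) (by omega) (by omega) m5
  have k6 := key 6 4 0 rfl rfl rfl (by omega) (by omega) (by omega) m6
  have k7 := key 7 4 1 rfl rfl rfl (by omega) (by omega) (by omega) m7
  have k8 := key 8 4 2 rfl rfl rfl (by omega) (by omega) (by omega) m8
  have k9 := key 9 4 3 rfl rfl rfl (by omega) (by omega) (by omega) m9
  intro x hx y hy hxy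
  interval_cases x <;> interval_cases y <;> first | exact absurd rfl hxy | (first | exact k0.1 | exact k0.2 | exact k1.1 | exact k1.2 | exact k2.1 | exact k2.2 | exact k3.1 | exact k3.2 | exact k4.1 | exact k4.2 | exact k5.1 | exact k5.2 | exact k6.1 | exact k6.2 | exact k7.1 | exact k7.2 | exact k8.1 | exact k8.2 | exact k9.1 | exact k9.2)

def vb (A B : Bool) (q : ℕ) : Bool := ite' (Nat.beq q 0) (!(A || B)) (ite' (Nat.beq q 1) (Bool.xor A B) (A && B))
theorem viol_bit {r : ℕ → ℕ → Bool} {p : ℕ} (h : Pat r p) {x y z : ℕ} (hx : x < 5) (hy : y < 5) (hz : z < 5) (h1 : x ≠ y) (h2 : x ≠ z) (q : ℕ) :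
    (viol PLs x y z q).testBit p = vb (r y x) (r z x) q := by
  have a := h.2 x hx y hy h1
  have b := h.2 x hx z hz h2
  unfold viol vb
  cases Nat.beq q 0
  · rw [ite'_false, ite'_false]
    cases Nat.beq q 1
    · rw [ite'_false, ite'_false]
      exact (Nat.testBit_and _ _ _).trans (by rw [a, b])
    · rw [ite'_true, ite'_true]
      exact (Nat.testBit_xor _ _ _).trans (by rw [a, b])
  · rw [ite'_true, ite'_true]
    refine (Nat.testBit_xor _ _ _).trans ?_
    rw [cOnes_bit h.1, Bool.true_xor]
    congr 1
    exact (Nat.testBit_or _ _ _).trans (by rw [a, b])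
theorem satc_vb : ∀ A B C : Bool, ∀ l < 9, ∀ q < 3, satc A B C (3*(l/3)+q) =
    !(ite' (Nat.beq (Nat.div l 3) 0) (vb (!A) (!B) q) (ite' (Nat.beq (Nat.div l 3) 1) (vb A (!C) q) (vb B C q))) := by decide
theorem violL_bit {r : ℕ → ℕ → Bool} (hr : Lin r) {p : ℕ} (h : Pat r p) {a b c l : ℕ} (ha : a < 5) (hb : b < 5) (hc : c < 5) (h1 : a ≠ b) (h2 : b ≠ c)
    (h3 : a ≠ c) (hl : l < 9) (g : ℕ → ℕ) (hg : g (Nat.mod l 3) < 3) :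
    (violL PLs g a b c l).testBit p = !(satR r a b c (3*(l/3) + g (Nat.mod l 3))) := by
  unfold satR violL
  rw [satc_vb _ _ _ _ hl _ hg, Bool.not_not]
  cases Nat.beq (Nat.div l 3) 0
  · rw [ite'_false, ite'_false]
    cases Nat.beq (Nat.div l 3) 1
    · rw [ite'_false, ite'_false, viol_bit h hc ha hb h3.symm h2.symm]
    · rw [ite'_true, ite'_true, viol_bit h hb ha hc h1.symm h2, hr.1 b (by omega) c (by omega) h2]
  · rw [ite'_true, ite'_true, viol_bit h ha hb hc h1 h3, hr.1 a (by omega) b (by omega) h1, hr.1 a (by omega) c (by omega) h3]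

theorem fz_cons (f : ℕ × ℕ × ℕ → ℕ → ℕ) (t : ℕ × ℕ × ℕ) (ts : List (ℕ × ℕ × ℕ)) (l : ℕ) (ls : List ℕ) :
    fz f (t :: ts) (l :: ls) = f t l ||| fz f ts ls := rfl
theorem fz_f {f : ℕ × ℕ × ℕ → ℕ → ℕ} {p : ℕ} {ts : List (ℕ × ℕ × ℕ)} {ls : List ℕ}
    (h : List.Forall₂ (fun t l => (f t l).testBit p = false) ts ls) : (fz f ts ls).testBit p = false := by
  induction h with
  | nil => exact Nat.zero_testBit p
  | cons h _ ih => rw [fz_cons, Nat.testBit_or, h, ih]; rfl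
theorem f_fz {f : ℕ × ℕ × ℕ → ℕ → ℕ} (S : ℕ → Prop) : ∀ {ts : List (ℕ × ℕ × ℕ)} {ls : List ℕ}, ts.length = ls.length →
    (∀ p, S p → (fz f ts ls).testBit p = false) → List.Forall₂ (fun t l => ∀ p, S p → (f t l).testBit p = false) ts ls := by
  intro ts
  induction ts with
  | nil => intro ls h _; cases ls with
    | nil => exact .nil
    | cons a l => simp at h
  | cons t ts ih =>
    intro ls h h2
    cases ls with
    | nil => simp at h
    | cons l ls =>
      have : ∀ p, S p → (f t l).testBit p = false ∧ (fz f ts ls).testBit p = false := by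
        intro p hp
        have := h2 p hp
        rw [fz_cons, Nat.testBit_or] at this
        simpa using this
      exact .cons (fun p hp => (this p hp).1) (ih (by simpa using h) fun p hp => (this p hp).2)

def T5 (t : ℕ × ℕ × ℕ) : Prop := t.1 < 5 ∧ t.2.1 < 5 ∧ t.2.2 < 5 ∧ t.1 ≠ t.2.1 ∧ t.2.1 ≠ t.2.2 ∧ t.1 ≠ t.2.2
instance (t) : Decidable (T5 t) := by unfold T5; infer_instance
def LawT (R : Rs) (t : ℕ × ℕ × ℕ) (l : ℕ) : Prop := Law R t.1 t.2.1 t.2.2 l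
def Inj5 (w : ℕ → ℕ) : Prop := (∀ i < 5, w i < 5) ∧ ∀ i < 5, ∀ j < 5, i ≠ j → w i ≠ w j

theorem cert_core {R : Rs} (hR : ∀ r ∈ R, Lin r) {ts1 ts2 : List (ℕ × ℕ × ℕ)} {ls1 ls2 : List ℕ} (w g : ℕ → ℕ) (hw : Inj5 w)
    (hg : ∀ q < 3, g q < 3)
    (h1 : List.Forall₂ (fun t l => T5 t ∧ l < 9 ∧ LawT R t l) ts1 ls1) (h2 : List.Forall₂ (fun t l => T5 t ∧ l < 9) ts2 ls2)
    (hc0 : Nat.beq (Nat.land (Nat.xor cOnes (fz (fun t l => violL PLs idn t.1 t.2.1 t.2.2 l) ts1 ls1))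
      (fz (fun t l => violL PLs g (w t.1) (w t.2.1) (w t.2.2) l) ts2 ls2)) 0 = true) :
    List.Forall₂ (fun t l => T5 t ∧ l < 9 ∧ Law R (w t.1) (w t.2.1) (w t.2.2) (3*(l/3) + g (Nat.mod l 3))) ts2 ls2 := by
  have hc := Nat.eq_of_beq_eq_true hc0
  have hS : ∀ p, (∃ r ∈ R, Pat r p) → (fz (fun t l => violL PLs g (w t.1) (w t.2.1) (w t.2.2) l) ts2 ls2).testBit p = false := by
    rintro p ⟨r, hr, hp⟩
    have hz : (fz (fun t l => violL PLs idn t.1 t.2.1 t.2.2 l) ts1 ls1).testBit p = false := by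
      refine fz_f (h1.imp ?_)
      rintro t l ⟨⟨a1, a2, a3, a4, a5, a6⟩, hl, hL⟩
      rw [violL_bit (hR r hr) hp a1 a2 a3 a4 a5 a6 hl idn (Nat.mod_lt _ (by omega))]
      have e : 3*(l/3) + idn (Nat.mod l 3) = l := Nat.div_add_mod l 3
      rw [e, hL r hr]; rfl
    generalize fz (fun t l => violL PLs idn t.1 t.2.1 t.2.2 l) ts1 ls1 = M at *
    generalize fz (fun t l => violL PLs g (w t.1) (w t.2.1) (w t.2.2) l) ts2 ls2 = V at *
    have hc : (cOnes ^^^ M) &&& V = 0 := hc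
    have := congrArg (fun n => n.testBit p) hc
    simp only [Nat.testBit_and, Nat.testBit_xor, cOnes_bit hp.1, hz, Nat.zero_testBit] at this
    simpa using this
  have h3 := f_fz _ h2.length_eq hS
  have h4 : List.Forall₂ (fun t l => (T5 t ∧ l < 9) ∧ ∀ p, (∃ r ∈ R, Pat r p) → (violL PLs g (w t.1) (w t.2.1) (w t.2.2) l).testBit p = false) ts2 ls2 := by
    clear hS h1 hc hc0
    induction h2 with
    | nil => exact .nil
    | cons a _ ih => cases h3 with
      | cons b c => exact .cons ⟨a, b⟩ (ih c)
  refine h4.imp ?_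
  rintro t l ⟨⟨⟨a1, a2, a3, a4, a5, a6⟩, hl⟩, hL⟩
  refine ⟨⟨a1, a2, a3, a4, a5, a6⟩, hl, fun r hr => ?_⟩
  obtain ⟨p, hp⟩ := pat_ex (hR r hr)
  have := hL p ⟨r, hr, hp⟩
  rw [violL_bit (hR r hr) hp (hw.1 _ a1) (hw.1 _ a2) (hw.1 _ a3) (hw.2 _ a1 _ a2 a4) (hw.2 _ a2 _ a3 a5) (hw.2 _ a1 _ a3 a6) hl g (hg _ (Nat.mod_lt _ (by omega)))] at this
  simpa using this

end CD

namespace CD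

theorem injP_all (p : ℕ → ℕ) (l : List (ℕ × ℕ)) (h : fr (fun t ih => ite' (Nat.beq (p t.1) (p t.2)) false ih) true l = true) :
    ∀ t ∈ l, p t.1 ≠ p t.2 := by
  induction l with
  | nil => intro t ht; simp at ht
  | cons a l ih =>
    rw [fr_cons] at h
    intro t ht
    by_cases e : p a.1 = p a.2
    · rw [e, Nat.beq_refl, ite'_true] at h; exact absurd h (by simp)
    · rw [beq_false' e, ite'_false] at h
      rcases List.mem_cons.1 ht with h1 | h1
      · rw [h1]; exact e
      · exact ih h t h1
theorem pfun_ge (pc i : ℕ) (h : 5 ≤ i) : pfun pc i = i := by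
  unfold pfun; rw [Nat.ble_eq_true_of_le h, ite'_true]
theorem pfun_lt (pc i : ℕ) (h : i < 5) : pfun pc i < 5 := by
  unfold pfun
  have : Nat.ble 5 i = false := by
    rw [← Bool.not_eq_true, Nat.ble_eq]; omega
  rw [this, ite'_false]; exact Nat.mod_lt _ (by omega)
theorem injP_5 {pc : ℕ} (h : injP (pfun pc) = true) : Inj5 (pfun pc) := by
  have H := injP_all _ _ h
  refine ⟨pfun_lt pc, ?_⟩
  have H2 : ∀ i < 5, ∀ j < 5, i < j → pfun pc i ≠ pfun pc j := by
    intro i hi j hj hij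
    refine H (i, j) ?_
    interval_cases j <;> interval_cases i <;> first | omega | simp
  intro i hi j hj hij
  rcases lt_or_gt_of_ne hij with h | h
  · exact H2 i hi j hj h
  · exact (H2 j hj i hi h).symm
theorem injP_9 {pc : ℕ} (h : injP (pfun pc) = true) : Inj9 (pfun pc) := by
  obtain ⟨h1, h2⟩ := injP_5 h
  have g : ∀ i < 9, pfun pc i < 9 := fun i hi => by
    by_cases h5 : i < 5
    · have := h1 i h5; omega
    · rw [pfun_ge _ _ (by omega)]; exact hi
  refine ⟨g, fun i hi j hj hij => ?_⟩
  by_cases h5 : i < 5 <;> by_cases h5' : j < 5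
  · exact h2 i h5 j h5' hij
  · rw [pfun_ge _ j (by omega)]; have := h1 i h5; omega
  · rw [pfun_ge _ i (by omega)]; have := h1 j h5'; omega
  · rw [pfun_ge _ i (by omega), pfun_ge _ j (by omega)]; exact hij

def Typ (R : Rs) (c : ℕ) : Prop := HasT R 4 (dig6 c)

theorem typ_all {R : Rs} (hQ : Q0 R) {c : ℕ} (h : Typ R c) : List.Forall₂ (fun t l => T5 t ∧ l < 9 ∧ LawT R t l) tri10 (cod10 c) := by
  obtain ⟨q0, q1, q2, q3⟩ := hQ
  unfold Typ HasT P6 dig6 at h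
  simp only [List.forall₂_cons, List.forall₂_nil_left_iff] at h
  obtain ⟨⟨_, _, a0, b0⟩, ⟨_, _, a1, b1⟩, ⟨_, _, a2, b2⟩, ⟨_, _, a3, b3⟩, ⟨_, _, a4, b4⟩, ⟨_, _, a5, b5⟩, _⟩ := h
  unfold tri10 cod10 dig6
  exact .cons ⟨by decide, by omega, q0⟩ (.cons ⟨by decide, by omega, q1⟩ (.cons ⟨by decide, by omega, q2⟩ (.cons ⟨by decide, by omega, q3⟩
    (.cons ⟨by decide, a0, b0⟩ (.cons ⟨by decide, a1, b1⟩ (.cons ⟨by decide, a2, b2⟩ (.cons ⟨by decide, a3, b3⟩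
    (.cons ⟨by decide, a4, b4⟩ (.cons ⟨by decide, a5, b5⟩ .nil)))))))))
theorem all_typ {R : Rs} {c : ℕ} (h : List.Forall₂ (fun t l => l < 9 ∧ LawT R t l) tri10 (cod10 c)) : Q0 R ∧ Typ R c := by
  unfold tri10 cod10 dig6 at h
  simp only [List.forall₂_cons, List.forall₂_nil_left_iff] at h
  obtain ⟨⟨_, q0⟩, ⟨_, q1⟩, ⟨_, q2⟩, ⟨_, q3⟩, ⟨a0, b0⟩, ⟨a1, b1⟩, ⟨a2, b2⟩, ⟨a3, b3⟩, ⟨a4, b4⟩, ⟨a5, b5⟩, _⟩ := h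
  refine ⟨⟨q0, q1, q2, q3⟩, ?_⟩
  unfold Typ HasT P6 dig6
  exact .cons ⟨by omega, by omega, a0, b0⟩ (.cons ⟨by omega, by omega, a1, b1⟩ (.cons ⟨by omega, by omega, a2, b2⟩ (.cons ⟨by omega, by omega, a3, b3⟩
    (.cons ⟨by omega, by omega, a4, b4⟩ (.cons ⟨by omega, by omega, a5, b5⟩ .nil)))))

theorem shape (tau : ℕ) : List.Forall₂ (fun t l => T5 t ∧ l < 9) tri10 (cod10 tau) := by
  unfold tri10 cod10 dig6
  have : ∀ x, Nat.mod x 9 < 9 := fun x => Nat.mod_lt _ (by omega)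
  exact .cons ⟨by decide, by omega⟩ (.cons ⟨by decide, by omega⟩ (.cons ⟨by decide, by omega⟩ (.cons ⟨by decide, by omega⟩
    (.cons ⟨by decide, this _⟩ (.cons ⟨by decide, this _⟩ (.cons ⟨by decide, this _⟩ (.cons ⟨by decide, this _⟩
    (.cons ⟨by decide, this _⟩ (.cons ⟨by decide, this _⟩ .nil)))))))))

theorem cert1_ok {R : Rs} (hR : Hyp R) (hQ : Q0 R) {tau e : ℕ} (hT : Typ R (Nat.mod e 531441)) (h : cert1 PLs tau e = true) :
    ∃ R', Hyp R' ∧ Q0 R' ∧ Typ R' tau := by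
  unfold cert1 at h
  rw [strictL_eq, strictL_eq] at h
  obtain ⟨hi, h⟩ := ite'_ff h
  rw [strictL_eq, strictL_eq] at h
  generalize Nat.div e 1062882 = pc at *
  have hw5 := injP_5 hi
  have hw9 := injP_9 hi
  cases hb : Nat.beq (Nat.mod (Nat.div e 531441) 2) 0
  · rw [hb, ite'_false] at h
    have := cert_core hR.lin (pfun pc) rvn hw5 (fun q hq => by unfold rvn; exact lt_of_le_of_lt (Nat.sub_le 2 q) (by omega)) (typ_all hQ hT) (shape tau) h
    refine ⟨rvs (rel (pfun pc) R), rvs_hyp (rel_hyp hw9 hR), all_typ (this.imp ?_)⟩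
    rintro t l ⟨⟨a1, a2, a3, a4, a5, a6⟩, hl, hL⟩
    exact ⟨hl, rvs_law (rel_hyp hw9 hR).lin (by omega) (by omega) (by omega) a4 a5 a6 hl (rel_law hL)⟩
  · rw [hb, ite'_true] at h
    have := cert_core hR.lin (pfun pc) idn hw5 (fun q hq => hq) (typ_all hQ hT) (shape tau) h
    refine ⟨rel (pfun pc) R, rel_hyp hw9 hR, all_typ (this.imp ?_)⟩
    rintro t l ⟨_, hl, hL⟩
    have e : 3*(l/3) + idn (Nat.mod l 3) = l := Nat.div_add_mod l 3
    rw [e] at hL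
    exact ⟨hl, rel_law hL⟩

theorem certC_ok (hc : runCert = true) {R : Rs} (hR : Hyp R) (hQ : Q0 R) {a e : ℕ} {cs : List ℕ} (hm : (a :: cs) ∈ CLS) (he : e ∈ a :: cs)
    (hT : Typ R (Nat.mod e 531441)) : ∃ R', Hyp R' ∧ Q0 R' ∧ Typ R' (Nat.mod a 531441) := by
  unfold runCert at hc
  rw [withPL_eq] at hc
  have h1 := fr_all _ _ hc _ hm
  have h1' : fr (fun e ih => ite' (cert1 PLs (Nat.mod a 531441) e) ih false) true (a :: cs) = true := h1
  have h2 := fr_all _ _ h1' e he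
  exact cert1_ok hR hQ hT h2

/-! ### enumeration of types -/
def swp (x i : ℕ) : ℕ := if i = 4 then x else if i = x then 4 else i
theorem swp_inj {x : ℕ} (hx : x < 9) : Inj9 (swp x) := by
  refine ⟨fun i hi => ?_, fun i hi j hj hij => ?_⟩ <;> unfold swp <;> split_ifs <;> omega

theorem swp_fix {x i : ℕ} (h : i < 4) (hx : 5 ≤ x) : swp x i = i := by
  unfold swp; rw [if_neg (by omega), if_neg (by omega)]
theorem mem_dropK {α : Type} (L : List α) (j k : ℕ) (hj : j < L.length) (h : ¬ j < k) : L[j] ∈ L.drop k := by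
  rw [List.mem_iff_getElem]
  exact ⟨j - k, by rw [List.length_drop]; omega, by rw [List.getElem_drop]; congr 1; omega⟩
theorem bset_in (x : ℕ) : ∀ (c : List ℕ) (ih : ℕ), (fr (fun x ih2 => Nat.lor (Nat.shiftLeft 1 (Nat.mod x 531441)) ih2) ih c).testBit x = true →
    (∃ e ∈ c, Nat.mod e 531441 = x) ∨ ih.testBit x = true := by
  intro c
  induction c with
  | nil => intro ih h; exact .inr h
  | cons a c IH =>
    intro ih h
    rw [fr_cons] at h
    have h := (Nat.testBit_or (1 <<< (a % 531441)) _ x).symm.trans h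
    rw [Bool.or_eq_true] at h
    rcases h with h | h
    · rw [Nat.testBit_shiftLeft, Bool.and_eq_true, decide_eq_true_eq] at h
      have : x - a % 531441 = 0 := by
        by_contra hne
        have := h.2
        obtain ⟨n, hn⟩ := Nat.exists_eq_succ_of_ne_zero hne
        rw [hn, Nat.testBit_succ] at this
        simp at this
      exact .inl ⟨a, by simp, by change a % 531441 = x; omega⟩
    · rcases IH ih h with ⟨e, he, h1⟩ | h1
      · exact .inl ⟨e, by simp [he], h1⟩
      · exact .inr h1
theorem bset_ok (x : ℕ) (L : List (List ℕ)) (h : (bset L).testBit x = true) : ∃ c ∈ L, ∃ e ∈ c, Nat.mod e 531441 = x := by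
  induction L with
  | nil => exact absurd h (by unfold bset; rw [fr_nil, Nat.zero_testBit]; simp)
  | cons c L ih =>
    unfold bset at h
    rw [fr_cons] at h
    rcases bset_in x _ _ h with ⟨e, he, h1⟩ | h1
    · exact ⟨c, by simp, e, he, h1⟩
    · obtain ⟨c', hc', h2⟩ := ih h1
      exact ⟨c', by simp [hc'], h2⟩
theorem bt_testBit (B c : ℕ) (h : bt B c = true) : B.testBit c = true := by
  unfold bt at h
  have h := Nat.eq_of_beq_eq_true h
  change (B >>> c) &&& 1 = 1 at h
  rw [Nat.testBit, Nat.and_comm, h]; rfl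

theorem leafV_suf (m : ℕ) (p tl : List ℕ) : tl <:+ leafV m p tl := by
  unfold leafV; rw [strictL_eq]; exact List.suffix_cons _ _
theorem pts_rev (R : Rs) (l0 l1 l2 l3 l4 l5 : ℕ) (h : HasT R 4 [l0,l1,l2,l3,l4,l5]) :
   List.Forall₂ (LawP R fun i => i) [(2,3,4),(1,3,4),(0,3,4),(1,2,4),(0,2,4),(0,1,4)] [l5,l4,l3,l2,l1,l0] := by
  unfold HasT P6 at h
  simp only [List.forall₂_cons, List.forall₂_nil_left_iff] at h
  obtain ⟨⟨_, _, a0, b0⟩, ⟨_, _, a1, b1⟩, ⟨_, _, a2, b2⟩, ⟨_, _, a3, b3⟩, ⟨_, _, a4, b4⟩, ⟨_, _, a5, b5⟩, _⟩ := h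
  exact .cons ⟨by decide, by decide, a5, b5⟩ (.cons ⟨by decide, by decide, a4, b4⟩ (.cons ⟨by decide, by decide, a3, b3⟩ (.cons ⟨by decide, by decide, a2, b2⟩
    (.cons ⟨by decide, by decide, a1, b1⟩ (.cons ⟨by decide, by decide, a0, b0⟩ .nil)))))
theorem hasT_ex {R : Rs} (hR : Hyp R) : ∃ l0 l1 l2 l3 l4 l5, HasT R 4 [l0,l1,l2,l3,l4,l5] := by
  obtain ⟨l0, a0, b0⟩ := hR.law 0 (by omega) 1 (by omega) 4 (by omega) (by omega) (by omega) (by omega)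
  obtain ⟨l1, a1, b1⟩ := hR.law 0 (by omega) 2 (by omega) 4 (by omega) (by omega) (by omega) (by omega)
  obtain ⟨l2, a2, b2⟩ := hR.law 1 (by omega) 2 (by omega) 4 (by omega) (by omega) (by omega) (by omega)
  obtain ⟨l3, a3, b3⟩ := hR.law 0 (by omega) 3 (by omega) 4 (by omega) (by omega) (by omega) (by omega)
  obtain ⟨l4, a4, b4⟩ := hR.law 1 (by omega) 3 (by omega) 4 (by omega) (by omega) (by omega) (by omega)
  obtain ⟨l5, a5, b5⟩ := hR.law 2 (by omega) 3 (by omega) 4 (by omega) (by omega) (by omega) (by omega)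
  refine ⟨l0, l1, l2, l3, l4, l5, ?_⟩
  unfold HasT P6
  exact .cons ⟨by omega, by omega, a0, b0⟩ (.cons ⟨by omega, by omega, a1, b1⟩ (.cons ⟨by omega, by omega, a2, b2⟩ (.cons ⟨by omega, by omega, a3, b3⟩
    (.cons ⟨by omega, by omega, a4, b4⟩ (.cons ⟨by omega, by omega, a5, b5⟩ .nil)))))

theorem enc_dig (l0 l1 l2 l3 l4 l5 : ℕ) (h0 : l0 < 9) (h1 : l1 < 9) (h2 : l2 < 9) (h3 : l3 < 9) (h4 : l4 < 9) (h5 : l5 < 9) :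
    dig6 (enc6 ([l0,l1,l2,l3,l4,l5].map sv)) = [l0,l1,l2,l3,l4,l5] := by
  have e : enc6 ([l0,l1,l2,l3,l4,l5].map sv) = l0 + 9*(l1 + 9*(l2+9*(l3+9*(l4+9*(l5+9*0))))) := by
    have g : ∀ l, Nat.pred (Nat.div (sv l) 80) = l := by
      intro l; unfold sv; change (80*(l+1))/80 - 1 = l; omega
    simp only [List.map_cons, List.map_nil, enc6, fr_cons, fr_nil, g]
    rfl
  rw [e]
  generalize hN : l0 + 9*(l1 + 9*(l2+9*(l3+9*(l4+9*(l5+9*0))))) = N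
  unfold dig6
  change [N % 9, N / 9 % 9, N / 81 % 9, N / 729 % 9, N / 6561 % 9, N / 59049 % 9] = _
  simp only [List.cons.injEq, and_true]
  refine ⟨?_, ?_, ?_, ?_, ?_, ?_⟩ <;> omega

theorem typ_mem (hV : runV = true) {R : Rs} (hR : Hyp R) (hQ : Q0 R) : ∃ c ∈ CLS, ∃ e ∈ c, Typ R (Nat.mod e 531441) := by
  obtain ⟨l0, l1, l2, l3, l4, l5, hT⟩ := hasT_ex hR
  unfold runV at hV
  rw [WSP_eq, strictL_eq, strictL_eq, mkL_eq, mkL_eq, strictL_eq, strictL_eq] at hV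
  have hw : World (fun i => i) := ⟨⟨fun i hi => hi, fun i _ j _ h => h⟩, fun n _ => rfl⟩
  have hm : Cov (SP R (fun i => i) SL0) (fold (tT C0 tq) lQ ON) :=
    tT_ok' SL0_ok C0_eq (pql_law hw hQ) tq rfl _ (cov_ON _)
  have hl := tT_ok SL0_ok C0_eq (pts_rev R _ _ _ _ _ _ hT) tsr rfl
  unfold tT at hm hl
  obtain ⟨m', tl, _, hs⟩ := srch_hit leafV leafV_suf (big_SP hR hw.1 SL0_ok) _ _ hl _ [] [] hm
  have := fr_all _ _ hV _ (hs.subset (by unfold leafV; rw [strictL_eq]; exact List.mem_cons_self))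
  obtain ⟨c, hc, e, he, h⟩ := bset_ok _ _ (bt_testBit _ _ this)
  refine ⟨c, hc, e, he, ?_⟩
  rw [h]
  unfold Typ
  rw [show ((List.map sv [l5, l4, l3, l2, l1, l0]).reverse ++ []) = [l0,l1,l2,l3,l4,l5].map sv from rfl]
  have hT' := hT
  unfold HasT P6 at hT'
  simp only [List.forall₂_cons, List.forall₂_nil_left_iff] at hT'
  obtain ⟨⟨_, _, a0, b0⟩, ⟨_, _, a1, b1⟩, ⟨_, _, a2, b2⟩, ⟨_, _, a3, b3⟩, ⟨_, _, a4, b4⟩, ⟨_, _, a5, b5⟩, _⟩ := hT'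
  rw [enc_dig _ _ _ _ _ _ a0 a1 a2 a3 a4 a5]
  exact hT

/-! ### the class runs -/
theorem dropC_eq (L : List (List ℕ)) : ∀ i, dropC L i = L.drop i := by
  intro i
  induction i with
  | zero => rfl
  | succ i ih =>
    change (List.rec [] (fun _ t _ => t) (dropC L i) : List (List ℕ)) = _
    rw [ih, ← List.drop_drop (i := 1)]
    cases L.drop i <;> rfl
theorem dec6_eq (c : ℕ) (k : List ℕ → List (List ℕ)) : dec6 c k = k ((dig6 c).map sv) := by
  have e : ∀ x, Nat.mul 80 (Nat.succ x) = sv x := fun _ => rfl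
  unfold dec6
  simp only [strictL_eq, e]
  rfl
theorem decAll_eq (L : List (List ℕ)) : decAll L = (L.flatten.map dig6).map (List.map sv) := by
  unfold decAll
  induction L with
  | nil => rfl
  | cons c L ih =>
    rw [fr_cons, ih, List.flatten_cons, List.map_append, List.map_append]
    generalize (L.flatten.map dig6).map (List.map sv) = M
    induction c with
    | nil => rfl
    | cons a c ih2 => rw [fr_cons, dec6_eq, ih2]; rfl
theorem dig6_mod (e : ℕ) : dig6 (Nat.mod e 531441) = dig6 e := by
  unfold dig6
  change [e % 531441 % 9, e % 531441 / 9 % 9, e % 531441 / 81 % 9, e % 531441 / 729 % 9, e % 531441 / 6561 % 9, e % 531441 / 59049 % 9] =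
    [e % 9, e / 9 % 9, e / 81 % 9, e / 729 % 9, e / 6561 % 9, e / 59049 % 9]
  simp only [List.cons.injEq, and_true]
  refine ⟨?_, ?_, ?_, ?_, ?_, ?_⟩ <;> omega
def runI (i : ℕ) : Prop := runC T0 i = true
theorem runR_all (i : ℕ) : ∀ n, runR i n = true → ∀ j < n, runI (i + j) := by
  intro n h
  unfold runR at h
  rw [mkTabs_eq] at h
  induction n with
  | zero => intro j hj; omega
  | succ n ih =>
    obtain ⟨h1, h2⟩ := ite'_ff (a := runC T0 (Nat.add i n)) h
    intro j hj
    by_cases e : j = n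
    · rw [e]; exact h1
    · exact ih h2 j (by omega)
theorem runI_chk {i a : ℕ} {cs : List ℕ} {t : List (List ℕ)} (h : runI i) (hd : CLS.drop i = (a :: cs) :: t) :
    chkClass T0 ((dig6 a).map sv) ((((a :: cs) :: t).flatten.map dig6).map (List.map sv)) = true := by
  unfold runI runC at h
  rw [dropC_eq, hd] at h
  have h : fcs fc0 (decAll ((a :: cs) :: t)) (fun al => @List.rec _ (fun _ => Bool) true (fun tau _ _ => chkClass T0 tau al) al) = true := h
  rw [fcs_eq fc0 (fun _ _ => rfl), decAll_eq] at h
  exact h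

theorem cls_ne : CLS.length = 102 ∧ ∀ c ∈ CLS, c ≠ [] := by decide +kernel

theorem no_typ (hV : runV = true) (hC : runCert = true) (hr : ∀ i < 102, runI i) : ∀ k, ∀ hk : k < CLS.length, ∀ R, Hyp R → Q0 R →
    ∀ e ∈ CLS[k], ¬ Typ R (Nat.mod e 531441) := by
  intro k
  induction k using Nat.strong_induction_on with
  | _ k IH =>
  intro hk R hR hQ e he hT
  obtain ⟨a, cs, hac⟩ := List.exists_cons_of_ne_nil (cls_ne.2 _ (List.getElem_mem hk))
  rw [hac] at he
  obtain ⟨R', hR', hQ', hT'⟩ := certC_ok hC hR hQ (hac ▸ List.getElem_mem hk) he hT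
  have hd : CLS.drop k = (a :: cs) :: CLS.drop (k+1) := by
    rw [← hac]; exact List.drop_eq_getElem_cons hk
  have h := runI_chk (hr k (by rw [cls_ne.1] at hk; exact hk)) hd
  unfold Typ at hT'
  rw [dig6_mod] at hT'
  refine class_contra hR' hQ' hT' (fun x h5 h9 => ?_) h
  have hs := swp_inj h9
  have e0 : swp x 0 = 0 := swp_fix (by omega) h5
  have e1 : swp x 1 = 1 := swp_fix (by omega) h5
  have e2 : swp x 2 = 2 := swp_fix (by omega) h5
  have e3 : swp x 3 = 3 := swp_fix (by omega) h5
  have e4 : swp x 4 = x := by unfold swp; rw [if_pos rfl]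
  have hQs : Q0 (rel (swp x) R') := by
    refine ⟨rel_law ?_, rel_law ?_, rel_law ?_, rel_law ?_⟩
    · rw [e0, e1, e2]; exact hQ'.1
    · rw [e0, e1, e3]; exact hQ'.2.1
    · rw [e0, e2, e3]; exact hQ'.2.2.1
    · rw [e1, e2, e3]; exact hQ'.2.2.2
  obtain ⟨c, hc, e', he', ht⟩ := typ_mem hV (rel_hyp hs hR') hQs
  obtain ⟨j, hj, rfl⟩ := List.getElem_of_mem hc
  by_cases hjk : j < k
  · exact absurd ht (IH j hjk hj _ (rel_hyp hs hR') hQs e' he')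
  · refine ⟨dig6 e', List.mem_map.2 ⟨e', ?_, rfl⟩, ?_⟩
    · rw [← hd, List.mem_flatten]
      exact ⟨_, mem_dropK _ j k hj hjk, he'⟩
    · unfold Typ at ht
      rw [dig6_mod] at ht
      unfold HasT at ht ⊢
      generalize dig6 e' = ls at ht ⊢
      unfold P6 at ht ⊢
      rcases ls with _ | ⟨l0, _ | ⟨l1, _ | ⟨l2, _ | ⟨l3, _ | ⟨l4, _ | ⟨l5, _ | ⟨l6, ls⟩⟩⟩⟩⟩⟩⟩ <;>
        simp only [List.forall₂_cons, List.forall₂_nil_left_iff, List.forall₂_nil_right_iff, and_false, reduceCtorEq] at ht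
      obtain ⟨⟨_, _, a0, b0⟩, ⟨_, _, a1, b1⟩, ⟨_, _, a2, b2⟩, ⟨_, _, a3, b3⟩, ⟨_, _, a4, b4⟩, ⟨_, _, a5, b5⟩, _⟩ := ht
      have b0 := law_rel b0; have b1 := law_rel b1; have b2 := law_rel b2
      have b3 := law_rel b3; have b4 := law_rel b4; have b5 := law_rel b5
      rw [e4] at b0 b1 b2 b3 b4 b5
      rw [e0, e1] at b0; rw [e0, e2] at b1; rw [e1, e2] at b2; rw [e0, e3] at b3; rw [e1, e3] at b4; rw [e2, e3] at b5
      exact .cons ⟨by omega, by omega, a0, b0⟩ (.cons ⟨by omega, by omega, a1, b1⟩ (.cons ⟨by omega, by omega, a2, b2⟩ (.cons ⟨by omega, by omega, a3, b3⟩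
        (.cons ⟨by omega, by omega, a4, b4⟩ (.cons ⟨by omega, by omega, a5, b5⟩ .nil)))))

theorem no_Q0 (hV : runV = true) (hC : runCert = true) (hr : ∀ i < 102, runI i) {R : Rs} (hR : Hyp R) (hQ : Q0 R) : False := by
  obtain ⟨c, hc, e, he, ht⟩ := typ_mem hV hR hQ
  obtain ⟨j, hj, rfl⟩ := List.getElem_of_mem hc
  exact no_typ hV hC hr j hj R hR hQ e he ht

end CD

namespace CD

theorem memN_ok {x : ℕ} {l : List ℕ} (h : memN x l = true) : x ∈ l := by
  unfold memN at h
  induction l with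
  | nil => exact absurd h (by rw [fr_nil]; simp)
  | cons a l ih =>
    rw [fr_cons] at h
    by_cases e : a = x
    · rw [e]; exact List.mem_cons_self
    · rw [beq_false' e, ite'_false] at h
      exact List.mem_cons_of_mem _ (ih h)
theorem fr_any {α : Type} (f : α → Bool) (l : List α) (h : fr (fun a ih => ite' (f a) true ih) false l = true) : ∃ a ∈ l, f a = true := by
  induction l with
  | nil => exact absurd h (by rw [fr_nil]; simp)
  | cons a l ih =>
    rw [fr_cons] at h
    cases e : f a
    · rw [e, ite'_false] at h
      obtain ⟨b, hb, h1⟩ := ih h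
      exact ⟨b, List.mem_cons_of_mem _ hb, h1⟩
    · exact ⟨a, List.mem_cons_self, e⟩
theorem dec_key (a b c d : ℕ) (ha : a < 9) (hb : b < 9) (hc : c < 9) (hd : d < 9) : dec4 (key4 (sv a) (sv b) (sv c) (sv d)) = [a,b,c,d] := by
  have e : key4 (sv a) (sv b) (sv c) (sv d) = 80*(a+1) + 1000*(80*(b+1) + 1000*(80*(c+1)+1000*(80*(d+1)))) := rfl
  rw [e]
  generalize hN : 80*(a+1) + 1000*(80*(b+1) + 1000*(80*(c+1)+1000*(80*(d+1)))) = N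
  unfold dec4
  change [N % 1000 / 80 - 1, N / 1000 % 1000 / 80 - 1, N / 1000000 % 1000 / 80 - 1, N / 1000000000 / 80 - 1] = _
  simp only [List.cons.injEq, and_true]
  have e1 : N % 1000 = 80*(a+1) := by omega
  have e2 : N / 1000 = 80*(b+1) + 1000*(80*(c+1)+1000*(80*(d+1))) := by omega
  have e3 : N / 1000000 = 80*(c+1)+1000*(80*(d+1)) := by omega
  have e4 : N / 1000000000 = 80*(d+1) := by omega
  have e5 : N / 1000 % 1000 = 80*(b+1) := by rw [e2]; omega
  have e6 : N / 1000000 % 1000 = 80*(c+1) := by rw [e3]; omega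
  rw [e1, e5, e6, e4]
  refine ⟨?_, ?_, ?_, ?_⟩ <;> omega

theorem quad_Q0 (hQP : runQP = true) {R : Rs} (hR : Hyp R) {a b c d : ℕ} (ha : a < 9) (hb : b < 9) (hc : c < 9) (hd : d < 9)
    (La : Law R 0 1 2 a) (Lb : Law R 0 1 3 b) (Lc : Law R 0 2 3 c) (Ld : Law R 1 2 3 d)
    (h : memN (key4 (sv a) (sv b) (sv c) (sv d)) QL = true) : ∃ R', Hyp R' ∧ Q0 R' := by
  unfold runQP at hQP
  rw [withPL_eq] at hQP
  have h1 := fr_all _ _ hQP _ (memN_ok h)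
  obtain ⟨pc, _, h2⟩ := fr_any _ _ h1
  unfold certQ1 at h2
  obtain ⟨hi, h3⟩ := ite'_ff h2
  rw [strictL_eq, strictL_eq, dec_key a b c d ha hb hc hd] at h3
  have hw5 := injP_5 hi
  have hw9 := injP_9 hi
  have := cert_core hR.lin (pfun pc) idn hw5 (fun q hq => hq) (ts1 := tri4) (ls1 := [a,b,c,d]) (ts2 := tri4) (ls2 := [2,2,3,3])
    (.cons ⟨by decide, ha, La⟩ (.cons ⟨by decide, hb, Lb⟩ (.cons ⟨by decide, hc, Lc⟩ (.cons ⟨by decide, hd, Ld⟩ .nil))))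
    (.cons ⟨by decide, by omega⟩ (.cons ⟨by decide, by omega⟩ (.cons ⟨by decide, by omega⟩ (.cons ⟨by decide, by omega⟩ .nil)))) h3
  refine ⟨rel (pfun pc) R, rel_hyp hw9 hR, ?_⟩
  unfold tri4 at this
  simp only [List.forall₂_cons] at this
  obtain ⟨⟨_, _, q0⟩, ⟨_, _, q1⟩, ⟨_, _, q2⟩, ⟨_, _, q3⟩, _⟩ := this
  exact ⟨rel_law q0, rel_law q1, rel_law q2, rel_law q3⟩

/-! ### sorting -/
theorem sort_ex {r : ℕ → ℕ → Bool} (hr : Lin r) : ∃ w, Inj9 w ∧ ∀ i < 9, ∀ j < 9, i < j → r (w i) (w j) = true := by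
  let le : Fin 9 → Fin 9 → Prop := fun i j => i = j ∨ r i j = true
  have : DecidableRel le := fun i j => by unfold le; infer_instance
  have : Std.Total le := ⟨fun i j => by
    by_cases h : i = j
    · exact .inl (.inl h)
    · have := hr.1 i i.2 j j.2 (by omega)
      cases e : r i j
      · rw [e] at this; exact .inr (.inr this)
      · exact .inl (.inr e)⟩
  have : IsTrans _ le := ⟨fun i j k h1 h2 => by
    rcases h1 with h1 | h1
    · rw [h1]; exact h2
    rcases h2 with h2 | h2
    · rw [← h2]; exact .inr h1
    by_cases hij : i = j
    · rw [hij]; exact .inr h2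
    by_cases hjk : j = k
    · rw [← hjk]; exact .inr h1
    by_cases hik : i = k
    · exact .inl hik
    · exact .inr (hr.2 i i.2 j j.2 k k.2 (by omega) (by omega) (by omega) h1 h2)⟩
  have hp := List.pairwise_insertionSort le (List.finRange 9)
  have hq := List.perm_insertionSort le (List.finRange 9)
  have hn := hq.nodup_iff.2 (List.nodup_finRange 9)
  have hl := hq.length_eq
  rw [List.length_finRange] at hl
  generalize List.insertionSort le (List.finRange 9) = L at hp hn hl
  have hne : ∀ i (hi : i < 9), ∀ j (hj : j < 9), i ≠ j → L[i] ≠ L[j] := fun i hi j hj h e =>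
    h ((List.Nodup.getElem_inj_iff hn).1 e)
  have hv : ∀ i (hi : i < 9), (if h : i < 9 then ((L[i] : Fin 9) : ℕ) else 0) = L[i] := fun i hi => dif_pos hi
  refine ⟨fun i => if h : i < 9 then (L[i] : Fin 9) else 0, ⟨fun i hi => ?_, fun i hi j hj h => ?_⟩, fun i hi j hj h => ?_⟩
  · dsimp only; rw [hv i hi]; exact (L[i]).2
  · dsimp only; rw [hv i hi, hv j hj]
    exact fun e => hne i hi j hj h (Fin.ext e)
  · dsimp only; rw [hv i hi, hv j hj]
    rcases List.pairwise_iff_getElem.1 hp i j (by omega) (by omega) h with e | e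
    · exact absurd e (hne i hi j hj (by omega))
    · exact e

/-! ### the quadruple -/
theorem sat_id : ∀ l < 9, satc true true true l = true → rQ.testBit (l+2) = true := by decide

def PQ : List (List Nat → Bool) := [noP, noP, noP, noP, quad 4 2 1 0, noP, noP, quad 7 2 1 0,
     fun p => quad 5 2 0 7 p, fun p => ite' (quad 7 4 1 0 p) true (quad 5 2 0 8 p)]
theorem zipQ_cons (a : ℕ) (l : List ℕ) (p : List Nat → Bool) (P : List (List Nat → Bool)) : zipQ (a :: l) (p :: P) = (a, rQ, p) :: zipQ l P := rfl
theorem zipQ_ok {S : ℕ → ℕ → Prop} {L ls : List ℕ} (h : List.Forall₂ (fun T l => (l < 9 ∧ TS S T l) ∧ rQ.testBit (l+2) = true) L ls) :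
    ∀ P : List (List Nat → Bool), P.length = L.length → List.Forall₂ (fun T l => l < 9 ∧ TS S T.1 l ∧ T.2.1.testBit (l+2) = true) (zipQ L P) ls := by
  induction h with
  | nil => intro P _; exact .nil
  | cons h _ ih =>
    intro P hP
    cases P with
    | nil => simp at hP
    | cons p P => rw [zipQ_cons]; exact .cons ⟨h.1.1, h.1.2, h.2⟩ (ih P (by simpa using hP))
theorem hit_cons (a b : ℕ) (p : List Nat → Bool) (ts : List (Nat × Nat × (List Nat → Bool))) (l : ℕ) (ls path : List ℕ)
   (h : Hit ((a, b, p) :: ts) (l :: ls) path) : p (sv l :: path) = true ∨ Hit ts ls (sv l :: path) := h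
theorem noP_f (p : List ℕ) : ¬ noP p = true := by unfold noP; simp

theorem hitQ {L : List ℕ} {l0 l1 l2 l3 l4 l5 l6 l7 l8 l9 : ℕ} (hL : L.length = 10)
    (h : Hit (zipQ L PQ) [l0,l1,l2,l3,l4,l5,l6,l7,l8,l9] []) :
    memN (key4 (sv l0) (sv l2) (sv l3) (sv l4)) QL = true ∨ memN (key4 (sv l0) (sv l5) (sv l6) (sv l7)) QL = true ∨
    memN (key4 (sv l3) (sv l6) (sv l8) (sv l1)) QL = true ∨ memN (key4 (sv l2) (sv l5) (sv l8) (sv l9)) QL = true ∨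
    memN (key4 (sv l4) (sv l7) (sv l9) (sv l1)) QL = true := by
  rcases L with _ | ⟨a0, _ | ⟨a1, _ | ⟨a2, _ | ⟨a3, _ | ⟨a4, _ | ⟨a5, _ | ⟨a6, _ | ⟨a7, _ | ⟨a8, _ | ⟨a9, L⟩⟩⟩⟩⟩⟩⟩⟩⟩⟩ <;>
    simp only [List.length_cons, List.length_nil] at hL <;> try omega
  unfold PQ at h
  simp only [zipQ_cons] at h
  rcases hit_cons _ _ _ _ _ _ _ h with h | h
  · exact absurd h (noP_f _)
  rcases hit_cons _ _ _ _ _ _ _ h with h | h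
  · exact absurd h (noP_f _)
  rcases hit_cons _ _ _ _ _ _ _ h with h | h
  · exact absurd h (noP_f _)
  rcases hit_cons _ _ _ _ _ _ _ h with h | h
  · exact absurd h (noP_f _)
  rcases hit_cons _ _ _ _ _ _ _ h with h | h
  · unfold quad at h; rw [strictL_eq] at h; exact .inl h
  rcases hit_cons _ _ _ _ _ _ _ h with h | h
  · exact absurd h (noP_f _)
  rcases hit_cons _ _ _ _ _ _ _ h with h | h
  · exact absurd h (noP_f _)
  rcases hit_cons _ _ _ _ _ _ _ h with h | h
  · unfold quad at h; rw [strictL_eq] at h; exact .inr (.inl h)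
  rcases hit_cons _ _ _ _ _ _ _ h with h | h
  · unfold quad at h; rw [strictL_eq] at h; exact .inr (.inr (.inl h))
  rcases hit_cons _ _ _ _ _ _ _ h with h | h
  · cases e : quad 7 4 1 0 [sv l9, sv l8, sv l7, sv l6, sv l5, sv l4, sv l3, sv l2, sv l1, sv l0]
    · rw [e, ite'_false] at h
      unfold quad at h; rw [strictL_eq] at h; exact .inr (.inr (.inr (.inr h)))
    · unfold quad at e; rw [strictL_eq] at e; exact .inr (.inr (.inr (.inl e)))
  · cases L with
    | nil => exact h.elim
    | cons x L => simp at hL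

def w5 (a b c d e n : ℕ) : ℕ := if n = 0 then a else if n = 1 then b else if n = 2 then c else if n = 3 then d else if n = 4 then e else n
theorem w5_inj {a b c d e : ℕ} (h : a < 5 ∧ b < 5 ∧ c < 5 ∧ d < 5 ∧ e < 5 ∧ a ≠ b ∧ a ≠ c ∧ a ≠ d ∧ a ≠ e ∧ b ≠ c ∧ b ≠ d ∧ b ≠ e ∧ c ≠ d ∧ c ≠ e ∧ d ≠ e) :
    Inj9 (w5 a b c d e) := by
  refine ⟨fun i hi => ?_, fun i hi j hj hij => ?_⟩ <;> unfold w5 <;> split_ifs <;> omega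

def pQ : List (ℕ × ℕ × ℕ) := [(0,1,2),(2,3,4),(0,1,3),(0,2,3),(1,2,3),(0,1,4),(0,2,4),(1,2,4),(0,3,4),(1,3,4)]

theorem Q0_ex (hq : runQ = true) (hQP : runQP = true) {R : Rs} (hR : Hyp R) : ∃ R', Hyp R' ∧ Q0 R' := by
  obtain ⟨F, _, hF, hF'⟩ := hR.big (fun i => i) ⟨fun i hi => hi, fun i _ j _ h => h⟩ (0,1,2,3,4) (by decide)
  obtain ⟨p, hp⟩ := Finset.card_pos.1 (show 0 < F.card by omega)
  obtain ⟨_, _, r0, hr0, _⟩ := hF' p hp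
  obtain ⟨w, hw, hs⟩ := sort_ex (hR.lin r0 hr0)
  have hR1 := rel_hyp hw hR
  have hid : ∀ a b c l, a < b → b < c → c < 9 → l < 9 → Law (rel w R) a b c l → rQ.testBit (l+2) = true := by
    intro a b c l h1 h2 h3 hl hL
    refine sat_id l hl ?_
    have := hL _ ⟨r0, hr0, rfl⟩
    unfold satR at this
    dsimp only at this
    rwa [hs a (by omega) b (by omega) h1, hs a (by omega) c (by omega) (by omega), hs b (by omega) c (by omega) h2] at this
  generalize rel w R = R1 at hR1 hid
  have law : ∀ a b c, a < b → b < c → c < 9 → ∃ l, l < 9 ∧ Law R1 a b c l ∧ rQ.testBit (l+2) = true := by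
    intro a b c h1 h2 h3
    obtain ⟨l, hl, hL⟩ := hR1.law a (by omega) b (by omega) c (by omega) (by omega) (by omega) (by omega)
    exact ⟨l, hl, hL, hid a b c l h1 h2 h3 hl hL⟩
  obtain ⟨l0, a0, b0, c0⟩ := law 0 1 2 (by omega) (by omega) (by omega)
  obtain ⟨l1, a1, b1, c1⟩ := law 2 3 4 (by omega) (by omega) (by omega)
  obtain ⟨l2, a2, b2, c2⟩ := law 0 1 3 (by omega) (by omega) (by omega)
  obtain ⟨l3, a3, b3, c3⟩ := law 0 2 3 (by omega) (by omega) (by omega)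
  obtain ⟨l4, a4, b4, c4⟩ := law 1 2 3 (by omega) (by omega) (by omega)
  obtain ⟨l5, a5, b5, c5⟩ := law 0 1 4 (by omega) (by omega) (by omega)
  obtain ⟨l6, a6, b6, c6⟩ := law 0 2 4 (by omega) (by omega) (by omega)
  obtain ⟨l7, a7, b7, c7⟩ := law 1 2 4 (by omega) (by omega) (by omega)
  obtain ⟨l8, a8, b8, c8⟩ := law 0 3 4 (by omega) (by omega) (by omega)
  obtain ⟨l9, a9, b9, c9⟩ := law 1 3 4 (by omega) (by omega) (by omega)
  unfold runQ at hq
  rw [WSP_eq, strictL_eq, strictL_eq, mkL_eq] at hq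
  have hq : bsrch (zipQ (tT C0 oQ) PQ) ON [] = true := hq
  have hw : World (fun i => i) := ⟨⟨fun i hi => hi, fun i _ j _ h => h⟩, fun n _ => rfl⟩
  have hP : List.Forall₂ (LawP R1 fun i => i) pQ [l0,l1,l2,l3,l4,l5,l6,l7,l8,l9] :=
    .cons ⟨by decide, by decide, a0, b0⟩ (.cons ⟨by decide, by decide, a1, b1⟩ (.cons ⟨by decide, by decide, a2, b2⟩ (.cons ⟨by decide, by decide, a3, b3⟩
     (.cons ⟨by decide, by decide, a4, b4⟩ (.cons ⟨by decide, by decide, a5, b5⟩ (.cons ⟨by decide, by decide, a6, b6⟩ (.cons ⟨by decide, by decide, a7, b7⟩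
     (.cons ⟨by decide, by decide, a8, b8⟩ (.cons ⟨by decide, by decide, a9, b9⟩ .nil)))))))))
  have hl := tT_ok SL0_ok C0_eq hP oQ rfl
  have hlen : (tT C0 oQ).length = 10 := by unfold tT; rw [List.length_map]; rfl
  generalize tT C0 oQ = L at hl hlen hq
  have hl2 : List.Forall₂ (fun T l => (l < 9 ∧ TS (SP R1 (fun i => i) SL0) T l) ∧ rQ.testBit (l+2) = true) L [l0,l1,l2,l3,l4,l5,l6,l7,l8,l9] := by
    rw [List.forall₂_iff_get] at hl ⊢
    refine ⟨hl.1, fun i h1 h2 => ⟨hl.2 i h1 h2, ?_⟩⟩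
    have : ∀ l ∈ [l0,l1,l2,l3,l4,l5,l6,l7,l8,l9], rQ.testBit (l+2) = true := by
      intro l hm
      simp only [List.mem_cons, List.not_mem_nil, or_false] at hm
      rcases hm with h | h | h | h | h | h | h | h | h | h <;> rw [h] <;> assumption
    exact this _ (List.get_mem _ _)
  have hit := bsrch_hit (big_SP hR1 hw.1 SL0_ok) _ _ (zipQ_ok hl2 PQ (by rw [hlen]; rfl)) ON [] (cov_ON _) hq
  rcases hitQ hlen hit with h | h | h | h | h
  · exact quad_Q0 hQP hR1 a0 a2 a3 a4 b0 b2 b3 b4 h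
  · exact quad_Q0 hQP (rel_hyp (w5_inj (a := 0) (b := 1) (c := 2) (d := 4) (e := 3) (by omega)) hR1) a0 a5 a6 a7 (rel_law b0) (rel_law b5) (rel_law b6) (rel_law b7) h
  · exact quad_Q0 hQP (rel_hyp (w5_inj (a := 0) (b := 2) (c := 3) (d := 4) (e := 1) (by omega)) hR1) a3 a6 a8 a1 (rel_law b3) (rel_law b6) (rel_law b8) (rel_law b1) h
  · exact quad_Q0 hQP (rel_hyp (w5_inj (a := 0) (b := 1) (c := 3) (d := 4) (e := 2) (by omega)) hR1) a2 a5 a8 a9 (rel_law b2) (rel_law b5) (rel_law b8) (rel_law b9) h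
  · exact quad_Q0 hQP (rel_hyp (w5_inj (a := 1) (b := 2) (c := 3) (d := 4) (e := 0) (by omega)) hR1) a4 a7 a9 a1 (rel_law b4) (rel_law b7) (rel_law b9) (rel_law b1) h

theorem no_Hyp (hq : runQ = true) (hQP : runQP = true) (hV : runV = true) (hC : runCert = true) (hr : ∀ i < 102, runI i) (R : Rs) (hR : Hyp R) : False := by
  obtain ⟨R', h1, h2⟩ := Q0_ex hq hQP hR
  exact no_Q0 hV hC hr h1 h2

end CD

namespace CD
theorem maj3 {α : Type*} (r1 r2 r3 : α → α → Prop) (a b : α) [Decidable (r1 a b)] [Decidable (r2 a b)] [Decidable (r3 a b)] :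
    majCount [r1, r2, r3] a b = (if r1 a b then 1 else 0) + (if r2 a b then 1 else 0) + (if r3 a b then 1 else 0) := by
  classical
  unfold majCount
  change Nat.card {i : Fin 3 // ([r1, r2, r3].get i) a b} = _
  rw [Nat.card_eq_fintype_card, Fintype.card_subtype, Finset.card_filter, Fin.sum_univ_three]
  simp only [List.get]
  congr

theorem cyc {α : Type*} {X : Set α} {D : Set (α → α → Prop)} (hD : IsCondorcetDomain X D) {a b c : α} (ha : a ∈ X) (hb : b ∈ X) (hc : c ∈ X)
    {r1 r2 r3 : α → α → Prop} (h1 : r1 ∈ D) (h2 : r2 ∈ D) (h3 : r3 ∈ D) (p1 : r1 a b) (p2 : r1 b c) (p3 : r2 b c) (p4 : ¬ r2 a c)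
    (p5 : r3 a b) (p6 : ¬ r3 a c) : False := by
  classical
  have := hD.2 [r1, r2, r3] (by simp [h1, h2, h3]) ⟨1, rfl⟩ a ha b hb c hc
  unfold MajPrefers at this
  simp only [maj3, List.length_cons, List.length_nil, if_pos p1, if_pos p2, if_pos p3, if_neg p4, if_pos p5, if_neg p6] at this
  have := this (by split_ifs <;> omega) (by split_ifs <;> omega)
  split_ifs at this <;> omega

theorem lawB (P : Bool → Bool → Bool → Prop) (h0 : ¬ P true false true) (h1 : ¬ P false true false)
    (h2 : P true true true → P false false true → P true false false → False)
    (h3 : P true true false → P false true true → P false false false → False) : ∃ l < 9, ∀ x y z, P x y z → satc x y z l = true := by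
  have key : ∀ l < 9, ∀ a b c d e f : Bool, satc a b c l = false → satc d e f l = false → ¬ P a b c → ¬ P d e f →
    (∀ x y z, satc x y z l = false → (x = a ∧ y = b ∧ z = c) ∨ (x = d ∧ y = e ∧ z = f) ∨ (x = true ∧ y = false ∧ z = true) ∨ (x = false ∧ y = true ∧ z = false)) →
    ∃ l < 9, ∀ x y z, P x y z → satc x y z l = true := by
    intro l hl a b c d e f _ _ n1 n2 h
    refine ⟨l, hl, fun x y z hP => ?_⟩
    by_contra hs
    rw [Bool.not_eq_true] at hs
    rcases h x y z hs with ⟨rfl, rfl, rfl⟩ | ⟨rfl, rfl, rfl⟩ | ⟨rfl, rfl, rfl⟩ | ⟨rfl, rfl, rfl⟩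
    · exact n1 hP
    · exact n2 hP
    · exact h0 hP
    · exact h1 hP
  by_cases a1 : P true true true
  · by_cases a2 : P false false true
    · have a3 := h2 a1 a2
      by_cases b1 : P true true false
      · by_cases b2 : P false true true
        · exact key 6 (by omega) _ _ _ _ _ _ rfl rfl a3 (h3 b1 b2) (by decide)
        · exact key 1 (by omega) _ _ _ _ _ _ rfl rfl a3 b2 (by decide)
      · exact key 5 (by omega) _ _ _ _ _ _ rfl rfl a3 b1 (by decide)
    · by_cases b1 : P true true false
      · by_cases b2 : P false true true
        · exact key 2 (by omega) _ _ _ _ _ _ rfl rfl a2 (h3 b1 b2) (by decide)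
        · exact key 3 (by omega) _ _ _ _ _ _ rfl rfl a2 b2 (by decide)
      · exact key 7 (by omega) _ _ _ _ _ _ rfl rfl a2 b1 (by decide)
  · by_cases b1 : P true true false
    · by_cases b2 : P false true true
      · exact key 4 (by omega) _ _ _ _ _ _ rfl rfl a1 (h3 b1 b2) (by decide)
      · exact key 8 (by omega) _ _ _ _ _ _ rfl rfl a1 b2 (by decide)
    · exact key 0 (by omega) _ _ _ _ _ _ rfl rfl a1 b1 (by decide)

theorem anti {α : Type*} {X : Set α} {r : α → α → Prop} (h : IsLinearOrderOn X r) {a b : α} (ha : a ∈ X) (hb : b ∈ X) (hab : a ≠ b) :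
    r b a ↔ ¬ r a b := by
  constructor
  · intro h1 h2; exact h.2.1 a ha (h.2.2.1 a ha b hb a ha h2 h1)
  · intro h1; exact (h.2.2.2 a ha b hb hab).resolve_left h1

theorem restr_eq {α : Type*} {X : Set α} {r r' : α → α → Prop} (h : IsLinearOrderOn X r) (h' : IsLinearOrderOn X r') (x : ℕ → α)
    (hx : ∀ i < 5, x i ∈ X) (hn : ∀ i < 5, ∀ j < 5, i ≠ j → x i ≠ x j) (he : ∀ j < 5, ∀ i < j, (r (x i) (x j) ↔ r' (x i) (x j))) :
    restrictRel (x '' Set.Iio 5) r = restrictRel (x '' Set.Iio 5) r' := by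
  funext a b
  unfold restrictRel
  apply propext
  refine and_congr_right fun ha => and_congr_right fun hb => ?_
  obtain ⟨i, hi, rfl⟩ := ha
  obtain ⟨j, hj, rfl⟩ := hb
  simp only [Set.mem_Iio] at hi hj
  rcases lt_trichotomy i j with e | e | e
  · exact he j hj i e
  · rw [e]; exact iff_of_false (h.2.1 _ (hx j hj)) (h'.2.1 _ (hx j hj))
  · rw [anti h (hx j hj) (hx i hi) (hn j hj i hi (by omega)), anti h' (hx j hj) (hx i hi) (hn j hj i hi (by omega)), he i hi j e]

open Classical in
theorem mkHyp {α : Type*} {X : Set α} {D : Set (α → α → Prop)} (hD : IsCondorcetDomain X D)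
    (hA : ∀ A : Set α, A ⊆ X → A.ncard = 5 → 17 ≤ (restrictDom A D).ncard) (v : ℕ → α) (hv : ∀ i < 9, v i ∈ X)
    (hi : ∀ i < 9, ∀ j < 9, i ≠ j → v i ≠ v j) : Hyp ((fun r i j => decide (r (v i) (v j))) '' D) := by
  have hlin : ∀ r ∈ D, Lin (fun i j => decide (r (v i) (v j))) := by
    intro r hr
    have h := hD.1 r hr
    refine ⟨fun i h1 j h2 h3 => ?_, fun i h1 j h2 k h3 _ _ _ h4 h5 => ?_⟩
    · rw [← decide_not]; exact decide_eq_decide.2 (anti h (hv i h1) (hv j h2) (hi i h1 j h2 h3))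
    · rw [decide_eq_true_eq] at *
      exact h.2.2.1 _ (hv i h1) _ (hv j h2) _ (hv k h3) h4 h5
  refine ⟨?_, ?_, ?_⟩
  · rintro _ ⟨r, hr, rfl⟩; exact hlin r hr
  · intro i h1 j h2 k h3 h12 h23 h13
    obtain ⟨l, hl, h⟩ := lawB (fun x y z => ∃ r ∈ D, decide (r (v i) (v j)) = x ∧ decide (r (v i) (v k)) = y ∧ decide (r (v j) (v k)) = z)
      (by
        rintro ⟨r, hr, e1, e2, e3⟩
        simp only [decide_eq_true_eq, decide_eq_false_iff_not] at e1 e2 e3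
        exact e2 ((hD.1 r hr).2.2.1 _ (hv i h1) _ (hv j h2) _ (hv k h3) e1 e3))
      (by
        rintro ⟨r, hr, e1, e2, e3⟩
        simp only [decide_eq_true_eq, decide_eq_false_iff_not] at e1 e2 e3
        rw [← anti (hD.1 r hr) (hv _ h2) (hv _ h3) (hi j h2 k h3 h23)] at e3
        exact e1 ((hD.1 r hr).2.2.1 _ (hv i h1) _ (hv k h3) _ (hv j h2) e2 e3))
      (by
        rintro ⟨r, hr, e1, e2, e3⟩ ⟨r', hr', e1', e2', e3'⟩ ⟨r'', hr'', e1'', e2'', e3''⟩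
        simp only [decide_eq_true_eq, decide_eq_false_iff_not] at e1 e2 e3 e1' e2' e3' e1'' e2'' e3''
        exact cyc hD (hv i h1) (hv j h2) (hv k h3) hr hr' hr'' e1 e3 e3' e2' e1'' e2'')
      (by
        rintro ⟨r, hr, e1, e2, e3⟩ ⟨r', hr', e1', e2', e3'⟩ ⟨r'', hr'', e1'', e2'', e3''⟩
        simp only [decide_eq_true_eq, decide_eq_false_iff_not] at e1 e2 e3 e1' e2' e3' e1'' e2'' e3''
        rw [← anti (hD.1 _ hr) (hv _ h2) (hv _ h3) (hi j h2 k h3 h23)] at e3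
        rw [← anti (hD.1 _ hr'') (hv _ h2) (hv _ h3) (hi j h2 k h3 h23)] at e3''
        exact cyc hD (hv i h1) (hv k h3) (hv j h2) hr hr'' hr' e2 e3 e3'' e1'' e2' e1')
    refine ⟨l, hl, ?_⟩
    rintro _ ⟨r, hr, rfl⟩
    exact h _ _ _ ⟨r, hr, rfl, rfl, rfl⟩
  · intro u hu q hq
    have hq' := hq
    obtain ⟨q0, q1, q2, q3, q4⟩ := q
    obtain ⟨o1, o2, o3, o4, o5⟩ := hq'
    simp only at o1 o2 o3 o4 o5
    let qq : ℕ → ℕ := fun i => if i = 0 then q0 else if i = 1 then q1 else if i = 2 then q2 else if i = 3 then q3 else q4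
    have hqq : ∀ i < 5, qq i < 9 := by
      intro i _; dsimp only [qq]; split_ifs <;> omega
    have hqi : ∀ i < 5, ∀ j < 5, i ≠ j → qq i ≠ qq j := by
      intro i _ j _ hij; dsimp only [qq]; split_ifs <;> omega
    let x : ℕ → α := fun i => v (u (qq i))
    have hx : ∀ i < 5, x i ∈ X := fun i h => hv _ (hu.1 _ (hqq i h))
    have hn : ∀ i < 5, ∀ j < 5, i ≠ j → x i ≠ x j := fun i h j h' e =>
      hi _ (hu.1 _ (hqq i h)) _ (hu.1 _ (hqq j h')) (hu.2 _ (hqq i h) _ (hqq j h') (hqi i h j h' e))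
    have hcard : (x '' Set.Iio 5).ncard = 5 := by
      rw [Set.ncard_image_of_injOn, ← Finset.coe_Iio, Set.ncard_coe_finset]
      · rfl
      · intro i h j h' e
        by_contra hne
        exact hn i h j h' hne e
    have h17 := hA (x '' Set.Iio 5) (by rintro _ ⟨i, h, rfl⟩; exact hx i h) hcard
    let S : ℕ → (α → α → Prop) → Prop := fun p r => r ∈ D ∧ ∃ c, PT[p]? = some c ∧ Mat (fun i j => decide (r (v i) (v j))) u (q0,q1,q2,q3,q4) c
    let F : Finset ℕ := (Finset.range 120).filter fun p => ∃ r, S p r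
    let g : ℕ → α → α → Prop := fun p => if h : ∃ r, S p r then restrictRel (x '' Set.Iio 5) h.choose else fun _ _ => False
    refine ⟨F, Finset.filter_subset _ _, ?_, ?_⟩
    · have hsub : restrictDom (x '' Set.Iio 5) D ⊆ g '' (F : Set ℕ) := by
        rintro _ ⟨r, hr, rfl⟩
        obtain ⟨p, hp, c, hc, hM⟩ := mat_ex (hlin r hr) hu hq
        have hS : ∃ r, S p r := ⟨r, hr, c, hc, hM⟩
        refine ⟨p, Finset.mem_coe.2 (Finset.mem_filter.2 ⟨Finset.mem_range.2 hp, hS⟩), ?_⟩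
        dsimp only [g]
        rw [dif_pos hS]
        obtain ⟨hr', c', hc', hM'⟩ := hS.choose_spec
        generalize hS.choose = r' at hr' hM'
        have ec : c = c' := Option.some.inj (hc.symm.trans hc')
        subst ec
        refine restr_eq (hD.1 _ hr') (hD.1 _ hr) x hx hn ?_
        unfold Mat at hM hM'
        obtain ⟨m0, m1, m2, m3, m4, m5, m6, m7, m8, m9⟩ := hM
        obtain ⟨n0, n1, n2, n3, n4, n5, n6, n7, n8, n9⟩ := hM'
        intro j hj i hij
        have hj5 : j = 0 ∨ j = 1 ∨ j = 2 ∨ j = 3 ∨ j = 4 := by omega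
        have hi5 : i = 0 ∨ i = 1 ∨ i = 2 ∨ i = 3 := by omega
        rcases hj5 with rfl | rfl | rfl | rfl | rfl <;> rcases hi5 with rfl | rfl | rfl | rfl <;>
          first
          | exact absurd hij (by decide)
          | exact decide_eq_decide.1 (n0.symm.trans m0)
          | exact decide_eq_decide.1 (n1.symm.trans m1)
          | exact decide_eq_decide.1 (n2.symm.trans m2)
          | exact decide_eq_decide.1 (n3.symm.trans m3)
          | exact decide_eq_decide.1 (n4.symm.trans m4)
          | exact decide_eq_decide.1 (n5.symm.trans m5)
          | exact decide_eq_decide.1 (n6.symm.trans m6)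
          | exact decide_eq_decide.1 (n7.symm.trans m7)
          | exact decide_eq_decide.1 (n8.symm.trans m8)
          | exact decide_eq_decide.1 (n9.symm.trans m9)
      calc 17 ≤ _ := h17
        _ ≤ (g '' (F : Set ℕ)).ncard := Set.ncard_le_ncard hsub ((Finset.finite_toSet F).image g)
        _ ≤ (F : Set ℕ).ncard := Set.ncard_image_le (Finset.finite_toSet F)
        _ = F.card := Set.ncard_coe_finset F
    · intro p hp
      obtain ⟨r, hr, c, hc, hM⟩ := (Finset.mem_filter.1 hp).2
      exact ⟨c, hc, _, ⟨r, hr, rfl⟩, hM⟩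

theorem top (H : ∀ R, ¬ Hyp R) {α : Type*} (X : Set α) (hX : X.Finite)
    (hXcard : 9 ≤ X.ncard) (D : Set (α → α → Prop)) (hD : IsCondorcetDomain X D) :
    ∃ A : Set α, A ⊆ X ∧ A.ncard = 5 ∧ (restrictDom A D).ncard ≤ 16 := by
  by_contra hno
  push Not at hno
  obtain ⟨Y, hY, hc⟩ := Set.exists_subset_card_eq hXcard
  have hYf : Y.Finite := hX.subset hY
  haveI := hYf.to_subtype
  let e : Y ≃ Fin 9 := Finite.equivFinOfCardEq hc
  refine H _ (mkHyp hD (fun A h1 h2 => hno A h1 h2) (fun i => (e.symm (Fin.ofNat 9 i) : α)) (fun i _ => hY (e.symm _).2) ?_)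
  intro i hi j hj hij h
  have := e.symm.injective (Subtype.ext h)
  have := congrArg Fin.val this
  simp only [Fin.val_ofNat] at this
  omega
end CD

namespace CD

set_option maxRecDepth 100000
theorem run_0 : runR 0 6 = true := by decide +kernel
theorem run_6 : runR 6 6 = true := by decide +kernel
theorem run_12 : runR 12 6 = true := by decide +kernel
theorem run_18 : runR 18 6 = true := by decide +kernel
theorem run_24 : runR 24 6 = true := by decide +kernel
theorem run_30 : runR 30 6 = true := by decide +kernel
theorem run_36 : runR 36 6 = true := by decide +kernel
theorem run_42 : runR 42 6 = true := by decide +kernel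
theorem run_48 : runR 48 6 = true := by decide +kernel
theorem run_54 : runR 54 6 = true := by decide +kernel
theorem run_60 : runR 60 6 = true := by decide +kernel
theorem run_66 : runR 66 6 = true := by decide +kernel
theorem run_72 : runR 72 6 = true := by decide +kernel
theorem run_78 : runR 78 6 = true := by decide +kernel
theorem run_84 : runR 84 6 = true := by decide +kernel
theorem run_90 : runR 90 6 = true := by decide +kernel
theorem run_96 : runR 96 6 = true := by decide +kernel
theorem runV_ok : runV = true := by decide +kernel
theorem runCert_ok : runCert = true := by decide +kernel
theorem runQP_ok : runQP = true := by decide +kernel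
theorem runQ_ok : runQ = true := by decide +kernel

theorem hr_all (i : ℕ) (h : i < 102) : runI i := by
  by_cases h0 : i < 6
  · have := runR_all 0 6 run_0 (i - 0) (by omega)
    rwa [show 0 + (i - 0) = i by omega] at this
  by_cases h6 : i < 12
  · have := runR_all 6 6 run_6 (i - 6) (by omega)
    rwa [show 6 + (i - 6) = i by omega] at this
  by_cases h12 : i < 18
  · have := runR_all 12 6 run_12 (i - 12) (by omega)
    rwa [show 12 + (i - 12) = i by omega] at this
  by_cases h18 : i < 24
  · have := runR_all 18 6 run_18 (i - 18) (by omega)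
    rwa [show 18 + (i - 18) = i by omega] at this
  by_cases h24 : i < 30
  · have := runR_all 24 6 run_24 (i - 24) (by omega)
    rwa [show 24 + (i - 24) = i by omega] at this
  by_cases h30 : i < 36
  · have := runR_all 30 6 run_30 (i - 30) (by omega)
    rwa [show 30 + (i - 30) = i by omega] at this
  by_cases h36 : i < 42
  · have := runR_all 36 6 run_36 (i - 36) (by omega)
    rwa [show 36 + (i - 36) = i by omega] at this
  by_cases h42 : i < 48
  · have := runR_all 42 6 run_42 (i - 42) (by omega)
    rwa [show 42 + (i - 42) = i by omega] at this
  by_cases h48 : i < 54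
  · have := runR_all 48 6 run_48 (i - 48) (by omega)
    rwa [show 48 + (i - 48) = i by omega] at this
  by_cases h54 : i < 60
  · have := runR_all 54 6 run_54 (i - 54) (by omega)
    rwa [show 54 + (i - 54) = i by omega] at this
  by_cases h60 : i < 66
  · have := runR_all 60 6 run_60 (i - 60) (by omega)
    rwa [show 60 + (i - 60) = i by omega] at this
  by_cases h66 : i < 72
  · have := runR_all 66 6 run_66 (i - 66) (by omega)
    rwa [show 66 + (i - 66) = i by omega] at this
  by_cases h72 : i < 78
  · have := runR_all 72 6 run_72 (i - 72) (by omega)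
    rwa [show 72 + (i - 72) = i by omega] at this
  by_cases h78 : i < 84
  · have := runR_all 78 6 run_78 (i - 78) (by omega)
    rwa [show 78 + (i - 78) = i by omega] at this
  by_cases h84 : i < 90
  · have := runR_all 84 6 run_84 (i - 84) (by omega)
    rwa [show 84 + (i - 84) = i by omega] at this
  by_cases h90 : i < 96
  · have := runR_all 90 6 run_90 (i - 90) (by omega)
    rwa [show 90 + (i - 90) = i by omega] at this
  by_cases h96 : i < 102
  · have := runR_all 96 6 run_96 (i - 96) (by omega)
    rwa [show 96 + (i - 96) = i by omega] at this
  omega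

end CD

/-- For `n ≥ 9`, no Condorcet domain on an `n`-element set is `(5,17)`-abundant:
it has a 5-element subset whose restriction contains at most 16 orders. -/
theorem no_five_seventeen_abundant {α : Type*} (X : Set α) (hX : X.Finite)
    (hXcard : 9 ≤ X.ncard) (D : Set (α → α → Prop)) (hD : IsCondorcetDomain X D) :
    ∃ A : Set α, A ⊆ X ∧ A.ncard = 5 ∧ (restrictDom A D).ncard ≤ 16 := by
  exact CD.top (fun R h => CD.no_Hyp CD.runQ_ok CD.runQP_ok CD.runV_ok CD.runCert_ok CD.hr_all R h) X hX hXcard D hD
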